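/- arXiv:2508.05180 — 2 statements merged into one kernel-verified Lean document; each statement's English description precedes it below -/
import Mathlib

section
/- Let x ∈ S_n be a 2-adic element and let P be the unique Sylow 2-subgroup of S_n containing x. Then Irr^x(S_n) = Irr_{2'}(S_n) and Irr^x(P) = Irr_{2'}(P). Moreover χ(x) ∈ {1, −1} for every χ ∈ Irr^x(S_n) and ψ(x) ∈ {1, −1} for every ψ ∈ Irr^x(P). -/
open CategoryTheory

noncomputable section

/-- The set of irreducible complex characters of a group `G`. -/
def Irr (G : Type) [Group G] : Set (G → ℂ) :=
  {χ | ∃ V : FDRep ℂ G, Simple V ∧ V.character = χ}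

/-- The irreducible characters of `G` that do not vanish at `g`. -/
def IrrX (G : Type) [Group G] (g : G) : Set (G → ℂ) :=
  {χ | χ ∈ Irr G ∧ χ g ≠ 0}

/-- The irreducible characters of `G` of degree not divisible by `p`. -/
def IrrP' (p : ℕ) (G : Type) [Group G] : Set (G → ℂ) :=
  {χ | ∃ V : FDRep ℂ G, Simple V ∧ V.character = χ ∧ ¬ (p ∣ Module.finrank ℂ V)}

/-- The degree of a character, recovered from its value at `1`. -/
def charDeg {G : Type} [Group G] (χ : G → ℂ) : ℕ := ⌊(χ 1).re⌋₊

/-- The `p`-part of a natural number. -/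
def pPart (p m : ℕ) : ℕ := p ^ (m.factorization p)

/-- `x` is a picky `p`-element: a `p`-element lying in a unique Sylow `p`-subgroup. -/
def IsPicky (p : ℕ) {G : Type*} [Group G] (x : G) : Prop :=
  (∃ k, orderOf x = p ^ k) ∧ ∃! Q : Sylow p G, x ∈ Q

/-- `H` is a normal subgroup of `K` (both subgroups of an ambient group `G`). -/
def NormalIn {G : Type*} [Group G] (H K : Subgroup G) : Prop :=
  H ≤ K ∧ ∀ k ∈ K, ∀ h ∈ H, k * h * k⁻¹ ∈ H

/-- `H` is subnormal in `K`: there is a finite chain of subgroups from `H` to `K`,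
each normal in the next. -/
def IsSubnormalIn {G : Type*} [Group G] (H K : Subgroup G) : Prop :=
  Relation.ReflTransGen NormalIn H K

/-- The subnormalizer of `x` in `G`: the subgroup generated by all `g` such that
`⟨x⟩` is subnormal in `⟨x, g⟩`. -/
def subnormalizer {G : Type*} [Group G] (x : G) : Subgroup G :=
  Subgroup.closure {g | IsSubnormalIn (Subgroup.zpowers x) (Subgroup.closure {x, g})}

lemma mem_subnormalizer_self {G : Type*} [Group G] (x : G) : x ∈ subnormalizer x :=
  Subgroup.subset_closure (by
    show IsSubnormalIn (Subgroup.zpowers x) (Subgroup.closure {x, x})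
    rw [Set.pair_eq_singleton, ← Subgroup.zpowers_eq_closure]
    exact Relation.ReflTransGen.refl)

/-- The full cycle type of a permutation of `Fin n`: the multiset of the lengths of
all its cycles, with fixed points counted as cycles of length `1`. -/
def fullCycleType {n : ℕ} (x : Equiv.Perm (Fin n)) : Multiset ℕ :=
  x.cycleType + Multiset.replicate (n - x.support.card) 1

/-- The multiset of cycle lengths of a `p`-adic element of `S_n`: `a_i` cycles of
length `p ^ i`, where `n = Σ a_i p ^ i` is the `p`-adic expansion of `n`. -/
def padicCycleMultiset (p n : ℕ) : Multiset ℕ :=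
  ∑ i ∈ Finset.range (Nat.digits p n).length,
    Multiset.replicate ((Nat.digits p n).getD i 0) (p ^ i)

/-- A `p`-adic element of `S_n`. -/
def IsPAdic (p : ℕ) {n : ℕ} (x : Equiv.Perm (Fin n)) : Prop :=
  fullCycleType x = padicCycleMultiset p n

/-- A picky element of Type II: a `2`-adic element on `n - 2` points together with
two fixed points. -/
def IsTypeII {n : ℕ} (x : Equiv.Perm (Fin n)) : Prop :=
  fullCycleType x = padicCycleMultiset 2 (n - 2) + Multiset.replicate 2 1

/-- A picky element of Type III: a `3`-adic element on `n - 3` points together with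
three fixed points. -/
def IsTypeIII {n : ℕ} (x : Equiv.Perm (Fin n)) : Prop :=
  fullCycleType x = padicCycleMultiset 3 (n - 3) + Multiset.replicate 3 1

namespace TwoAdic

open Finset MvPolynomial

/-! ### Complete symmetric sums and the Jacobi-Trudi identity -/

section JacobiTrudi

variable {ι R : Type*} [Fintype ι] [DecidableEq ι] [CommRing R]

/-- The geometric series `∑ a ^ m t ^ m`. -/
def geomSeries (a : R) : PowerSeries R := PowerSeries.mk fun m => a ^ m

lemma one_sub_mul_geomSeries (a : R) :
    (1 - PowerSeries.C a * PowerSeries.X) * geomSeries a = 1 := by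
  ext m
  rw [sub_mul, one_mul, mul_assoc, map_sub, PowerSeries.coeff_C_mul]
  cases m with
  | zero => simp [geomSeries]
  | succ m =>
    rw [PowerSeries.coeff_succ_X_mul]
    simp [geomSeries, PowerSeries.coeff_one, pow_succ']

/-- The complete homogeneous sum of degree `m` in the elements `x i`. -/
def completeSum (x : ι → R) (m : ℕ) : R := ∑ k ∈ piAntidiag univ m, ∏ i, x i ^ k i

lemma coeff_prod_geomSeries (x : ι → R) (m : ℕ) :
    PowerSeries.coeff m (∏ i, geomSeries (x i)) = completeSum x m := by
  rw [PowerSeries.coeff_prod, completeSum]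
  refine Finset.sum_bij' (fun l _ => ⇑l) (fun k _ => Finsupp.equivFunOnFinite.symm k) ?_ ?_ ?_ ?_ ?_
  · intro l hl
    simpa using (mem_finsuppAntidiag.1 hl).1
  · intro k hk
    simpa [mem_finsuppAntidiag] using hk
  · intro l _
    ext; simp
  · intro k _
    ext; simp
  · intro l _
    simp [geomSeries]

/-- The complete sums with a shifted index, extended by zero to negative degrees. -/
def shiftedCompleteSum (x : ι → R) (g k : ℕ) : R := if k ≤ g then completeSum x (g - k) else 0

/-- The product of the `1 - x i t` over all `i ≠ l`. -/
def complementProd (x : ι → R) (l : ι) : Polynomial R :=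
  ∏ i ∈ univ.erase l, (1 - Polynomial.C (x i) * Polynomial.X)

lemma natDegree_complementProd_lt (x : ι → R) (l : ι) :
    (complementProd x l).natDegree < Fintype.card ι := by
  have h : (complementProd x l).natDegree ≤ ∑ i ∈ univ.erase l, 1 := by
    refine (Polynomial.natDegree_prod_le _ _).trans (Finset.sum_le_sum fun i _ => ?_)
    compute_degree
  rw [Finset.sum_const, smul_eq_mul, mul_one, card_erase_of_mem (mem_univ _), card_univ] at h
  have : 0 < Fintype.card ι := Fintype.card_pos_iff.2 ⟨l⟩
  omega

lemma complementProd_mul (x : ι → R) (l : ι) :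
    (complementProd x l : PowerSeries R) * ∏ i, geomSeries (x i) = geomSeries (x l) := by
  have h : (complementProd x l : PowerSeries R) =
      ∏ i ∈ univ.erase l, (1 - PowerSeries.C (x i) * PowerSeries.X) := by
    rw [complementProd, ← Polynomial.coeToPowerSeries.ringHom_apply, map_prod]
    simp
  rw [h, ← Finset.mul_prod_erase univ _ (mem_univ l), mul_left_comm, ← Finset.prod_mul_distrib]
  simp [one_sub_mul_geomSeries]

end JacobiTrudi

section JacobiTrudiFin

variable {R : Type*} [CommRing R] {N : ℕ}

lemma sum_coeff_mul_shiftedCompleteSum (x : Fin N → R) (l : Fin N) (g : ℕ) :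
    ∑ k : Fin N, shiftedCompleteSum x g k * (complementProd x l).coeff k = x l ^ g := by
  have h := congrArg (PowerSeries.coeff g) (complementProd_mul x l)
  rw [PowerSeries.coeff_mul] at h
  simp only [coeff_prod_geomSeries, Polynomial.coeff_coe] at h
  rw [show PowerSeries.coeff g (geomSeries (x l)) = x l ^ g by simp [geomSeries]] at h
  rw [← h, Finset.Nat.sum_antidiagonal_eq_sum_range_succ_mk,
    Fin.sum_univ_eq_sum_range
      (fun k => shiftedCompleteSum x g k * (complementProd x l).coeff k) N]
  have hd := natDegree_complementProd_lt x l
  rw [Fintype.card_fin] at hd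
  have e1 : ∑ k ∈ range N, shiftedCompleteSum x g k * (complementProd x l).coeff k =
      ∑ k ∈ range (N + g + 1), shiftedCompleteSum x g k * (complementProd x l).coeff k := by
    refine Finset.sum_subset (by simp; omega) fun k _ hk => ?_
    rw [Polynomial.coeff_eq_zero_of_natDegree_lt, mul_zero]
    simp at hk; omega
  have e2 : ∑ k ∈ range (g + 1), shiftedCompleteSum x g k * (complementProd x l).coeff k =
      ∑ k ∈ range (N + g + 1), shiftedCompleteSum x g k * (complementProd x l).coeff k := by
    refine Finset.sum_subset (by simp) fun k _ hk => ?_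
    rw [shiftedCompleteSum, if_neg, zero_mul]
    simp at hk; omega
  rw [e1, ← e2]
  refine Finset.sum_congr rfl fun k hk => ?_
  rw [shiftedCompleteSum, if_pos (by simp at hk; omega), mul_comm]

/-- The generalized Vandermonde determinant with exponents `γ`. -/
def alternant (x : Fin N → R) (γ : Fin N → ℕ) : R :=
  (Matrix.of fun i l => x l ^ γ i).det

/-- The Jacobi-Trudi identity. -/
lemma alternant_eq (x : Fin N → R) (γ : Fin N → ℕ) :
    alternant x γ = (Matrix.of fun i k : Fin N => shiftedCompleteSum x (γ i) k).det *
      alternant x (fun i => i) := by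
  have key : ∀ γ : Fin N → ℕ, (Matrix.of fun i l => x l ^ γ i) =
      (Matrix.of fun i k : Fin N => shiftedCompleteSum x (γ i) k) *
        (Matrix.of fun k l : Fin N => (complementProd x l).coeff k) := by
    intro γ
    ext i l
    simp [Matrix.mul_apply, sum_coeff_mul_shiftedCompleteSum]
  have h1 : (Matrix.of fun i k : Fin N => shiftedCompleteSum x (i : ℕ) k).det = 1 := by
    rw [Matrix.det_of_isLowerTriangular]
    · refine Finset.prod_eq_one fun i _ => ?_
      simp [shiftedCompleteSum, completeSum]
    · intro i k hik
      have : (i : ℕ) < k := hik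
      rw [Matrix.of_apply, shiftedCompleteSum, if_neg (by omega)]
  have h2 := key (fun i => i)
  unfold alternant
  rw [h2, key γ, Matrix.det_mul, Matrix.det_mul, h1, one_mul]

end JacobiTrudiFin

/-! ### Counting functions with prescribed fibre sizes -/

section Content

variable {M : Type*} [Fintype M] [DecidableEq M] {n : ℕ}

/-- The fibre sizes of a function on `Fin n`. -/
def content (f : Fin n → M) (m : M) : ℕ := #{i | f i = m}

lemma sum_content (f : Fin n → M) : ∑ m, content f m = n := by
  have := Finset.card_eq_sum_card_fiberwise (f := f) (s := univ) (t := univ) (by simp)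
  simpa [content] using this.symm

lemma prod_comp_content {R : Type*} [CommMonoid R] (f : Fin n → M) (w : M → R) :
    ∏ i, w (f i) = ∏ m, w m ^ content f m := by
  simpa [content] using Finset.prod_comp w f (s := univ) |>.trans
    (Finset.prod_subset (subset_univ _) (by
      intro m _ hm
      have : #{i | f i = m} = 0 := by
        rw [Finset.card_eq_zero, Finset.filter_eq_empty_iff]
        intro i _ h
        exact hm (by simp [← h])
      simp [this]))

lemma card_content_eq (A : M → ℕ) (hA : ∑ m, A m = n) :
    (#{f : Fin n → M | content f = A}) * ∏ m, (A m).factorial = n.factorial := by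
  have h1 : (∑ m, (X m : MvPolynomial M ℕ)) ^ n = ∑ f : Fin n → M, ∏ i, X (f i) := by
    rw [Finset.sum_pow', Fintype.piFinset_univ]
  rw [Finset.sum_pow_eq_sum_piAntidiag] at h1
  have mon : ∀ k : M → ℕ, ∏ m, (X m : MvPolynomial M ℕ) ^ k m =
      monomial (Finsupp.equivFunOnFinite.symm k) 1 := by
    intro k
    rw [MvPolynomial.monomial_eq]
    simp [Finsupp.prod_fintype]
  have h2 := congrArg (coeff (Finsupp.equivFunOnFinite.symm A)) h1
  simp only [prod_comp_content, mon, coeff_sum] at h2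
  have e1 : ∀ k : M → ℕ, coeff (Finsupp.equivFunOnFinite.symm A)
      ((Nat.multinomial univ k : MvPolynomial M ℕ) *
        monomial (Finsupp.equivFunOnFinite.symm k) 1) =
      if k = A then Nat.multinomial univ k else 0 := by
    intro k
    rw [← map_natCast (C : ℕ →+* MvPolynomial M ℕ), coeff_C_mul, coeff_monomial]
    simp
  have e2 : ∀ f : Fin n → M, coeff (Finsupp.equivFunOnFinite.symm A)
      (monomial (Finsupp.equivFunOnFinite.symm (content f)) (1 : ℕ)) =
      if content f = A then 1 else 0 := by
    intro f
    rw [coeff_monomial]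
    simp
  rw [Finset.sum_congr rfl fun k _ => e1 k, Finset.sum_congr rfl fun f _ => e2 f,
    Finset.sum_ite_eq', if_pos (by simpa using hA), ← Finset.card_filter] at h2
  rw [← h2, mul_comm, Nat.multinomial_spec, hA]

lemma card_perm_comp_eq (f : Fin n → M) :
    #{g : Equiv.Perm (Fin n) | f ∘ g = f} = ∏ m, (content f m).factorial := by
  have := DomMulAct.stabilizer_card f
  rw [Fintype.card_subtype] at this
  rw [this]
  refine Finset.prod_congr rfl fun m _ => ?_
  rw [Fintype.card_subtype, content]

/-- Burnside's lemma, weighted by an arbitrary function of the fibre sizes. -/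
lemma sum_perm_sum_fixed {R : Type*} [CommSemiring R] (φ : (M → ℕ) → R) :
    ∑ g : Equiv.Perm (Fin n), ∑ f : Fin n → M with f ∘ g = f, φ (content f) =
      n.factorial * ∑ A ∈ piAntidiag univ n, φ A := by
  simp_rw [Finset.sum_filter]
  rw [Finset.sum_comm]
  simp_rw [← Finset.sum_filter, Finset.sum_const, card_perm_comp_eq]
  rw [← Finset.sum_fiberwise_of_maps_to (g := fun f : Fin n → M => content f)
    (t := piAntidiag univ n) (by intro f _; simp [sum_content]), Finset.mul_sum]
  refine Finset.sum_congr rfl fun A hA => ?_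
  have h : ∀ f ∈ ({f | content f = A} : Finset (Fin n → M)),
      (∏ m, (content f m).factorial) • φ (content f) = (∏ m, (A m).factorial) • φ A := by
    intro f hf
    rw [(mem_filter.1 hf).2]
  rw [Finset.sum_congr rfl h, Finset.sum_const, ← card_content_eq A (by simpa using hA),
    smul_smul, nsmul_eq_mul]

end Content

/-! ### Frobenius characters of the symmetric group -/

section Frobenius

variable {N n : ℕ}

/-- The sum over all `g`-invariant functions `f` of the products of the `x (f i)`. -/
def permWeight {R : Type*} [CommSemiring R] (x : Fin N → R) (g : Equiv.Perm (Fin n)) : R :=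
  ∑ f : Fin n → Fin N with f ∘ g = f, ∏ i, x (f i)

/-- The number of `g`-invariant functions with fibre sizes `α`. -/
def fixedCount (α : Fin N → ℕ) (g : Equiv.Perm (Fin n)) : ℕ :=
  #{f : Fin n → Fin N | f ∘ g = f ∧ content f = α}

lemma fixedCount_mul_permWeight {R : Type*} [CommSemiring R] (x : Fin N → R) (α : Fin N → ℕ)
    (g : Equiv.Perm (Fin n)) :
    (fixedCount α g : R) * permWeight x g =
      ∑ F : Fin n → Fin N × Fin N with F ∘ g = F,
        if (fun i => ∑ j, content F (i, j)) = α then ∏ j, x j ^ ∑ i, content F (i, j) else 0 := by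
  have h1 : ∀ F : Fin n → Fin N × Fin N,
      (fun i => ∑ j, content F (i, j)) = content (Prod.fst ∘ F) := by
    intro F
    ext i
    simp only [content, Function.comp]
    rw [← Finset.card_biUnion]
    · congr 1; ext a; simp [Prod.ext_iff]
    · intro j _ j' _ hjj
      refine Finset.disjoint_left.2 fun a ha hb => hjj ?_
      simp only [mem_filter, mem_univ, true_and] at ha hb
      simpa using (ha.symm.trans hb)
  have h2 : ∀ (F : Fin n → Fin N × Fin N) j,
      ∑ i, content F (i, j) = content (Prod.snd ∘ F) j := by
    intro F j
    simp only [content, Function.comp]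
    rw [← Finset.card_biUnion]
    · congr 1; ext a; simp [Prod.ext_iff]
    · intro i _ i' _ hii
      refine Finset.disjoint_left.2 fun a ha hb => hii ?_
      simp only [mem_filter, mem_univ, true_and] at ha hb
      simpa using (ha.symm.trans hb)
  simp_rw [h1, h2, ← prod_comp_content]
  rw [← Finset.sum_filter, Finset.filter_filter, fixedCount, Finset.card_eq_sum_ones,
    Nat.cast_sum, permWeight, Finset.sum_mul_sum, ← Finset.sum_product']
  refine Finset.sum_bij' (fun p _ => fun i => (p.1 i, p.2 i))
    (fun F _ => (Prod.fst ∘ F, Prod.snd ∘ F)) ?_ ?_ ?_ ?_ ?_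
  · rintro ⟨f, f'⟩ h
    simp only [mem_product, mem_filter, mem_univ, true_and] at h ⊢
    refine ⟨?_, h.1.2⟩
    funext i
    have a := congrFun h.1.1 i
    have b := congrFun h.2 i
    simp only [Function.comp] at a b ⊢
    rw [a, b]
  · intro F h
    simp only [mem_product, mem_filter, mem_univ, true_and] at h ⊢
    rw [Function.comp_assoc, Function.comp_assoc, h.1]
    exact ⟨⟨rfl, h.2⟩, rfl⟩
  · intro p _; rfl
  · intro F _; rfl
  · rintro ⟨f, f'⟩ _
    simp [Function.comp]

lemma sum_fixedCount_mul_permWeight {R : Type*} [CommRing R] (x : Fin N → R) (α : Fin N → ℕ)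
    (hα : ∑ i, α i = n) :
    ∑ g : Equiv.Perm (Fin n), (fixedCount α g : R) * permWeight x g =
      n.factorial * ∏ i, completeSum x (α i) := by
  simp_rw [fixedCount_mul_permWeight]
  rw [sum_perm_sum_fixed (fun A : Fin N × Fin N → ℕ => if (fun i => ∑ j, A (i, j)) = α then
    ∏ j, x j ^ ∑ i, A (i, j) else 0), ← Finset.sum_filter]
  congr 1
  simp only [completeSum]
  rw [Finset.prod_univ_sum]
  refine Finset.sum_bij' (fun A _ => fun i j => A (i, j)) (fun p _ => fun ij => p ij.1 ij.2)
    ?_ ?_ ?_ ?_ ?_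
  · intro A hA
    simp only [mem_filter] at hA
    simp [Fintype.mem_piFinset, ← hA.2]
  · intro p hp
    simp only [Fintype.mem_piFinset, mem_piAntidiag] at hp
    simp [Fintype.sum_prod_type, hp, hα]
  · intro A _; rfl
  · intro p _; rfl
  · intro A _
    simp_rw [← Finset.prod_pow_eq_pow_sum]
    exact Finset.prod_comm

variable (N) in
/-- The Vandermonde determinant in the variables `X i`. -/
def vandermondePoly : MvPolynomial (Fin N) ℂ := alternant X (fun i => i)

lemma prod_X_pow (k : Fin N → ℕ) : ∏ i, (X i : MvPolynomial (Fin N) ℂ) ^ k i =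
    monomial (Finsupp.equivFunOnFinite.symm k) 1 := by
  rw [MvPolynomial.monomial_eq]
  simp [Finsupp.prod_fintype]

lemma alternant_X (γ : Fin N → ℕ) :
    alternant (X : Fin N → MvPolynomial (Fin N) ℂ) γ =
      ∑ w : Equiv.Perm (Fin N), monomial (Finsupp.equivFunOnFinite.symm (γ ∘ w))
        ((Equiv.Perm.sign w : ℤ) : ℂ) := by
  rw [alternant, Matrix.det_apply']
  refine Finset.sum_congr rfl fun w _ => ?_
  have h : ∏ i, (Matrix.of fun i l => (X l : MvPolynomial (Fin N) ℂ) ^ γ i) (w i) i =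
      ∏ i, (X i : MvPolynomial (Fin N) ℂ) ^ (γ ∘ w) i := rfl
  rw [h, prod_X_pow, ← map_intCast (C : ℂ →+* MvPolynomial (Fin N) ℂ), C_mul_monomial, mul_one]

/-- The Frobenius class function attached to the exponent vector `β`. -/
def frobeniusChar (β : Fin N → ℕ) (g : Equiv.Perm (Fin n)) : ℂ :=
  coeff (Finsupp.equivFunOnFinite.symm β) (vandermondePoly N * permWeight X g)

lemma coeff_permWeight (α : Fin N →₀ ℕ) (g : Equiv.Perm (Fin n)) :
    coeff α (permWeight (X : Fin N → MvPolynomial (Fin N) ℂ) g) = fixedCount α g := by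
  simp only [permWeight, prod_comp_content, prod_X_pow, coeff_sum, coeff_monomial]
  rw [fixedCount, Finset.sum_boole, Finset.filter_filter]
  congr 3
  ext f
  simp [Equiv.symm_apply_eq, funext_iff]

lemma frobeniusChar_eq (β : Fin N → ℕ) (g : Equiv.Perm (Fin n)) :
    frobeniusChar β g = ∑ w : Equiv.Perm (Fin N), ((Equiv.Perm.sign w : ℤ) : ℂ) *
      if (∀ i, (w i : ℕ) ≤ β i) then (fixedCount (fun i => β i - w i) g : ℂ) else 0 := by
  rw [frobeniusChar, vandermondePoly, alternant_X, Finset.sum_mul, coeff_sum]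
  refine Finset.sum_congr rfl fun w _ => ?_
  rw [coeff_monomial_mul', coeff_permWeight]
  simp only [Finsupp.le_def, Finsupp.equivFunOnFinite_symm_apply_apply, Function.comp]
  split_ifs <;> simp
  rfl

lemma sum_frobeniusChar_mul_permWeight (γ : Fin N → ℕ) (hγ : ∑ i, γ i = n + ∑ i : Fin N, (i : ℕ)) :
    ∑ g : Equiv.Perm (Fin n), C (frobeniusChar γ g) *
        permWeight (X : Fin N → MvPolynomial (Fin N) ℂ) g =
      n.factorial * (Matrix.of fun i k : Fin N =>
        shiftedCompleteSum (X : Fin N → MvPolynomial (Fin N) ℂ) (γ i) k).det := by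
  simp_rw [frobeniusChar_eq, map_sum, Finset.sum_mul]
  rw [Finset.sum_comm, ← Matrix.det_transpose, Matrix.det_apply', Finset.mul_sum]
  refine Finset.sum_congr rfl fun w _ => ?_
  simp only [map_mul, mul_assoc, map_intCast, Matrix.transpose_apply, Matrix.of_apply]
  rw [← Finset.mul_sum, mul_left_comm]
  congr 1
  by_cases h : ∀ i, (w i : ℕ) ≤ γ i
  · simp only [h, implies_true, if_true, map_natCast]
    rw [sum_fixedCount_mul_permWeight]
    · congr 1
      refine Finset.prod_congr rfl fun i _ => ?_
      rw [shiftedCompleteSum, if_pos (h i)]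
    · have h1 : ∑ i, (w i : ℕ) = ∑ i : Fin N, (i : ℕ) := Equiv.sum_comp w (fun i => (i : ℕ))
      have h2 : ∑ i, (γ i - w i) + ∑ i, (w i : ℕ) = ∑ i, γ i := by
        rw [← Finset.sum_add_distrib]
        exact Finset.sum_congr rfl fun i _ => Nat.sub_add_cancel (h i)
      omega
  · simp only [h, if_false, map_zero, zero_mul, Finset.sum_const_zero]
    push Not at h
    obtain ⟨i, hi⟩ := h
    rw [Finset.prod_eq_zero (mem_univ i), mul_zero]
    rw [shiftedCompleteSum, if_neg (by omega)]

lemma sum_frobeniusChar_mul_frobeniusChar (γ β : Fin N → ℕ)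
    (hγ : ∑ i, γ i = n + ∑ i : Fin N, (i : ℕ)) (hγm : StrictMono γ) (hβm : StrictMono β) :
    ∑ g : Equiv.Perm (Fin n), frobeniusChar γ g * frobeniusChar β g =
      if γ = β then (n.factorial : ℂ) else 0 := by
  have h := alternant_eq (X : Fin N → MvPolynomial (Fin N) ℂ) γ
  have h2 := congrArg (fun p => coeff (Finsupp.equivFunOnFinite.symm β) (C (n.factorial : ℂ) * p)) h
  rw [← mul_assoc, map_natCast, ← sum_frobeniusChar_mul_permWeight γ hγ, Finset.sum_mul,
    coeff_sum] at h2
  have h3 : ∀ g : Equiv.Perm (Fin n), coeff (Finsupp.equivFunOnFinite.symm β)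
      (C (frobeniusChar γ g) * permWeight (X : Fin N → MvPolynomial (Fin N) ℂ) g *
        alternant X fun i => (i : ℕ)) = frobeniusChar γ g * frobeniusChar β g := by
    intro g
    rw [mul_assoc, coeff_C_mul, mul_comm (permWeight _ _)]
    rfl
  rw [Finset.sum_congr rfl fun g _ => h3 g] at h2
  rw [← h2, ← map_natCast (C : ℂ →+* MvPolynomial (Fin N) ℂ), coeff_C_mul, alternant_X, coeff_sum]
  have h4 : ∀ w : Equiv.Perm (Fin N), γ ∘ w = β → w = 1 := by
    intro w hw
    have hwm : StrictMono w := fun i j hij => by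
      have := hβm hij
      rw [← hw] at this
      exact hγm.lt_iff_lt.1 this
    ext i
    have := congrArg (fun e : Fin N ≃o Fin N => e i)
      (Subsingleton.elim (hwm.orderIsoOfSurjective w w.surjective) (OrderIso.refl _))
    simpa using congrArg Fin.val this
  split_ifs with hγβ
  · rw [Finset.sum_eq_single 1]
    · simp [coeff_monomial, hγβ]
    · intro w _ hw
      rw [coeff_monomial, if_neg]
      exact fun he => hw (h4 w (by simpa using he))
    · simp
  · rw [Finset.sum_eq_zero, mul_zero]
    intro w _
    rw [coeff_monomial, if_neg]
    intro he
    have he' : γ ∘ w = β := by simpa using he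
    rw [h4 w he'] at he'
    exact hγβ (by simpa using he')

end Frobenius

/-! ### Coefficients of power sum products -/

section PowerSums

variable {N : ℕ}

lemma coeff_vandermondePoly (β : Fin N →₀ ℕ) :
    (coeff β (vandermondePoly N) = 0 ∨ coeff β (vandermondePoly N) = 1 ∨
      coeff β (vandermondePoly N) = -1) ∧
    (coeff β (vandermondePoly N) ≠ 0 → ∑ i, β i = ∑ i : Fin N, (i : ℕ)) := by
  rw [vandermondePoly, alternant_X, coeff_sum]
  simp only [coeff_monomial]
  by_cases h : ∃ w : Equiv.Perm (Fin N),
      Finsupp.equivFunOnFinite.symm ((fun i : Fin N => (i : ℕ)) ∘ w) = β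
  · obtain ⟨w, rfl⟩ := h
    rw [Finset.sum_eq_single w]
    · rw [if_pos rfl]
      refine ⟨?_, fun _ => ?_⟩
      · rcases Int.units_eq_one_or (Equiv.Perm.sign w) with h | h <;> simp [h]
      · simpa using Equiv.sum_comp w (fun i : Fin N => (i : ℕ))
    · intro w' _ hw'
      rw [if_neg]
      intro he
      refine hw' (Equiv.ext fun i => ?_)
      have := congrFun (Finsupp.equivFunOnFinite.symm.injective he) i
      exact Fin.ext this
    · simp
  · push Not at h
    rw [Finset.sum_eq_zero fun w _ => if_neg (h w)]
    simp

lemma rename_swap_vandermondePoly {i j : Fin N} (hij : i ≠ j) :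
    rename (Equiv.swap i j) (vandermondePoly N) = -vandermondePoly N := by
  have h := Matrix.det_permute' (Equiv.swap i j)
    (Matrix.of fun i l : Fin N => (X l : MvPolynomial (Fin N) ℂ) ^ (i : ℕ))
  rw [Equiv.Perm.sign_swap hij] at h
  unfold vandermondePoly alternant
  rw [AlgHom.map_det]
  have e : (rename (Equiv.swap i j)).mapMatrix
      (Matrix.of fun i l : Fin N => (X l : MvPolynomial (Fin N) ℂ) ^ (i : ℕ)) =
      (Matrix.of fun i l : Fin N => (X l : MvPolynomial (Fin N) ℂ) ^ (i : ℕ)).submatrix id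
        (Equiv.swap i j) := by
    ext a b : 2
    simp [AlgHom.mapMatrix_apply]
  rw [e, h]
  simp

/-- Coefficients of an antisymmetric polynomial vanish at non-injective exponents. -/
lemma injective_of_coeff_ne_zero {A : MvPolynomial (Fin N) ℂ}
    (hA : ∀ i j : Fin N, i ≠ j → rename (Equiv.swap i j) A = -A) {β : Fin N →₀ ℕ}
    (h : coeff β A ≠ 0) : Function.Injective β := by
  intro i j hij
  by_contra hne
  have h1 := coeff_rename_mapDomain (Equiv.swap i j) (Equiv.swap i j).injective A β
  have h2 : β.mapDomain (Equiv.swap i j) = β := by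
    rw [← Finsupp.equivMapDomain_eq_mapDomain]
    ext a
    rw [Finsupp.equivMapDomain_apply, Equiv.symm_swap]
    by_cases ha : a = i
    · rw [ha, Equiv.swap_apply_left, hij]
    by_cases hb : a = j
    · rw [hb, Equiv.swap_apply_right, hij]
    rw [Equiv.swap_apply_of_ne_of_ne ha hb]
  rw [h2, hA i j hne, coeff_neg] at h1
  exact h (by linear_combination (-1 / 2 : ℂ) * h1)

lemma sum_fin_le_of_injective {f : Fin N → ℕ} (hf : Function.Injective f) :
    ∑ i : Fin N, (i : ℕ) ≤ ∑ i, f i := by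
  have hc : #(univ.image f) = N := by rw [Finset.card_image_of_injective _ hf]; simp
  have h1 : ∑ i, f i = ∑ a ∈ univ.image f, a := (Finset.sum_image (f := fun a => a) hf.injOn).symm
  rw [h1, ← Finset.sum_coe_sort (univ.image f) (fun a => a),
    ← ((univ.image f).orderIsoOfFin hc).toEquiv.sum_comp (fun a => (a : ℕ))]
  refine Finset.sum_le_sum fun i _ => ?_
  have hm : StrictMono fun i : Fin N => ((univ.image f).orderIsoOfFin hc i : ℕ) :=
    fun a b hab => ((univ.image f).orderIsoOfFin hc).strictMono hab
  obtain ⟨i, hi⟩ := i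
  induction i with
  | zero => simp
  | succ k ih =>
    have := hm (show (⟨k, by omega⟩ : Fin N) < ⟨k + 1, hi⟩ by simp)
    have := ih (by omega) (mem_univ _)
    simp only [RelIso.coe_fn_toEquiv] at *
    omega

lemma coeff_mul_psum (A : MvPolynomial (Fin N) ℂ) (m : ℕ) (β : Fin N →₀ ℕ) :
    coeff β (A * psum (Fin N) ℂ m) =
      ∑ i, if m ≤ β i then coeff (β - Finsupp.single i m) A else 0 := by
  rw [psum, Finset.mul_sum, coeff_sum]
  refine Finset.sum_congr rfl fun i _ => ?_
  rw [X_pow_eq_monomial, coeff_mul_monomial']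
  simp

lemma coeff_vandermondePoly_mul_psums (s : Finset ℕ) :
    (∀ i j : Fin N, i ≠ j → rename (Equiv.swap i j)
      (vandermondePoly N * ∏ k ∈ s, psum (Fin N) ℂ (2 ^ k)) =
        -(vandermondePoly N * ∏ k ∈ s, psum (Fin N) ℂ (2 ^ k))) ∧
    ∀ β : Fin N →₀ ℕ,
      (coeff β (vandermondePoly N * ∏ k ∈ s, psum (Fin N) ℂ (2 ^ k)) = 0 ∨
        coeff β (vandermondePoly N * ∏ k ∈ s, psum (Fin N) ℂ (2 ^ k)) = 1 ∨
        coeff β (vandermondePoly N * ∏ k ∈ s, psum (Fin N) ℂ (2 ^ k)) = -1) ∧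
      (coeff β (vandermondePoly N * ∏ k ∈ s, psum (Fin N) ℂ (2 ^ k)) ≠ 0 →
        ∑ i, β i = ∑ i : Fin N, (i : ℕ) + ∑ k ∈ s, 2 ^ k) := by
  have anti : ∀ s : Finset ℕ, ∀ i j : Fin N, i ≠ j → rename (Equiv.swap i j)
      (vandermondePoly N * ∏ k ∈ s, psum (Fin N) ℂ (2 ^ k)) =
        -(vandermondePoly N * ∏ k ∈ s, psum (Fin N) ℂ (2 ^ k)) := by
    intro s i j hij
    rw [map_mul, rename_swap_vandermondePoly hij, map_prod]
    simp [rename_psum]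
  refine ⟨anti s, ?_⟩
  induction s using Finset.induction_on_max with
  | empty => simpa using coeff_vandermondePoly
  | insert K s hlt ih =>
    intro β
    have hK : K ∉ s := fun h => lt_irrefl _ (hlt K h)
    have hanti := anti (insert K s)
    have hs := anti s
    rw [Finset.prod_insert hK, mul_comm (psum _ _ _), ← mul_assoc] at hanti ⊢
    rw [Finset.sum_insert hK]
    set A := vandermondePoly N * ∏ k ∈ s, psum (Fin N) ℂ (2 ^ k) with hA
    have hsum : ∑ k ∈ s, 2 ^ k < 2 ^ K := Nat.geomSum_lt le_rfl hlt
    set c : Fin N → ℂ := fun i =>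
      if 2 ^ K ≤ β i then coeff (β - Finsupp.single i (2 ^ K)) A else 0 with hc
    have hcoeff : coeff β (A * psum (Fin N) ℂ (2 ^ K)) = ∑ i, c i := coeff_mul_psum _ _ _
    by_cases h0 : coeff β (A * psum (Fin N) ℂ (2 ^ K)) = 0
    · exact ⟨Or.inl h0, fun h => absurd h0 h⟩
    have hβ := injective_of_coeff_ne_zero hanti h0
    have sub_apply : ∀ i l : Fin N,
        (β - Finsupp.single i (2 ^ K) : Fin N →₀ ℕ) l = if l = i then β l - 2 ^ K else β l := by
      intro i l
      rw [Finsupp.tsub_apply, Finsupp.single_apply]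
      split_ifs <;> simp_all
    have hc' : ∀ i, c i ≠ 0 → 2 ^ K ≤ β i ∧ coeff (β - Finsupp.single i (2 ^ K)) A ≠ 0 ∧
        c i = coeff (β - Finsupp.single i (2 ^ K)) A := by
      intro i hi
      simp only [hc] at hi ⊢
      split_ifs at hi ⊢ with h
      · exact ⟨h, hi, rfl⟩
      · exact absurd rfl hi
    have hdeg : ∀ i, c i ≠ 0 →
        ∑ l, β l = ∑ l : Fin N, (l : ℕ) + (2 ^ K + ∑ k ∈ s, 2 ^ k) := by
      intro i hi
      obtain ⟨h1, h2, -⟩ := hc' i hi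
      have h3 := (ih _).2 h2
      have h4 : β i + ∑ l ∈ univ.erase i, β l = ∑ l, β l :=
        Finset.add_sum_erase univ _ (mem_univ i)
      have h5 : ∑ l ∈ univ.erase i, (β - Finsupp.single i (2 ^ K) : Fin N →₀ ℕ) l =
          ∑ l ∈ univ.erase i, β l :=
        Finset.sum_congr rfl fun l hl => by rw [sub_apply, if_neg (Finset.ne_of_mem_erase hl)]
      rw [← Finset.add_sum_erase univ _ (mem_univ i), sub_apply, if_pos rfl, h5] at h3
      omega
    have huniq : ∀ i j, c i ≠ 0 → c j ≠ 0 → i = j := by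
      intro i j hi hj
      by_contra hij
      obtain ⟨hi1, hi2, -⟩ := hc' i hi
      obtain ⟨hj1, hj2, -⟩ := hc' j hj
      have inji := injective_of_coeff_ne_zero hs hi2
      have injj := injective_of_coeff_ne_zero hs hj2
      have hd := hdeg i hi
      let f : Fin N → ℕ := fun l => if l = i ∨ l = j then β l - 2 ^ K else β l
      have hf : Function.Injective f := by
        intro a b hab
        have hia : ∀ b, b ≠ i → β i - 2 ^ K ≠ β b := fun b hb h =>
          hb (inji (by rw [sub_apply, sub_apply, if_neg hb, if_pos rfl, h]))
        have hja : ∀ b, b ≠ j → β j - 2 ^ K ≠ β b := fun b hb h =>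
          hb (injj (by rw [sub_apply, sub_apply, if_neg hb, if_pos rfl, h]))
        simp only [f] at hab
        split_ifs at hab with ha hb hb
        · refine hβ ?_
          have ha' : 2 ^ K ≤ β a := by rcases ha with rfl | rfl <;> assumption
          have hb' : 2 ^ K ≤ β b := by rcases hb with rfl | rfl <;> assumption
          omega
        · push Not at hb
          rcases ha with rfl | rfl
          · exact absurd hab (hia b hb.1)
          · exact absurd hab (hja b hb.2)
        · push Not at ha
          rcases hb with rfl | rfl
          · exact absurd hab.symm (hia a ha.1)
          · exact absurd hab.symm (hja a ha.2)
        · exact hβ hab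
      have h1 := sum_fin_le_of_injective hf
      have h2 : ∑ l, f l + 2 * 2 ^ K = ∑ l, β l := by
        rw [← Finset.add_sum_erase univ f (mem_univ i), ← Finset.add_sum_erase univ β (mem_univ i),
          ← Finset.add_sum_erase (univ.erase i) f (mem_erase.2 ⟨Ne.symm hij, mem_univ j⟩),
          ← Finset.add_sum_erase (univ.erase i) β (mem_erase.2 ⟨Ne.symm hij, mem_univ j⟩)]
        have h3 : ∑ l ∈ (univ.erase i).erase j, f l = ∑ l ∈ (univ.erase i).erase j, β l := by
          refine Finset.sum_congr rfl fun l hl => ?_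
          simp only [mem_erase] at hl
          simp [f, hl.1, hl.2.1]
        have h4 : f i = β i - 2 ^ K := if_pos (Or.inl rfl)
        have h5 : f j = β j - 2 ^ K := if_pos (Or.inr rfl)
        rw [h3, h4, h5]
        omega
      omega
    obtain ⟨i, -, hi⟩ := Finset.exists_ne_zero_of_sum_ne_zero (hcoeff ▸ h0)
    have hval : coeff β (A * psum (Fin N) ℂ (2 ^ K)) = c i := by
      rw [hcoeff]
      refine Finset.sum_eq_single i (fun j _ hj => ?_) (by simp)
      by_contra hcj
      exact hj (huniq j i hcj hi)
    refine ⟨?_, fun _ => hdeg i hi⟩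
    rw [hval, (hc' i hi).2.2]
    exact (ih _).1

end PowerSums

/-! ### Values at permutations whose cycle lengths are distinct powers of two -/

section DistinctPowers

variable {N n : ℕ}

open scoped Classical in
/-- The cycles of `x`, including the fixed points, have distinct lengths, which are powers
of two. -/
structure HasDistinctTwoPowerCycles (x : Equiv.Perm (Fin n)) : Prop where
  card_eq : ∀ a, ∃ k, #{i | x.SameCycle a i} = 2 ^ k
  sameCycle : ∀ a b, #{i | x.SameCycle a i} = #{i | x.SameCycle b i} → x.SameCycle a b

lemma comp_eq_iff_forall_sameCycle {M : Type*} (x : Equiv.Perm (Fin n)) (f : Fin n → M) :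
    f ∘ x = f ↔ ∀ a b, x.SameCycle a b → f a = f b := by
  refine ⟨fun h => ?_, fun h => ?_⟩
  · have key : ∀ (m : ℕ) a, f ((x ^ m) a) = f a := by
      intro m
      induction m with
      | zero => simp
      | succ m ih => intro a; rw [pow_succ, Equiv.Perm.mul_apply, ih]; exact congrFun h a
    intro a b hab
    obtain ⟨m, -, rfl⟩ := hab.exists_pow_eq'
    exact (key m a).symm
  · funext a
    exact (h a (x a) (Equiv.Perm.sameCycle_apply_right.2 (Equiv.Perm.SameCycle.refl x a))).symm

open scoped Classical in
lemma permWeight_eq_prod {R : Type*} [CommSemiring R] (w : Fin N → R) (x : Equiv.Perm (Fin n)) :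
    permWeight w x = ∏ q : Quotient (Equiv.Perm.SameCycle.setoid x),
      ∑ j, w j ^ #{i | Quotient.mk (Equiv.Perm.SameCycle.setoid x) i = q} := by
  rw [Finset.prod_univ_sum, Fintype.piFinset_univ, permWeight]
  symm
  refine Finset.sum_bij (fun h _ => fun i => h (Quotient.mk _ i)) ?_ ?_ ?_ ?_
  · intro h _
    simp only [mem_filter, mem_univ, true_and]
    rw [comp_eq_iff_forall_sameCycle]
    intro a b hab
    exact congrArg h (Quotient.sound hab)
  · intro h _ h' _ e
    funext q
    induction q using Quotient.inductionOn with
    | h a => exact congrFun e a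
  · intro f hf
    simp only [mem_filter, mem_univ, true_and] at hf
    rw [comp_eq_iff_forall_sameCycle] at hf
    exact ⟨Quotient.lift f hf, mem_univ _, rfl⟩
  · intro h _
    rw [← Finset.prod_comp (fun q => w (h q))
      (fun i => Quotient.mk (Equiv.Perm.SameCycle.setoid x) i) (s := univ) |>.trans
        (Finset.prod_subset (subset_univ _) ?_)]
    intro q _ hq
    have : #{i | Quotient.mk (Equiv.Perm.SameCycle.setoid x) i = q} = 0 := by
      rw [Finset.card_eq_zero, Finset.filter_eq_empty_iff]
      intro i _ hi
      exact hq (mem_image.2 ⟨i, mem_univ _, hi⟩)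
    rw [this, pow_zero]

lemma HasDistinctTwoPowerCycles.exists_permWeight_eq {x : Equiv.Perm (Fin n)}
    (hx : HasDistinctTwoPowerCycles x) :
    ∃ s : Finset ℕ, permWeight (X : Fin N → MvPolynomial (Fin N) ℂ) x =
      ∏ k ∈ s, psum (Fin N) ℂ (2 ^ k) := by
  classical
  have hcard : ∀ a, #{i | Quotient.mk (Equiv.Perm.SameCycle.setoid x) i = Quotient.mk _ a} =
      #{i | x.SameCycle a i} := by
    intro a
    congr 1
    ext i
    simp only [mem_filter, mem_univ, true_and]
    rw [Quotient.eq]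
    exact Equiv.Perm.sameCycle_comm
  have h : ∀ q : Quotient (Equiv.Perm.SameCycle.setoid x), ∃ k,
      #{i | Quotient.mk (Equiv.Perm.SameCycle.setoid x) i = q} = 2 ^ k := by
    intro q
    induction q using Quotient.inductionOn with
    | h a => rw [hcard]; exact hx.card_eq a
  choose κ hκ using h
  have hinj : Function.Injective κ := by
    intro p q hpq
    induction p using Quotient.inductionOn with
    | h a =>
    induction q using Quotient.inductionOn with
    | h b =>
    refine Quotient.sound (hx.sameCycle a b ?_)
    rw [← hcard, ← hcard, hκ, hκ, hpq]
  refine ⟨univ.image κ, ?_⟩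
  rw [permWeight_eq_prod, Finset.prod_image hinj.injOn]
  refine Finset.prod_congr rfl fun q _ => ?_
  rw [hκ, psum]

lemma HasDistinctTwoPowerCycles.frobeniusChar_mem {x : Equiv.Perm (Fin n)}
    (hx : HasDistinctTwoPowerCycles x) (β : Fin N → ℕ) :
    frobeniusChar β x = 0 ∨ frobeniusChar β x = 1 ∨ frobeniusChar β x = -1 := by
  obtain ⟨s, hs⟩ := hx.exists_permWeight_eq (N := N)
  rw [frobeniusChar, hs]
  exact ((coeff_vandermondePoly_mul_psums s).2 _).1

end DistinctPowers

/-! ### Integrality -/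

section Integrality

variable {N n : ℕ}

lemma invertible_natCard (G : Type*) [Group G] [Finite G] : Nonempty (Invertible (Nat.card G : ℂ)) :=
  ⟨invertibleOfNonzero (Nat.cast_ne_zero.2 Nat.card_pos.ne')⟩

lemma content_comp_perm {M : Type*} [DecidableEq M] (f : Fin n → M) (g : Equiv.Perm (Fin n)) :
    content (f ∘ g) = content f := by
  funext m
  exact Finset.card_bij (fun i _ => g i) (by simp) (by simp) fun i hi =>
    ⟨g⁻¹ i, by simpa using hi, by simp⟩

lemma trace_funLeft {ι : Type*} [Fintype ι] [DecidableEq ι] (σ : ι → ι) :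
    LinearMap.trace ℂ (ι → ℂ) (LinearMap.funLeft ℂ ℂ σ) = #{i | σ i = i} := by
  rw [LinearMap.trace_eq_matrix_trace ℂ (Pi.basisFun ℂ ι), Matrix.trace, Finset.card_filter]
  push_cast
  refine Finset.sum_congr rfl fun i _ => ?_
  rw [Matrix.diag_apply, LinearMap.toMatrix_apply]
  simp [Pi.single_apply]

/-- The permutation representation on functions with fibre sizes `α`. -/
def contentRep (α : Fin N → ℕ) :
    Representation ℂ (Equiv.Perm (Fin n)) ({f : Fin n → Fin N // content f = α} → ℂ) where
  toFun g := LinearMap.funLeft ℂ ℂ fun f => ⟨f.1 ∘ g, (content_comp_perm f.1 g).trans f.2⟩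
  map_one' := rfl
  map_mul' _ _ := rfl

lemma character_contentRep (α : Fin N → ℕ) (g : Equiv.Perm (Fin n)) :
    (FDRep.of (contentRep (n := n) α)).character g = fixedCount α g := by
  classical
  refine (trace_funLeft _).trans ?_
  rw [fixedCount]
  congr 1
  refine Finset.card_bij (fun f _ => f.1) (fun f hf => ?_) (fun f _ f' _ h => Subtype.ext h)
    fun f hf => ?_
  · simp only [mem_filter, mem_univ, true_and] at hf ⊢
    exact ⟨congrArg Subtype.val hf, f.2⟩
  · simp only [mem_filter, mem_univ, true_and] at hf
    exact ⟨⟨f, hf.2⟩, mem_filter.2 ⟨mem_univ _, Subtype.ext hf.1⟩, rfl⟩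

lemma character_inv (V : FDRep ℂ (Equiv.Perm (Fin n))) (g : Equiv.Perm (Fin n)) :
    V.character g⁻¹ = V.character g := by
  have h : IsConj g g⁻¹ := by
    rw [Equiv.Perm.isConj_iff_cycleType_eq, Equiv.Perm.cycleType_inv]
  obtain ⟨c, hc⟩ := isConj_iff.1 h
  rw [← hc, FDRep.char_conj]

lemma sum_character_mul_fixedCount (V : FDRep ℂ (Equiv.Perm (Fin n))) (α : Fin N → ℕ) :
    ∃ k : ℤ, ∑ g, V.character g * fixedCount α g = n.factorial * k := by
  obtain ⟨_⟩ := invertible_natCard (Equiv.Perm (Fin n))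
  have h := FDRep.scalar_product_char_eq_finrank_equivariant V (FDRep.of (contentRep (n := n) α))
  refine ⟨Module.finrank ℂ (V ⟶ FDRep.of (contentRep (n := n) α)), ?_⟩
  rw [Int.cast_natCast, ← h, Nat.card_eq_fintype_card, Fintype.card_perm, Fintype.card_fin,
    mul_inv_cancel_left₀ (Nat.cast_ne_zero.2 n.factorial_ne_zero)]
  refine Finset.sum_congr rfl fun g _ => ?_
  rw [character_contentRep, character_inv, mul_comm]

lemma sum_character_mul_frobeniusChar (V : FDRep ℂ (Equiv.Perm (Fin n))) (β : Fin N → ℕ) :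
    ∃ k : ℤ, ∑ g, V.character g * frobeniusChar β g = n.factorial * k := by
  have h : ∀ w : Equiv.Perm (Fin N), ∃ k : ℤ, ∑ g : Equiv.Perm (Fin n), V.character g *
      (((Equiv.Perm.sign w : ℤ) : ℂ) *
      if (∀ i, (w i : ℕ) ≤ β i) then (fixedCount (fun i => β i - w i) g : ℂ) else 0) =
        n.factorial * k := by
    intro w
    split_ifs
    · obtain ⟨k, hk⟩ := sum_character_mul_fixedCount V (fun i => β i - w i)
      refine ⟨Equiv.Perm.sign w * k, ?_⟩
      push_cast
      rw [mul_left_comm, ← hk, Finset.mul_sum]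
      exact Finset.sum_congr rfl fun g _ => by ring
    · exact ⟨0, by simp⟩
  choose k hk using h
  refine ⟨∑ w, k w, ?_⟩
  simp_rw [frobeniusChar_eq, Finset.mul_sum]
  rw [Finset.sum_comm]
  simp_rw [hk]
  push_cast
  rw [Finset.mul_sum]

end Integrality

/-! ### Irreducible characters of symmetric groups are Frobenius characters up to sign -/

section Completeness

variable {N n : ℕ}

/-- The strictly increasing sequence obtained from a multiset by sorting and adding `i` to the
`i`-th entry. -/
def betaSeq (n : ℕ) (M : Multiset ℕ) (i : Fin n) : ℕ := (M.sort (· ≤ ·)).getD i 0 + i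

lemma strictMono_betaSeq {M : Multiset ℕ} (hM : Multiset.card M = n) :
    StrictMono (betaSeq n M) := by
  intro i j hij
  have hl : (M.sort (· ≤ ·)).length = n := by rw [Multiset.length_sort, hM]
  have hs : (M.sort (· ≤ ·)).Pairwise (· ≤ ·) := Multiset.pairwise_sort M _
  have hij' : (i : ℕ) < j := hij
  have h := List.pairwise_iff_getElem.1 hs i j (by omega) (by omega) hij
  simp only [betaSeq]
  rw [List.getD_eq_getElem _ _ (by omega), List.getD_eq_getElem _ _ (by omega)]
  omega

lemma sum_betaSeq {M : Multiset ℕ} (hM : Multiset.card M = n) :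
    ∑ i, betaSeq n M i = M.sum + ∑ i : Fin n, (i : ℕ) := by
  have hl : (M.sort (· ≤ ·)).length = n := by rw [Multiset.length_sort, hM]
  simp only [betaSeq]
  rw [Finset.sum_add_distrib]
  congr 1
  conv_rhs => rw [← Multiset.sort_eq M (· ≤ ·), Multiset.sum_coe]
  subst hl
  rw [← congrArg List.sum (List.ofFn_getElem (xs := M.sort (· ≤ ·))), List.sum_ofFn]
  exact Finset.sum_congr rfl fun i _ => by rw [List.getD_eq_getElem _ _ i.2]

lemma eq_of_betaSeq_eq {M M' : Multiset ℕ} (hM : Multiset.card M = n)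
    (hM' : Multiset.card M' = n) (h : betaSeq n M = betaSeq n M') : M = M' := by
  rw [← Multiset.sort_eq M (· ≤ ·), ← Multiset.sort_eq M' (· ≤ ·)]
  congr 1
  have hl : (M.sort (· ≤ ·)).length = n := by rw [Multiset.length_sort, hM]
  have hl' : (M'.sort (· ≤ ·)).length = n := by rw [Multiset.length_sort, hM']
  refine List.ext_getElem (by rw [hl, hl']) fun i hi hi' => ?_
  have := congrFun h ⟨i, by omega⟩
  simp only [betaSeq] at this
  rw [List.getD_eq_getElem _ _ hi, List.getD_eq_getElem _ _ hi'] at this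
  omega

/-- The parts of the partition of a permutation of `Fin n`, padded by zeros to `n` entries. -/
def paddedParts (g : Equiv.Perm (Fin n)) : Multiset ℕ :=
  g.partition.parts + Multiset.replicate (n - Multiset.card g.partition.parts) 0

lemma card_paddedParts (g : Equiv.Perm (Fin n)) : Multiset.card (paddedParts g) = n := by
  have h1 : Multiset.card g.partition.parts • 1 ≤ g.partition.parts.sum :=
    Multiset.card_nsmul_le_sum fun a ha => g.partition.parts_pos ha
  have h2 := g.partition.parts_sum.trans (Fintype.card_fin n)
  rw [paddedParts, Multiset.card_add, Multiset.card_replicate]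
  simp only [smul_eq_mul, mul_one] at h1
  omega

lemma sum_paddedParts (g : Equiv.Perm (Fin n)) : (paddedParts g).sum = n := by
  rw [paddedParts, Multiset.sum_add, Multiset.sum_replicate, smul_zero, add_zero]
  exact g.partition.parts_sum.trans (Fintype.card_fin n)

lemma isConj_of_paddedParts_eq {g h : Equiv.Perm (Fin n)} (e : paddedParts g = paddedParts h) :
    IsConj g h := by
  rw [Equiv.Perm.partition_eq_of_isConj]
  have key : ∀ g : Equiv.Perm (Fin n), (paddedParts g).filter (0 < ·) = g.partition.parts := by
    intro g
    rw [paddedParts, Multiset.filter_add, Multiset.filter_eq_self.2 fun a ha =>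
      g.partition.parts_pos ha, Multiset.filter_eq_nil.2 fun a ha => by
        rw [Multiset.eq_of_mem_replicate ha]; exact lt_irrefl 0]
    exact add_zero _
  exact Nat.Partition.ext (by rw [← key g, ← key h, e])

lemma permWeight_conj {R : Type*} [CommSemiring R] (w : Fin N → R) (g c : Equiv.Perm (Fin n)) :
    permWeight w (c * g * c⁻¹) = permWeight w g := by
  refine Finset.sum_bij' (fun f _ => f ∘ c) (fun f _ => f ∘ ⇑c⁻¹) ?_ ?_ ?_ ?_ ?_
  · intro f hf
    simp only [mem_filter, mem_univ, true_and] at hf ⊢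
    conv_rhs => rw [← hf]
    funext i
    simp
  · intro f hf
    simp only [mem_filter, mem_univ, true_and] at hf ⊢
    conv_rhs => rw [← hf]
    funext i
    simp
  · intro f _
    funext i
    simp
  · intro f _
    funext i
    simp
  · intro f _
    exact (Equiv.prod_comp c fun i => w (f i)).symm

lemma frobeniusChar_eq_of_isConj (β : Fin N → ℕ) {g h : Equiv.Perm (Fin n)} (e : IsConj g h) :
    frobeniusChar β g = frobeniusChar β h := by
  obtain ⟨c, rfl⟩ := isConj_iff.1 e
  rw [frobeniusChar, frobeniusChar, permWeight_conj]

lemma isConj_out (g : Equiv.Perm (Fin n)) : IsConj (Quotient.out (ConjClasses.mk g)) g :=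
  ConjClasses.mk_eq_mk_iff_isConj.1 (Quotient.out_eq (ConjClasses.mk g))

/-- The exponent sequence attached to a conjugacy class. -/
def classBeta (q : ConjClasses (Equiv.Perm (Fin n))) : Fin n → ℕ :=
  betaSeq n (paddedParts (Quotient.out q))

lemma classBeta_injective : Function.Injective (classBeta (n := n)) := by
  intro q q' h
  have := isConj_of_paddedParts_eq
    (eq_of_betaSeq_eq (card_paddedParts _) (card_paddedParts _) h)
  rw [← Quotient.out_eq q, ← Quotient.out_eq q']
  exact ConjClasses.mk_eq_mk_iff_isConj.2 this

lemma sum_frobeniusChar_classBeta (q q' : ConjClasses (Equiv.Perm (Fin n))) [Decidable (q = q')] :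
    ∑ g : Equiv.Perm (Fin n), frobeniusChar (classBeta q) g * frobeniusChar (classBeta q') g =
      if q = q' then (n.factorial : ℂ) else 0 := by
  rw [sum_frobeniusChar_mul_frobeniusChar (classBeta q) (classBeta q') ?_
    (strictMono_betaSeq (card_paddedParts _)) (strictMono_betaSeq (card_paddedParts _))]
  · simp only [classBeta_injective.eq_iff]
  · rw [classBeta, sum_betaSeq (card_paddedParts _), sum_paddedParts]

lemma exists_eq_sum_frobeniusChar (χ : Equiv.Perm (Fin n) → ℂ)
    (hχ : ∀ g h, IsConj g h → χ g = χ h) :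
    ∃ c : ConjClasses (Equiv.Perm (Fin n)) → ℂ,
      ∀ g, χ g = ∑ q, c q * frobeniusChar (classBeta q) g := by
  classical
  let v : ConjClasses (Equiv.Perm (Fin n)) → ConjClasses (Equiv.Perm (Fin n)) → ℂ :=
    fun q r => frobeniusChar (classBeta q) (Quotient.out r)
  have hv : ∀ q g, v q (ConjClasses.mk g) = frobeniusChar (classBeta q) g :=
    fun q g => frobeniusChar_eq_of_isConj _ (isConj_out g)
  have hli : LinearIndependent ℂ v := by
    rw [Fintype.linearIndependent_iff]
    intro c hc q'
    have h : ∑ g : Equiv.Perm (Fin n),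
        (∑ q, c q * frobeniusChar (classBeta q) g) * frobeniusChar (classBeta q') g = 0 := by
      refine Finset.sum_eq_zero fun g _ => ?_
      have := congrFun hc (ConjClasses.mk g)
      simp only [Finset.sum_apply, Pi.smul_apply, hv, smul_eq_mul, Pi.zero_apply] at this
      rw [this, zero_mul]
    simp_rw [Finset.sum_mul, mul_assoc] at h
    rw [Finset.sum_comm] at h
    simp_rw [← Finset.mul_sum, sum_frobeniusChar_classBeta] at h
    simpa [Nat.factorial_ne_zero] using h
  have hspan := hli.span_eq_top_of_card_eq_finrank' (by simp)
  obtain ⟨c, hc⟩ := (Submodule.mem_span_range_iff_exists_fun ℂ).1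
    (hspan ▸ Submodule.mem_top (x := fun r : ConjClasses (Equiv.Perm (Fin n)) => χ (Quotient.out r)))
  refine ⟨c, fun g => ?_⟩
  have := congrFun hc (ConjClasses.mk g)
  simp only [Finset.sum_apply, Pi.smul_apply, hv, smul_eq_mul] at this
  rw [this, hχ _ _ (isConj_out g)]

theorem exists_character_eq_frobeniusChar (V : FDRep ℂ (Equiv.Perm (Fin n))) [Simple V] :
    ∃ β : Fin n → ℕ, (∀ g, V.character g = frobeniusChar β g) ∨
      ∀ g, V.character g = -frobeniusChar β g := by
  classical
  obtain ⟨c, hc⟩ := exists_eq_sum_frobeniusChar V.character fun g h e => by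
    obtain ⟨a, rfl⟩ := isConj_iff.1 e
    rw [FDRep.char_conj]
  have hfac : (n.factorial : ℂ) ≠ 0 := Nat.cast_ne_zero.2 n.factorial_ne_zero
  have inner : ∀ q', ∑ g, V.character g * frobeniusChar (classBeta q') g = n.factorial * c q' := by
    intro q'
    simp_rw [hc, Finset.sum_mul, mul_assoc]
    rw [Finset.sum_comm]
    simp_rw [← Finset.mul_sum, sum_frobeniusChar_classBeta]
    simp [mul_comm]
  have hintegral : ∀ q, ∃ k : ℤ, c q = k := by
    intro q
    obtain ⟨k, hk⟩ := sum_character_mul_frobeniusChar V (classBeta q)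
    exact ⟨k, mul_left_cancel₀ hfac ((inner q).symm.trans hk)⟩
  choose k hk using hintegral
  have hnorm : ∑ g, V.character g * V.character g = n.factorial := by
    obtain ⟨_⟩ := invertible_natCard (Equiv.Perm (Fin n))
    have h := FDRep.char_orthonormal V V
    rw [if_pos ⟨Iso.refl V⟩, Nat.card_eq_fintype_card, Fintype.card_perm, Fintype.card_fin,
      inv_mul_eq_one₀ hfac] at h
    rw [h]
    exact Finset.sum_congr rfl fun g _ => by rw [character_inv]
  have hsq : ∑ q, k q * k q = 1 := by
    have h : ∑ g, V.character g * V.character g = n.factorial * ∑ q, c q * c q := by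
      have h' : ∀ g, V.character g * V.character g =
          ∑ q, c q * (V.character g * frobeniusChar (classBeta q) g) := by
        intro g
        conv_lhs => rw [hc g, Finset.sum_mul]
        exact Finset.sum_congr rfl fun q _ => by rw [← hc g]; ring
      simp_rw [h']
      rw [Finset.sum_comm, Finset.mul_sum]
      refine Finset.sum_congr rfl fun q _ => ?_
      rw [← Finset.mul_sum, inner]
      ring
    rw [hnorm] at h
    have h' := mul_left_cancel₀ hfac ((mul_one _).trans h)
    simp only [hk] at h'
    exact_mod_cast h'.symm
  have hne : ∃ q, k q ≠ 0 := by
    by_contra! h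
    simp [h] at hsq
  obtain ⟨q, hq⟩ := hne
  have h1 := Finset.add_sum_erase univ (fun q => k q * k q) (mem_univ q)
  have hnn : ∀ r, 0 ≤ k r * k r := fun r => mul_self_nonneg _
  have hpos : 0 < k q * k q := mul_self_pos.2 hq
  have hrest : ∑ r ∈ univ.erase q, k r * k r = 0 := by
    have := Finset.sum_nonneg fun r (_ : r ∈ univ.erase q) => hnn r
    omega
  have hzero : ∀ r, r ≠ q → k r = 0 := by
    intro r hr
    have := (Finset.sum_eq_zero_iff_of_nonneg fun r _ => hnn r).1 hrest r
      (mem_erase.2 ⟨hr, mem_univ r⟩)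
    exact mul_self_eq_zero.1 this
  have hval : ∀ g, V.character g = k q * frobeniusChar (classBeta q) g := by
    intro g
    rw [hc, ← hk]
    refine Finset.sum_eq_single q (fun r _ hr => ?_) (by simp)
    rw [hk, hzero r hr]
    simp
  have hone : k q * k q = 1 := by
    omega
  refine ⟨classBeta q, ?_⟩
  rcases mul_self_eq_one_iff.1 hone with h | h
  · left; intro g; rw [hval, h]; simp
  · right; intro g; rw [hval, h]; simp

theorem HasDistinctTwoPowerCycles.character_mem {x : Equiv.Perm (Fin n)}
    (hx : HasDistinctTwoPowerCycles x) (V : FDRep ℂ (Equiv.Perm (Fin n))) [Simple V] :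
    V.character x = 0 ∨ V.character x = 1 ∨ V.character x = -1 := by
  obtain ⟨β, h⟩ := exists_character_eq_frobeniusChar V
  have := hx.frobeniusChar_mem β
  rcases h with h | h <;> rw [h] <;> rcases this with h' | h' | h' <;> simp [h']

end Completeness

end TwoAdic

namespace TwoAdic

open Finset

/-! ### Parity of character values at elements of two-power order -/

section Parity

lemma exists_sum_pow_eq {R : Type*} [CommRing R] (s : Multiset R) (k : ℕ) :
    ∃ r, s.sum ^ 2 ^ k = (s.map (· ^ 2 ^ k)).sum + 2 * r := by
  induction s using Multiset.induction_on with
  | empty => exact ⟨0, by simp⟩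
  | cons a s ih =>
    obtain ⟨r, hr⟩ := ih
    obtain ⟨r', hr'⟩ := exists_add_pow_prime_pow_eq Nat.prime_two a s.sum k
    refine ⟨r + a * s.sum * r', ?_⟩
    rw [Multiset.sum_cons, hr', hr, Multiset.map_cons, Multiset.sum_cons]
    push_cast
    ring

lemma exists_trace_pow_eq {V : Type*} [AddCommGroup V] [Module ℂ V] [FiniteDimensional ℂ V]
    (A : Module.End ℂ V) {k : ℕ} (hA : A ^ 2 ^ k = 1) :
    ∃ r : ℂ, IsIntegral ℤ r ∧
      LinearMap.trace ℂ V A ^ 2 ^ k = Module.finrank ℂ V + 2 * r := by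
  have hroot : ∀ μ ∈ A.charpoly.roots, μ ^ 2 ^ k = 1 := by
    intro μ hμ
    have h : Module.End.HasEigenvalue A μ :=
      (Module.End.hasEigenvalue_iff_isRoot_charpoly A μ).2 (Polynomial.isRoot_of_mem_roots hμ)
    obtain ⟨v, hv⟩ := h.exists_hasEigenvector
    have h1 := hv.pow_apply (2 ^ k)
    rw [hA, Module.End.one_apply] at h1
    have h2 : (μ ^ 2 ^ k - 1) • v = 0 := by rw [sub_smul, ← h1, one_smul, sub_self]
    rcases smul_eq_zero.1 h2 with h3 | h3
    · exact sub_eq_zero.1 h3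
    · exact absurd h3 hv.2
  have hintegral : ∀ μ ∈ A.charpoly.roots, IsIntegral ℤ μ := fun μ hμ =>
    IsIntegral.of_pow (n := 2 ^ k) (by positivity) (by rw [hroot μ hμ]; exact isIntegral_one)
  have hsplit : A.charpoly.Splits := IsAlgClosed.splits _
  have hcard : Multiset.card A.charpoly.roots = Module.finrank ℂ V := by
    rw [← hsplit.natDegree_eq_card_roots, LinearMap.charpoly_natDegree]
  obtain ⟨s, hs⟩ : ∃ s : Multiset (integralClosure ℤ ℂ),
      s.map (algebraMap (integralClosure ℤ ℂ) ℂ) = A.charpoly.roots :=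
    ⟨A.charpoly.roots.attach.map fun μ => ⟨μ.1, hintegral μ.1 μ.2⟩, by
      rw [Multiset.map_map]
      exact Multiset.attach_map_val _⟩
  obtain ⟨r, hr⟩ := exists_sum_pow_eq s k
  refine ⟨algebraMap _ ℂ r, r.2, ?_⟩
  rw [Module.End.trace_eq_sum_roots_charpoly_of_splits hsplit, ← hs, ← map_multiset_sum, ← map_pow,
    hr, map_add, map_mul, map_multiset_sum, Multiset.map_map]
  congr 1
  rw [← hcard, ← hs, Multiset.card_map,
    Multiset.map_congr (g := fun _ => (1 : ℂ)) rfl fun a ha => by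
      have := hroot (algebraMap _ ℂ a) (hs ▸ Multiset.mem_map_of_mem _ ha)
      simpa using this]
  simp

lemma exists_int_eq_of_isIntegral {r : ℂ} (hr : IsIntegral ℤ r) {a : ℤ} (h : 2 * r = a) :
    ∃ b : ℤ, r = b := by
  have h1 : r = algebraMap ℚ ℂ ((a : ℚ) / 2) := by
    rw [eq_comm, ← mul_right_inj' (two_ne_zero (α := ℂ)), h]
    simp
    ring
  rw [h1, isIntegral_algebraMap_iff (algebraMap ℚ ℂ).injective,
    IsIntegrallyClosed.isIntegral_iff] at hr
  obtain ⟨b, hb⟩ := hr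
  exact ⟨b, by rw [h1, ← hb]; simp⟩

variable {G : Type} [Group G]

lemma exists_character_pow_eq (V : FDRep ℂ G) {g : G} {k : ℕ} (hg : g ^ 2 ^ k = 1) :
    ∃ r : ℂ, IsIntegral ℤ r ∧ V.character g ^ 2 ^ k = Module.finrank ℂ V + 2 * r :=
  exists_trace_pow_eq (V.ρ g) (by rw [← map_pow, hg, map_one])

lemma character_ne_zero_of_odd (V : FDRep ℂ G) {g : G} {k : ℕ} (hg : g ^ 2 ^ k = 1)
    (hV : ¬ 2 ∣ Module.finrank ℂ V) : V.character g ≠ 0 := by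
  intro h
  obtain ⟨r, hr, h1⟩ := exists_character_pow_eq V hg
  rw [h, zero_pow (by positivity)] at h1
  obtain ⟨b, rfl⟩ := exists_int_eq_of_isIntegral hr (a := -(Module.finrank ℂ V : ℤ)) (by
    push_cast
    linear_combination -h1)
  have h2 : (Module.finrank ℂ V : ℤ) + 2 * b = 0 := by exact_mod_cast h1.symm
  omega

lemma odd_of_character_eq (V : FDRep ℂ G) {g : G} {k : ℕ} (hg : g ^ 2 ^ k = 1)
    (h : V.character g = 1 ∨ V.character g = -1) : ¬ 2 ∣ Module.finrank ℂ V := by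
  obtain ⟨r, hr, h1⟩ := exists_character_pow_eq V (k := k + 1)
    (by rw [pow_succ, pow_mul, hg, one_pow])
  have h2 : V.character g ^ 2 ^ (k + 1) = 1 := by
    rw [pow_succ, mul_comm, pow_mul]
    rcases h with h | h <;> simp [h]
  rw [h2] at h1
  obtain ⟨b, rfl⟩ := exists_int_eq_of_isIntegral hr (a := 1 - (Module.finrank ℂ V : ℤ)) (by
    push_cast
    linear_combination -h1)
  have h2 : (Module.finrank ℂ V : ℤ) + 2 * b = 1 := by exact_mod_cast h1.symm
  omega

end Parity

/-! ### Cycle lengths of 2-adic elements -/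

section CycleLengths

variable {n : ℕ}

lemma nodup_padicCycleMultiset : (padicCycleMultiset 2 n).Nodup := by
  rw [Multiset.nodup_iff_count_le_one]
  intro m
  rw [padicCycleMultiset, Multiset.count_sum']
  simp only [Multiset.count_replicate]
  by_cases h : ∃ j, 2 ^ j = m
  · obtain ⟨j, rfl⟩ := h
    calc _ ≤ ∑ i ∈ Finset.range (Nat.digits 2 n).length, if i = j then 1 else 0 := by
          refine Finset.sum_le_sum fun i hi => ?_
          by_cases hij : i = j
          · rw [if_pos (by rw [hij]), if_pos hij]
            have hi' := Finset.mem_range.1 hi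
            rw [List.getD_eq_getElem _ _ hi']
            have := Nat.digits_lt_base (b := 2) (by norm_num)
              (List.getElem_mem (l := Nat.digits 2 n) hi')
            omega
          · rw [if_neg hij, if_neg fun h => hij (Nat.pow_right_injective le_rfl h)]
      _ ≤ 1 := by
          rw [Finset.sum_ite_eq']
          split_ifs <;> simp
  · push Not at h
    rw [Finset.sum_eq_zero fun i _ => if_neg (h i)]
    exact zero_le_one

lemma exists_eq_two_pow_of_mem {m : ℕ} (hm : m ∈ padicCycleMultiset 2 n) : ∃ k, m = 2 ^ k := by
  obtain ⟨i, -, hi⟩ := Multiset.mem_sum.1 hm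
  exact ⟨i, Multiset.eq_of_mem_replicate hi⟩

open scoped Classical in
lemma filter_sameCycle_of_apply_eq {x : Equiv.Perm (Fin n)} {a : Fin n} (ha : x a = a) :
    ({i | x.SameCycle a i} : Finset (Fin n)) = {a} := by
  ext i
  simp only [mem_filter, mem_univ, true_and, mem_singleton]
  refine ⟨fun h => ?_, fun h => h ▸ Equiv.Perm.SameCycle.refl x a⟩
  exact (h.eq_of_left ha).symm

open scoped Classical in
lemma filter_sameCycle_of_apply_ne {x : Equiv.Perm (Fin n)} {a : Fin n} (ha : x a ≠ a) :
    ({i | x.SameCycle a i} : Finset (Fin n)) = (x.cycleOf a).support := by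
  ext i
  simp only [mem_filter, mem_univ, true_and]
  rw [Equiv.Perm.mem_support_cycleOf_iff' ha]

theorem hasDistinctTwoPowerCycles {x : Equiv.Perm (Fin n)} (hx : IsPAdic 2 x) :
    HasDistinctTwoPowerCycles x := by
  classical
  have hnd : (fullCycleType x).Nodup := hx ▸ nodup_padicCycleMultiset
  have hpow : ∀ m ∈ fullCycleType x, ∃ k, m = 2 ^ k := fun m hm =>
    exists_eq_two_pow_of_mem (hx ▸ hm)
  rw [fullCycleType, Multiset.nodup_add] at hnd
  obtain ⟨hnd1, hnd2, -⟩ := hnd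
  have hfix : n - #x.support ≤ 1 := by
    by_contra! h
    have := Multiset.nodup_iff_count_le_one.1 hnd2 1
    rw [Multiset.count_replicate_self] at this
    omega
  have hmem : ∀ a, x a ≠ a → #(x.cycleOf a).support ∈ x.cycleType := by
    intro a ha
    rw [Equiv.Perm.cycleType_def]
    exact Multiset.mem_map_of_mem _ (Finset.mem_def.1
      (Equiv.Perm.cycleOf_mem_cycleFactorsFinset_iff.2 (Equiv.Perm.mem_support.2 ha)))
  refine ⟨fun a => ?_, fun a b hab => ?_⟩
  · by_cases ha : x a = a
    · exact ⟨0, by rw [filter_sameCycle_of_apply_eq ha]; simp⟩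
    · rw [filter_sameCycle_of_apply_ne ha]
      exact hpow _ (Multiset.mem_add.2 (Or.inl (hmem a ha)))
  · by_cases ha : x a = a <;> by_cases hb : x b = b
    · have h1 : #(x.supportᶜ) ≤ 1 := by rw [Finset.card_compl, Fintype.card_fin]; exact hfix
      rw [Finset.card_le_one.1 h1 a (by simpa using ha) b (by simpa using hb)]
    · rw [filter_sameCycle_of_apply_eq ha, filter_sameCycle_of_apply_ne hb, card_singleton] at hab
      have := Equiv.Perm.two_le_of_mem_cycleType (hmem b hb)
      omega
    · rw [filter_sameCycle_of_apply_eq hb, filter_sameCycle_of_apply_ne ha, card_singleton] at hab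
      have := Equiv.Perm.two_le_of_mem_cycleType (hmem a ha)
      omega
    · rw [filter_sameCycle_of_apply_ne ha, filter_sameCycle_of_apply_ne hb] at hab
      rw [Equiv.Perm.cycleType_def] at hnd1
      have h1 := Multiset.inj_on_of_nodup_map hnd1 _
        (Equiv.Perm.cycleOf_mem_cycleFactorsFinset_iff.2 (Equiv.Perm.mem_support.2 ha)) _
        (Equiv.Perm.cycleOf_mem_cycleFactorsFinset_iff.2 (Equiv.Perm.mem_support.2 hb)) hab
      rw [← Equiv.Perm.mem_support_cycleOf_iff' ha, h1, Equiv.Perm.mem_support_cycleOf_iff' hb]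

end CycleLengths

/-! ### Nonvanishing characters are linear -/

section Linear

variable {G : Type} [Group G]

lemma finrank_invariants_linHom (V : FDRep ℂ G) [Simple V] :
    Module.finrank ℂ (Representation.linHom V.ρ V.ρ).invariants = 1 := by
  rw [(Representation.linHom.invariantsEquivFDRepHom V V).finrank_eq,
    FDRep.finrank_hom_simple_simple, if_pos ⟨Iso.refl V⟩]

lemma one_ne_zero_of_simple (V : FDRep ℂ G) [Simple V] : (1 : Module.End ℂ V) ≠ 0 := by
  intro h0
  have h1 := finrank_invariants_linHom V
  have : Subsingleton (Representation.linHom V.ρ V.ρ).invariants := by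
    refine subsingleton_of_forall_eq 0 fun A => Subtype.ext ?_
    have : (A : Module.End ℂ V) = A * 1 := (mul_one _).symm
    rw [this, h0, mul_zero]
    rfl
  rw [Module.finrank_zero_of_subsingleton] at h1
  omega

lemma exists_eq_smul_one_of_commute (V : FDRep ℂ G) [Simple V] (A : Module.End ℂ V)
    (hA : ∀ g, Commute (V.ρ g) A) : ∃ c : ℂ, A = c • 1 := by
  have hmem : ∀ A : Module.End ℂ V, (∀ g, Commute (V.ρ g) A) →
      A ∈ (Representation.linHom V.ρ V.ρ).invariants := by
    intro A hA g
    rw [Representation.linHom_apply, ← LinearMap.comp_assoc]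
    change V.ρ g * A * V.ρ g⁻¹ = A
    rw [(hA g).eq, mul_assoc, ← map_mul, mul_inv_cancel, map_one, mul_one]
  have hne : (⟨1, hmem 1 fun g => Commute.one_right _⟩ :
      (Representation.linHom V.ρ V.ρ).invariants) ≠ 0 :=
    fun h => one_ne_zero_of_simple V (congrArg Subtype.val h)
  obtain ⟨c, hc⟩ := (finrank_eq_one_iff_of_nonzero' _ hne).1
    (finrank_invariants_linHom V) ⟨A, hmem A hA⟩
  exact ⟨c, (congrArg Subtype.val hc).symm⟩

variable (G) in
/-- The intersection of the kernels of all homomorphisms to `ℤˣ`. -/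
def signKernel : Subgroup G := ⨅ f : G →* ℤˣ, f.ker

lemma mem_signKernel {z : G} : z ∈ signKernel G ↔ ∀ f : G →* ℤˣ, f z = 1 := by
  simp [signKernel, Subgroup.mem_iInf, MonoidHom.mem_ker]

theorem character_eq_of_ne_zero [Finite G] {ξ : G} (hξ : ∀ z ∈ signKernel G, IsConj ξ (ξ * z))
    (V : FDRep ℂ G) [Simple V] (h : V.character ξ ≠ 0) :
    V.character ξ = 1 ∨ V.character ξ = -1 := by
  classical
  have := Fintype.ofFinite G
  set e : Module.End ℂ V := ∑ z : signKernel G, V.ρ z with he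
  have hcomm : ∀ g, Commute (V.ρ g) e := by
    intro g
    have hn : (signKernel G).Normal := ⟨fun z hz g => mem_signKernel.2 fun f => by
      simp [mem_signKernel.1 hz f]⟩
    rw [commute_iff_eq, he, Finset.mul_sum, Finset.sum_mul]
    refine Fintype.sum_equiv (MulAut.conjNormal (H := signKernel G) g).toEquiv _ _ fun z => ?_
    rw [← map_mul, ← map_mul]
    congr 1
    simp
  have htrace : LinearMap.trace ℂ V (V.ρ ξ * e) = Fintype.card (signKernel G) * V.character ξ := by
    rw [he, Finset.mul_sum, map_sum, Finset.sum_congr rfl (g := fun _ => V.character ξ)]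
    · simp
    · intro z _
      obtain ⟨c, hc⟩ := isConj_iff.1 (hξ z z.2)
      rw [← map_mul, ← hc]
      exact FDRep.char_conj V ξ c
  obtain ⟨c, hc⟩ := exists_eq_smul_one_of_commute V e hcomm
  have hc0 : c ≠ 0 := by
    rintro rfl
    rw [hc, zero_smul, mul_zero, map_zero] at htrace
    exact mul_ne_zero (Nat.cast_ne_zero.2 Fintype.card_ne_zero) h htrace.symm
  have htriv : ∀ z ∈ signKernel G, V.ρ z = 1 := by
    intro z hz
    have h1 : V.ρ z * e = e := by
      rw [he, Finset.mul_sum]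
      refine Fintype.sum_equiv (Equiv.mulLeft ⟨z, hz⟩) _ _ fun w => ?_
      rw [← map_mul]
      rfl
    rw [hc, mul_smul_comm, mul_one] at h1
    exact smul_right_injective _ hc0 h1
  have habel : ∀ g h, Commute (V.ρ g) (V.ρ h) := by
    intro g h
    have h1 : V.ρ ((h * g)⁻¹ * (g * h)) = 1 := by
      refine htriv _ (mem_signKernel.2 fun f => ?_)
      rw [map_mul, map_inv, map_mul, map_mul, mul_comm (f h), inv_mul_cancel]
    rw [commute_iff_eq, ← map_mul, ← map_mul]
    calc V.ρ (g * h) = V.ρ (h * g * ((h * g)⁻¹ * (g * h))) := by rw [mul_inv_cancel_left]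
      _ = V.ρ (h * g) := by rw [map_mul, h1, mul_one]
  have hone : (1 : Module.End ℂ V) ≠ 0 := one_ne_zero_of_simple V
  choose s hs using fun g => exists_eq_smul_one_of_commute V (V.ρ g) fun g' => habel g' g
  have hchar : ∀ g, V.character g = s g * Module.finrank ℂ V := by
    intro g
    rw [FDRep.character, hs g, map_smul, LinearMap.trace_one, smul_eq_mul]
  have hsmul : ∀ g g', s g * s g' = s (g * g') := by
    intro g g'
    have h1 : V.ρ (g * g') = V.ρ g * V.ρ g' := map_mul _ _ _
    rw [hs, hs g, hs g', smul_mul_smul_comm, mul_one] at h1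
    exact (smul_left_injective ℂ hone h1).symm
  have hs1 : ∀ z ∈ signKernel G, s z = 1 := by
    intro z hz
    refine smul_left_injective ℂ hone ?_
    simp only
    rw [← hs, htriv z hz, one_smul]
  have hdim : (Module.finrank ℂ V : ℂ) * Module.finrank ℂ V = 1 := by
    obtain ⟨_⟩ := invertible_natCard G
    have h1 := FDRep.char_orthonormal V V
    have h2 : ∀ g, V.character g * V.character g⁻¹ = Module.finrank ℂ V * Module.finrank ℂ V := by
      intro g
      rw [hchar, hchar, mul_mul_mul_comm, hsmul, mul_inv_cancel, hs1 1 (one_mem _), one_mul]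
    rw [if_pos ⟨Iso.refl V⟩] at h1
    simp_rw [h2] at h1
    rw [Finset.sum_const, Finset.card_univ, ← Nat.card_eq_fintype_card, nsmul_eq_mul,
      inv_mul_cancel_left₀ (Nat.cast_ne_zero.2 Nat.card_pos.ne')] at h1
    exact h1
  have hdim' : Module.finrank ℂ V = 1 := by
    have : Module.finrank ℂ V * Module.finrank ℂ V = 1 := by exact_mod_cast hdim
    exact Nat.eq_one_of_mul_eq_one_right this
  rw [hchar, hdim', Nat.cast_one, mul_one]
  refine mul_self_eq_one_iff.1 ?_
  rw [hsmul]
  refine hs1 _ (mem_signKernel.2 fun f => ?_)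
  rw [map_mul, Int.units_mul_self]

end Linear

/-! ### Cyclic subgroups acting transitively on cosets -/

section Transitive

open MulAction Subgroup

/-- The cyclic group generated by `g` acts transitively on `X`. -/
abbrev ZPowersTransitive {G : Type*} [Group G] (g : G) (X : Type*) [MulAction G X] : Prop :=
  IsPretransitive (zpowers g) X

lemma minimalPeriod_eq_natCard {G X : Type*} [Group G] [MulAction G X] [Finite X] {g : G}
    (hg : ZPowersTransitive g X) (a : X) :
    Function.minimalPeriod (g • ·) a = Nat.card X := by
  have : Fintype (orbit (zpowers g) a) := Fintype.ofFinite _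
  rw [minimalPeriod_eq_card, ← Nat.card_eq_fintype_card, orbit_eq_univ, Nat.card_univ]

lemma zpowersTransitive_of_minimalPeriod_eq {G X : Type*} [Group G] [MulAction G X] [Finite X]
    {g : G} {a : X} (h : Function.minimalPeriod (g • ·) a = Nat.card X) :
    ZPowersTransitive g X := by
  have : Fintype (orbit (zpowers g) a) := Fintype.ofFinite _
  rw [minimalPeriod_eq_card, ← Nat.card_eq_fintype_card] at h
  rw [ZPowersTransitive, isPretransitive_iff_orbit_eq_univ a]
  exact Set.eq_of_subset_of_ncard_le (Set.subset_univ _)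
    (by rw [Set.ncard_univ, ← h, Nat.card_coe_set_eq])

lemma exists_hom_of_index_two {M : Type*} [Group M] {K : Subgroup M} (h : K.index = 2) :
    ∃ ε : M →* ℤˣ, ∀ m, ε m = 1 ↔ m ∈ K := by
  classical
  refine ⟨MonoidHom.mk' (fun m => if m ∈ K then 1 else -1) fun a b => ?_, fun m => ?_⟩
  · have := mul_mem_iff_of_index_two h (a := a) (b := b)
    by_cases ha : a ∈ K <;> by_cases hb : b ∈ K <;> simp_all
  · by_cases hm : m ∈ K <;> simp [hm]

variable {G : Type} [Group G] [Finite G]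

omit [Finite G] in
lemma mk_smul_pow_eq_iff {H : Subgroup G} (g c : G) (m : ℕ) :
    g ^ m • (c : G ⧸ H) = c ↔ c⁻¹ * g ^ m * c ∈ H := by
  rw [eq_comm, MulAction.Quotient.smul_coe, QuotientGroup.eq, smul_eq_mul, mul_assoc]

lemma exists_transfer_eq {M : Subgroup G} {A : Type*} [CommGroup A] (ϕ : M →* A) {g : G}
    (hg : ZPowersTransitive g (G ⧸ M)) :
    ∃ (c : G) (h : c⁻¹ * g ^ M.index * c ∈ M), ϕ.transfer g = ϕ ⟨_, h⟩ := by
  have : Fintype (Quotient (orbitRel (zpowers g) (G ⧸ M))) := Fintype.ofFinite _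
  have hs : Subsingleton (Quotient (orbitRel (zpowers g) (G ⧸ M))) :=
    (pretransitive_iff_subsingleton_quotient (zpowers g) (G ⧸ M)).1 hg
  let q : Quotient (orbitRel (zpowers g) (G ⧸ M)) := Quotient.mk _ ((1 : G) : G ⧸ M)
  have key := MonoidHom.transfer_eq_prod_quotient_orbitRel_zpowers_quot ϕ g
  rw [Fintype.prod_subsingleton _ q] at key
  have hd : Function.minimalPeriod (g • ·) q.out = M.index := by
    rw [minimalPeriod_eq_natCard hg, index]
  refine ⟨q.out.out, ?_, ?_⟩
  · rw [← hd]
    exact QuotientGroup.out_conj_pow_minimalPeriod_mem M g q.out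
  · rw [key]
    congr 2
    rw [hd]

omit [Finite G] in
lemma ZPowersTransitive.of_le {H M : Subgroup G} {ξ : G} (h : ZPowersTransitive ξ (G ⧸ H))
    (hHM : H ≤ M) : ZPowersTransitive ξ (G ⧸ M) := by
  refine ⟨?_⟩
  rintro ⟨a⟩ ⟨b⟩
  obtain ⟨g, hg⟩ := h.exists_smul_eq (a : G ⧸ H) (b : G ⧸ H)
  exact ⟨g, congrArg (Subgroup.quotientMapOfLE hHM) hg⟩

lemma exists_le_index_eq_two_pow (hG : IsPGroup 2 G) {H : Subgroup G} {k j : ℕ}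
    (hH : H.index = 2 ^ k) (hj : j ≤ k) : ∃ M, H ≤ M ∧ M.index = 2 ^ j := by
  obtain ⟨N, hN⟩ := IsPGroup.iff_card.1 hG
  obtain ⟨l, hl⟩ := IsPGroup.iff_card.1 (hG.to_subgroup H)
  have hNl : N = l + k := by
    have := H.card_mul_index
    rw [hH, hl, hN, ← pow_add] at this
    exact (Nat.pow_right_injective le_rfl this).symm
  obtain ⟨M, hM, hHM⟩ := Sylow.exists_subgroup_card_pow_prime_le 2
    (show 2 ^ (l + (k - j)) ∣ Nat.card G by rw [hN]; exact pow_dvd_pow _ (by omega)) H hl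
    (by omega)
  refine ⟨M, hHM, ?_⟩
  have := M.card_mul_index
  rw [hM, hN, show N = l + (k - j) + j by omega, pow_add 2 (l + (k - j))] at this
  exact Nat.eq_of_mul_eq_mul_left (by positivity) this

lemma ZPowersTransitive.mul_of_mem_signKernel {ξ z : G} (hz : z ∈ signKernel G)
    (hG : IsPGroup 2 G) (n : ℕ) : ∀ H : Subgroup G, H.index = 2 ^ n →
    ZPowersTransitive ξ (G ⧸ H) → ZPowersTransitive (ξ * z) (G ⧸ H) := by
  induction n with
  | zero =>
    intro H hH _
    have : Subsingleton (G ⧸ H) := by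
      rw [pow_zero, index_eq_one] at hH
      subst hH
      exact QuotientGroup.subsingleton_quotient_top
    exact ⟨fun a b => ⟨1, Subsingleton.elim _ _⟩⟩
  | succ n ih =>
    intro H hH hξ
    obtain ⟨M, hHM, hMi⟩ := exists_le_index_eq_two_pow hG hH n.le_succ
    have hrel : (H.subgroupOf M).index = 2 := by
      have := relIndex_mul_index hHM
      rw [hMi, hH, pow_succ, mul_comm] at this
      exact Nat.eq_of_mul_eq_mul_left (by positivity) this
    obtain ⟨ε, hε⟩ := exists_hom_of_index_two hrel
    simp only [mem_subgroupOf] at hε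
    have hmap : ∀ (g : G) (a : G ⧸ H),
        Subgroup.quotientMapOfLE hHM (g • a) = g • Subgroup.quotientMapOfLE hHM a := by
      rintro g ⟨a⟩
      rfl
    have hξM := hξ.of_le hHM
    have htM := ih M hMi hξM
    obtain ⟨c, hc, hce⟩ := exists_transfer_eq ε hξM
    obtain ⟨e, he, hee⟩ := exists_transfer_eq ε htM
    have hεξ : ε.transfer ξ ≠ 1 := by
      rw [hce, Ne, hε, ← mk_smul_pow_eq_iff, pow_smul_eq_iff_minimalPeriod_dvd,
        minimalPeriod_eq_natCard hξ, ← index, hMi, hH, Nat.pow_dvd_pow_iff_le_right (by simp)]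
      omega
    have hεt : ε.transfer (ξ * z) ≠ 1 := by
      rw [map_mul, mem_signKernel.1 hz ε.transfer, mul_one]
      exact hεξ
    rw [hee, Ne, hε, ← mk_smul_pow_eq_iff, pow_smul_eq_iff_minimalPeriod_dvd, hMi] at hεt
    apply zpowersTransitive_of_minimalPeriod_eq (a := (e : G ⧸ H))
    rw [← index, hH]
    set m := Function.minimalPeriod (fun a : G ⧸ H => (ξ * z) • a) (e : G ⧸ H) with hm
    have h1 : 2 ^ n ∣ m := by
      have h2 : (ξ * z) ^ m • (e : G ⧸ H) = e := by
        rw [pow_smul_eq_iff_minimalPeriod_dvd]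
      have h3 := congrArg (Subgroup.quotientMapOfLE hHM) h2
      rw [hmap, pow_smul_eq_iff_minimalPeriod_dvd, minimalPeriod_eq_natCard htM, ← index, hMi] at h3
      exact h3
    have h2 : m ∣ 2 ^ (n + 1) := by
      rw [← pow_smul_eq_iff_minimalPeriod_dvd, mk_smul_pow_eq_iff]
      have h3 := (hε (⟨_, he⟩ * ⟨_, he⟩)).1 (by rw [map_mul, Int.units_mul_self])
      rw [pow_succ, ← hMi, pow_mul]
      convert h3 using 1
      rw [Subgroup.coe_mul]
      group
    obtain ⟨i, hi, hi'⟩ := (Nat.dvd_prime_pow Nat.prime_two).1 h2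
    rw [hi', Nat.pow_dvd_pow_iff_le_right (by simp)] at h1
    rw [hi', Nat.pow_dvd_pow_iff_le_right (by simp)] at hεt
    rw [hi']
    congr 1
    omega

end Transitive

section Orbit

open MulAction Subgroup

variable {G : Type} [Group G] [Finite G]

omit [Finite G] in
lemma zpowersTransitive_stabilizer_iff {X : Type*} [MulAction G X] {ξ : G} {b : X} :
    ZPowersTransitive ξ (G ⧸ stabilizer G b) ↔ ∀ g : G, ∃ i : ℤ, g • b = ξ ^ i • b := by
  constructor
  · intro h g
    obtain ⟨⟨_, i, rfl⟩, hi⟩ := h.exists_smul_eq ((1 : G) : G ⧸ stabilizer G b) (g : G ⧸ _)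
    refine ⟨i, ?_⟩
    have h1 : ((ξ ^ i * 1 : G) : G ⧸ stabilizer G b) = g := hi
    rw [QuotientGroup.eq, mem_stabilizer_iff, mul_smul, inv_smul_eq_iff, mul_one] at h1
    exact h1
  · refine fun h => ⟨?_⟩
    rintro ⟨c⟩ ⟨d⟩
    obtain ⟨i, hi⟩ := h c
    obtain ⟨j, hj⟩ := h d
    refine ⟨⟨ξ ^ (j - i), j - i, rfl⟩, ?_⟩
    change ((ξ ^ (j - i) * c : G) : G ⧸ stabilizer G b) = d
    rw [QuotientGroup.eq, mem_stabilizer_iff, mul_smul, inv_smul_eq_iff, mul_smul, hi, hj,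
      smul_smul, ← zpow_add, sub_add_cancel]

lemma exists_smul_eq_zpow_mul_smul {X : Type*} [MulAction G X] (hG : IsPGroup 2 G) {ξ z : G}
    (hz : z ∈ signKernel G) {b : X} (h : ∀ g : G, ∃ i : ℤ, g • b = ξ ^ i • b) (g : G) :
    ∃ i : ℤ, g • b = (ξ * z) ^ i • b := by
  obtain ⟨k, hk⟩ := hG.index (stabilizer G b)
  exact zpowersTransitive_stabilizer_iff.1 (ZPowersTransitive.mul_of_mem_signKernel hz hG k _ hk
    (zpowersTransitive_stabilizer_iff.2 h)) g

lemma ZPowersTransitive.zpow_mem_iff {H : Subgroup G} {ξ : G} (h : ZPowersTransitive ξ (G ⧸ H))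
    (i : ℤ) : ξ ^ i ∈ H ↔ (H.index : ℤ) ∣ i := by
  rw [index, ← minimalPeriod_eq_natCard h ((1 : G) : G ⧸ H), ← zpow_smul_eq_iff_minimalPeriod_dvd,
    MulAction.Quotient.smul_coe, eq_comm, QuotientGroup.eq, inv_one, one_mul, smul_eq_mul, mul_one]

lemma exists_smul_zpow_smul_eq {X : Type*} [MulAction G X] (hG : IsPGroup 2 G) {ξ : G} {b : X}
    (h : ∀ g : G, ∃ i : ℤ, g • b = ξ ^ i • b) (p : G) (j : ℕ) (m : ℤ) :
    ∃ m' : ℤ, p • ξ ^ (2 ^ j * m) • b = ξ ^ (2 ^ j * m') • p • b := by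
  obtain ⟨k, hk⟩ := hG.index (stabilizer G b)
  have hS := zpowersTransitive_stabilizer_iff.2 h
  rcases le_or_gt j k with hj | hj
  · obtain ⟨H, hSH, hH⟩ := exists_le_index_eq_two_pow hG hk hj
    have hmem := (hS.of_le hSH).zpow_mem_iff
    rw [hH] at hmem
    push_cast at hmem
    obtain ⟨i, hi⟩ := h p
    obtain ⟨i', hi'⟩ := h (p * ξ ^ (2 ^ j * m))
    have h1 : (ξ ^ i)⁻¹ * p ∈ H := hSH <| by
      rw [mem_stabilizer_iff, mul_smul, hi, inv_smul_smul]
    have h2 : (ξ ^ i')⁻¹ * (p * ξ ^ (2 ^ j * m)) ∈ H := hSH <| by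
      rw [mem_stabilizer_iff, mul_smul, hi', inv_smul_smul]
    have h3 : ξ ^ (i' - i) ∈ H := by
      have := H.mul_mem h1 (H.mul_mem ((hmem (2 ^ j * m)).2 ⟨m, rfl⟩) (H.inv_mem h2))
      convert this using 1
      group
    obtain ⟨m', hm'⟩ := (hmem _).1 h3
    refine ⟨m', ?_⟩
    rw [← hm', hi, smul_smul, hi', smul_smul, ← zpow_add, sub_add_cancel]
  · refine ⟨0, ?_⟩
    have : ξ ^ ((2 : ℤ) ^ j * m) ∈ stabilizer G b := by
      rw [hS.zpow_mem_iff, hk]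
      push_cast
      exact dvd_mul_of_dvd_left (pow_dvd_pow _ hj.le) _
    rw [mem_stabilizer_iff.1 this, mul_zero, zpow_zero, one_smul]

end Orbit

/-! ### The Sylow subgroup containing an element with distinct two-power cycle lengths -/

section Tower

open MulAction

variable {n : ℕ}

open scoped Classical in
lemma HasDistinctTwoPowerCycles.sameCycle_of_mem {x : Equiv.Perm (Fin n)}
    (hx : HasDistinctTwoPowerCycles x) {O : Finset (Fin n)} {m : ℕ} (hO : #O = 2 ^ m)
    (hxO : ∀ a b, x.SameCycle a b → a ∈ O → b ∈ O) {a b : Fin n} (ha : a ∈ O) (hb : b ∈ O) :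
    x.SameCycle a b := by
  choose κ hκ using hx.card_eq
  obtain ⟨c, hc, hmax⟩ := O.exists_max_image κ ⟨a, ha⟩
  have hsub : ({i | x.SameCycle c i} : Finset (Fin n)) ⊆ O := fun i hi =>
    hxO c i (mem_filter.1 hi).2 hc
  have hle : #O ≤ ∑ k ∈ range (κ c + 1), 2 ^ k := by
    rw [card_eq_sum_card_fiberwise (f := κ) (t := range (κ c + 1))
      fun i hi => by simpa [Nat.lt_succ_iff] using hmax i hi]
    refine sum_le_sum fun k _ => ?_
    rcases ({i ∈ O | κ i = k} : Finset (Fin n)).eq_empty_or_nonempty with h | ⟨d, hd⟩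
    · simp [h]
    · rw [← (mem_filter.1 hd).2, ← hκ]
      refine card_le_card fun i hi => ?_
      rw [mem_filter] at hi hd ⊢
      exact ⟨mem_univ _, hx.sameCycle _ _ (by rw [hκ, hκ, hi.2, hd.2])⟩
  have hlt : #O < 2 ^ (κ c + 1) := hle.trans_lt (Nat.geomSum_lt le_rfl (by simp))
  have hge := card_le_card hsub
  rw [hκ] at hge
  have hm : m = κ c := by
    rw [hO] at hlt hge
    have h1 := (Nat.pow_lt_pow_iff_right (by simp)).1 hlt
    have h2 := (Nat.pow_le_pow_iff_right (by simp)).1 hge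
    omega
  have heq := eq_of_subset_of_card_le hsub (by rw [hO, hκ, hm])
  rw [← heq, mem_filter] at ha hb
  exact ha.2.symm.trans hb.2

lemma HasDistinctTwoPowerCycles.sameCycle_apply {x : Equiv.Perm (Fin n)}
    (hx : HasDistinctTwoPowerCycles x) {P : Subgroup (Equiv.Perm (Fin n))} (hP : IsPGroup 2 P)
    (hxP : x ∈ P) {p : Equiv.Perm (Fin n)} (hp : p ∈ P) (a : Fin n) : x.SameCycle a (p a) := by
  classical
  obtain ⟨m, hm⟩ := hP.card_orbit a
  refine hx.sameCycle_of_mem (O := (orbit P a).toFinset) (m := m) ?_ ?_ ?_ ?_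
  · rw [← hm, Nat.card_eq_card_toFinset]
  · rintro b _ ⟨i, rfl⟩ hb
    rw [Set.mem_toFinset] at hb ⊢
    exact mem_orbit_of_mem_orbit (⟨x ^ i, P.zpow_mem hxP i⟩ : P) hb
  · simp
  · rw [Set.mem_toFinset]
    exact ⟨⟨p, hp⟩, rfl⟩

/-- The permutations that fix every cycle of `x` and permute the cycles of each
`x ^ 2 ^ j`. -/
def towerSubgroup (x : Equiv.Perm (Fin n)) : Subgroup (Equiv.Perm (Fin n)) :=
  let S : Submonoid (Equiv.Perm (Fin n)) :=
    { carrier := {t | (∀ j a b, (x ^ 2 ^ j).SameCycle a b → (x ^ 2 ^ j).SameCycle (t a) (t b)) ∧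
        ∀ a, x.SameCycle a (t a)}
      one_mem' := ⟨fun _ _ _ h => h, fun _ => .refl _ _⟩
      mul_mem' := fun hs ht => ⟨fun _ _ _ h => hs.1 _ _ _ (ht.1 _ _ _ h),
        fun _ => (ht.2 _).trans (hs.2 _)⟩ }
  { S with
    inv_mem' := fun {t} ht => (Submonoid.powers_le.2 ht)
      (mem_powers_iff_mem_zpowers.2 (inv_mem (Subgroup.mem_zpowers t))) }

lemma HasDistinctTwoPowerCycles.le_towerSubgroup {x : Equiv.Perm (Fin n)}
    (hx : HasDistinctTwoPowerCycles x) {P : Subgroup (Equiv.Perm (Fin n))} (hP : IsPGroup 2 P)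
    (hxP : x ∈ P) : P ≤ towerSubgroup x := by
  refine fun p hp => ⟨fun j a b => ?_, hx.sameCycle_apply hP hxP hp⟩
  rintro ⟨m, rfl⟩
  obtain ⟨m', hm'⟩ := exists_smul_zpow_smul_eq (ξ := (⟨x, hxP⟩ : P)) (b := a) hP
    (fun g => by
      obtain ⟨i, hi⟩ := hx.sameCycle_apply hP hxP g.2 a
      exact ⟨i, hi.symm⟩) ⟨p, hp⟩ j m
  refine ⟨m', ?_⟩
  have h1 : p ((x ^ ((2 : ℤ) ^ j * m)) a) = (x ^ ((2 : ℤ) ^ j * m')) (p a) := hm'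
  rw [zpow_mul, zpow_mul] at h1
  exact_mod_cast h1.symm

lemma sameCycle_pow_two_succ {x : Equiv.Perm (Fin n)} {j : ℕ} {c d : Fin n}
    (h : (x ^ 2 ^ j).SameCycle c d) :
    (x ^ 2 ^ (j + 1)).SameCycle c d ∨ (x ^ 2 ^ (j + 1)).SameCycle ((x ^ 2 ^ j) c) d := by
  obtain ⟨m, rfl⟩ := h
  rw [pow_succ, pow_mul]
  set y := x ^ 2 ^ j
  obtain ⟨l, rfl | rfl⟩ := m.even_or_odd'
  · refine .inl ⟨l, ?_⟩
    rw [← zpow_natCast, ← zpow_mul]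
    rfl
  · refine .inr ⟨l, ?_⟩
    rw [← zpow_natCast, ← zpow_mul, ← Equiv.Perm.mul_apply, zpow_add_one]
    rfl

lemma sameCycle_pow_two_apply {x t : Equiv.Perm (Fin n)} (ht : t ∈ towerSubgroup x) (j : ℕ) :
    ∀ c, (x ^ 2 ^ j).SameCycle c ((t ^ 2 ^ j) c) := by
  induction j with
  | zero => simpa using ht.2
  | succ j ih =>
    intro c
    set u := t ^ 2 ^ j with hu
    have huT : u ∈ towerSubgroup x := (towerSubgroup x).pow_mem ht _
    rw [pow_succ 2 j, pow_mul t, ← hu, pow_two, Equiv.Perm.mul_apply, ← pow_succ]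
    rcases sameCycle_pow_two_succ (ih c) with h1 | h1
    · exact h1.trans (huT.1 _ _ _ h1)
    · have h2 := huT.1 _ _ _ h1
      rcases sameCycle_pow_two_succ (ih ((x ^ 2 ^ j) c)) with h3 | h3
      · have h4 : (x ^ 2 ^ (j + 1)).SameCycle ((x ^ 2 ^ j) c) c := by
          simpa using ((towerSubgroup x).inv_mem huT).1 _ _ _ (h3.symm.trans h1)
        exact h4.symm.trans (h3.trans h2)
      · refine .trans ⟨1, ?_⟩ (h3.trans h2)
        rw [zpow_one, pow_succ, pow_mul, pow_two, Equiv.Perm.mul_apply]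

lemma HasDistinctTwoPowerCycles.towerSubgroup_eq {x : Equiv.Perm (Fin n)}
    (hx : HasDistinctTwoPowerCycles x) (P : Sylow 2 (Equiv.Perm (Fin n))) (hxP : x ∈ P) :
    towerSubgroup x = P := by
  refine P.is_maximal' (fun t => ?_) (hx.le_towerSubgroup P.isPGroup' hxP)
  obtain ⟨j, hj⟩ := P.isPGroup' ⟨x, hxP⟩
  have hj' : x ^ 2 ^ j = 1 := congrArg Subtype.val hj
  refine ⟨j, Subtype.ext (Equiv.ext fun c => ?_)⟩
  have := sameCycle_pow_two_apply t.2 j c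
  rw [hj', Equiv.Perm.sameCycle_one] at this
  exact this.symm

open scoped Classical in
lemma zpow_apply_eq_self_iff (x : Equiv.Perm (Fin n)) (a : Fin n) (i : ℤ) :
    (x ^ i) a = a ↔ (#{b | x.SameCycle a b} : ℤ) ∣ i := by
  have : Fintype (orbit (Subgroup.zpowers x) a) := Fintype.ofFinite _
  rw [← Equiv.Perm.smul_def, zpow_smul_eq_iff_minimalPeriod_dvd, minimalPeriod_eq_card,
    ← Nat.card_eq_fintype_card]
  have : orbit (Subgroup.zpowers x) a = ({b | x.SameCycle a b} : Finset (Fin n)) := by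
    ext b
    rw [mem_coe, mem_filter_univ]
    constructor
    · rintro ⟨⟨_, i, rfl⟩, rfl⟩
      exact ⟨i, rfl⟩
    · rintro ⟨i, rfl⟩
      exact ⟨⟨_, i, rfl⟩, rfl⟩
  rw [this, Nat.card_coe_set_eq, Set.ncard_coe_finset]

lemma exists_mem_towerSubgroup_conj {x t : Equiv.Perm (Fin n)} (ht : t ∈ towerSubgroup x)
    (hxt : ∀ a b, t.SameCycle a b ↔ x.SameCycle a b) :
    ∃ g ∈ towerSubgroup x, g * x * g⁻¹ = t := by
  classical
  let r : Fin n → Fin n := fun a => (Quotient.mk (Equiv.Perm.SameCycle.setoid x) a).out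
  have hr : ∀ a, x.SameCycle (r a) a := fun a =>
    Quotient.mk_out (s := Equiv.Perm.SameCycle.setoid x) a
  have hr' : ∀ a b, x.SameCycle a b → r a = r b := fun a b h =>
    congrArg Quotient.out (Quotient.sound (s := Equiv.Perm.SameCycle.setoid x) h)
  choose i hi using hr
  have hper : ∀ (a : Fin n) (k l : ℤ), (x ^ k) a = (x ^ l) a ↔ (t ^ k) a = (t ^ l) a := by
    have h1 : ∀ (y : Equiv.Perm (Fin n)) (a : Fin n) (k l : ℤ),
        (y ^ k) a = (y ^ l) a ↔ (y ^ (k - l)) a = a := by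
      intro y a k l
      rw [sub_eq_neg_add, zpow_add, Equiv.Perm.mul_apply, zpow_neg, Equiv.Perm.inv_eq_iff_eq,
        eq_comm]
    intro a k l
    rw [h1, h1 t, zpow_apply_eq_self_iff, zpow_apply_eq_self_iff]
    simp only [hxt]
  let g : Fin n → Fin n := fun a => (t ^ i a) (r a)
  have hg : ∀ (k : ℤ) (a : Fin n), g ((x ^ k) a) = (t ^ k) (g a) := by
    intro k a
    have h1 : r ((x ^ k) a) = r a := (hr' _ _ ⟨k, rfl⟩).symm
    have h2 := hi ((x ^ k) a)
    rw [h1] at h2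
    conv_rhs at h2 => rw [← hi a]
    rw [← Equiv.Perm.mul_apply, ← zpow_add, hper] at h2
    simp only [g]
    rw [h1, h2, zpow_add, Equiv.Perm.mul_apply]
  have hxg : ∀ a, x.SameCycle (r a) (g a) := fun a => (hxt _ _).1 ⟨i a, rfl⟩
  have hinj : Function.Injective g := by
    intro a b hab
    have h1 : r a = r b := by
      have h2 := (hxg a).trans (hab ▸ (hxg b).symm)
      have h3 := hr' _ _ h2
      rwa [hr' (r a) a ⟨i a, hi a⟩, hr' (r b) b ⟨i b, hi b⟩] at h3
    have h2 : (t ^ i a) (r a) = (t ^ i b) (r a) := by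
      conv_rhs => rw [h1]
      exact hab
    rw [← hper, hi] at h2
    rw [h2, h1, hi]
  let γ : Equiv.Perm (Fin n) := Equiv.ofBijective g (Finite.injective_iff_bijective.1 hinj)
  refine ⟨γ, ⟨fun j a b => ?_, fun a => ?_⟩, ?_⟩
  · rintro ⟨m, rfl⟩
    have h1 := sameCycle_pow_two_apply ((towerSubgroup x).zpow_mem ht m) j (g a)
    have h2 : g (((x ^ 2 ^ j) ^ m) a) = ((t ^ m) ^ 2 ^ j) (g a) := by
      rw [← zpow_natCast, ← zpow_mul, hg, ← zpow_natCast, ← zpow_mul, mul_comm]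
    rw [← h2] at h1
    exact h1
  · exact Equiv.Perm.SameCycle.trans (Equiv.Perm.SameCycle.symm ⟨i a, hi a⟩) (hxg a)
  · rw [mul_inv_eq_iff_eq_mul]
    ext a
    have := hg 1 a
    rw [zpow_one, zpow_one] at this
    exact congrArg Fin.val this

lemma HasDistinctTwoPowerCycles.isConj_mul {x : Equiv.Perm (Fin n)}
    (hx : HasDistinctTwoPowerCycles x) (P : Sylow 2 (Equiv.Perm (Fin n)))
    (hxP : x ∈ (P : Subgroup (Equiv.Perm (Fin n))))
    (z : (P : Subgroup (Equiv.Perm (Fin n)))) (hz : z ∈ signKernel P) :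
    IsConj ⟨x, hxP⟩ (⟨x, hxP⟩ * z) := by
  have hT := hx.towerSubgroup_eq P hxP
  have ht : x * z ∈ (P : Subgroup (Equiv.Perm (Fin n))) := mul_mem hxP z.2
  obtain ⟨g, hg, h⟩ := exists_mem_towerSubgroup_conj (x := x) (t := x * z) (by rw [hT]; exact ht)
    fun a b => by
      constructor
      · rintro ⟨i, rfl⟩
        exact hx.sameCycle_apply P.isPGroup' hxP (zpow_mem ht i) a
      · rintro ⟨i, rfl⟩
        obtain ⟨k, hk⟩ := exists_smul_eq_zpow_mul_smul P.isPGroup' (ξ := ⟨x, hxP⟩) hz (b := a)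
          (fun g => by
            obtain ⟨i, hi⟩ := hx.sameCycle_apply P.isPGroup' hxP g.2 a
            exact ⟨i, hi.symm⟩) (⟨x, hxP⟩ ^ i)
        exact ⟨k, hk.symm⟩
  rw [hT] at hg
  exact isConj_iff.2 ⟨⟨g, hg⟩, Subtype.ext h⟩

end Tower

lemma irrX_eq_irrP' {G : Type} [Group G] {g : G} {k : ℕ} (hg : g ^ 2 ^ k = 1)
    (h : ∀ χ ∈ IrrX G g, χ g = 1 ∨ χ g = -1) : IrrX G g = IrrP' 2 G := by
  ext χ
  constructor
  · intro hχ
    obtain ⟨⟨V, hV, rfl⟩, -⟩ := id hχ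
    exact ⟨V, hV, rfl, odd_of_character_eq V hg (h _ hχ)⟩
  · rintro ⟨V, hV, rfl, hodd⟩
    exact ⟨⟨V, hV, rfl⟩, character_ne_zero_of_odd V hg hodd⟩

end TwoAdic

/-- For a `2`-adic element `x` of `S_n` with unique Sylow `2`-subgroup `P`:
`Irr^x(S_n) = Irr_{2'}(S_n)`, `Irr^x(P) = Irr_{2'}(P)`, and all these characters take
value `±1` at `x`. -/
theorem twoAdic_case (n : ℕ) (x : Equiv.Perm (Fin n)) (hx2 : IsPAdic 2 x)
    (P : Sylow 2 (Equiv.Perm (Fin n))) (hx : x ∈ (P : Subgroup (Equiv.Perm (Fin n)))) :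
    IrrX (Equiv.Perm (Fin n)) x = IrrP' 2 (Equiv.Perm (Fin n)) ∧
    IrrX ↥(P : Subgroup (Equiv.Perm (Fin n))) ⟨x, hx⟩ =
      IrrP' 2 ↥(P : Subgroup (Equiv.Perm (Fin n))) ∧
    (∀ χ ∈ IrrX (Equiv.Perm (Fin n)) x, χ x = 1 ∨ χ x = -1) ∧
    (∀ ψ ∈ IrrX ↥(P : Subgroup (Equiv.Perm (Fin n))) ⟨x, hx⟩,
      ψ ⟨x, hx⟩ = 1 ∨ ψ ⟨x, hx⟩ = -1) := by
  have hd := TwoAdic.hasDistinctTwoPowerCycles hx2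
  obtain ⟨k, hk⟩ := P.isPGroup' ⟨x, hx⟩
  have hS : ∀ χ ∈ IrrX (Equiv.Perm (Fin n)) x, χ x = 1 ∨ χ x = -1 := by
    rintro _ ⟨⟨V, hV, rfl⟩, h0⟩
    exact (hd.character_mem V).resolve_left h0
  have hP : ∀ ψ ∈ IrrX ↥(P : Subgroup (Equiv.Perm (Fin n))) ⟨x, hx⟩,
      ψ ⟨x, hx⟩ = 1 ∨ ψ ⟨x, hx⟩ = -1 := by
    rintro _ ⟨⟨V, hV, rfl⟩, h0⟩
    exact TwoAdic.character_eq_of_ne_zero (hd.isConj_mul P hx) V h0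
  exact ⟨TwoAdic.irrX_eq_irrP' (congrArg Subtype.val hk) hS, TwoAdic.irrX_eq_irrP' hk hP, hS, hP⟩

end
end

section
/- Let n ≥ 6 be an even integer with n ≢ 0 (mod 8), let y ∈ S_n be a picky element of Type II, and let P be the unique Sylow 2-subgroup of S_n containing y. Then Irr^y(S_n) = Irr_{2'}(S_n) and Irr^y(P) = Irr_{2'}(P). Moreover χ(y) ∈ {1, −1} for every χ ∈ Irr_{2'}(S_n) and for every χ ∈ Irr_{2'}(P). -/
open CategoryTheory

noncomputable section

section ClassFunctions

open scoped ComplexConjugate Matrix ComplexOrder MatrixOrder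

/-- Bessel's inequality for class functions, evaluated at a group element. -/
theorem sum_norm_sq_le_card_centralizer {G ι : Type*} [Group G] [Fintype G] [Fintype ι]
    [DecidableEq ι] (e : ι → G → ℂ) (y : G)
    (hcl : ∀ i g h, e i (h * g * h⁻¹) = e i g)
    (horth : ∀ i j, ∑ g, e i g * conj (e j g) = if i = j then (Fintype.card G : ℂ) else 0) :
    ∑ i, ‖e i y‖ ^ 2 ≤ Nat.card (Subgroup.centralizer {y}) := by
  classical
  set s : ℝ := ∑ i, ‖e i y‖ ^ 2 with hs
  have hs0 : 0 ≤ s := Finset.sum_nonneg fun i _ => by positivity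
  set F : G → ℂ := fun g => ∑ i, conj (e i y) * e i g with hF
  have hFy : F y = s := by
    simp only [hF, hs]
    push_cast
    exact Finset.sum_congr rfl fun i _ => Complex.conj_mul' _
  have hFcl : ∀ g h, F (h * g * h⁻¹) = F g := fun g h => by simp only [hF, hcl]
  have hnorm : ∑ g, ‖F g‖ ^ 2 = Fintype.card G * s := by
    have : (∑ g, ((‖F g‖ : ℂ)) ^ 2) = Fintype.card G * s := by
      calc (∑ g, ((‖F g‖ : ℂ)) ^ 2) = ∑ g, F g * conj (F g) :=
            Finset.sum_congr rfl fun g _ => (Complex.mul_conj' _).symm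
        _ = ∑ g, ∑ i, ∑ j, conj (e i y) * e j y * (e i g * conj (e j g)) := by
            refine Finset.sum_congr rfl fun g _ => ?_
            simp only [hF, map_sum, map_mul, Complex.conj_conj, Finset.sum_mul_sum]
            refine Finset.sum_congr rfl fun i _ => Finset.sum_congr rfl fun j _ => ?_
            ring
        _ = ∑ i, ∑ j, conj (e i y) * e j y * ∑ g, (e i g * conj (e j g)) := by
            rw [Finset.sum_comm]
            refine Finset.sum_congr rfl fun i _ => ?_
            rw [Finset.sum_comm]
            simp only [Finset.mul_sum]
        _ = Fintype.card G * s := by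
            simp only [horth, hs]
            push_cast
            rw [Finset.mul_sum]
            refine Finset.sum_congr rfl fun i _ => ?_
            simp only [mul_ite, mul_zero, Finset.sum_ite_eq, Finset.mem_univ, if_true]
            rw [Complex.conj_mul', mul_comm]
    exact_mod_cast this
  have hfib : ∀ g : G, (Finset.univ.filter fun h : G => h * y * h⁻¹ = g).card ≤
      Nat.card (Subgroup.centralizer {y}) := by
    intro g
    rcases (Finset.univ.filter fun h : G => h * y * h⁻¹ = g).eq_empty_or_nonempty with h0 | ⟨k, hk⟩
    · simp [h0]
    · rw [Finset.mem_filter] at hk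
      rw [Nat.card_eq_fintype_card, ← Fintype.card_coe]
      refine Fintype.card_le_of_injective (fun h => ⟨k⁻¹ * h.1, ?_⟩) ?_
      · have hh := (Finset.mem_filter.1 h.2).2
        rw [Subgroup.mem_centralizer_singleton_iff]
        have : k * y * k⁻¹ = h.1 * y * h.1⁻¹ := hk.2.trans hh.symm
        have h2 : y * k⁻¹ * h.1 = k⁻¹ * h.1 * y := by
          calc y * k⁻¹ * h.1 = k⁻¹ * (k * y * k⁻¹) * h.1 := by group
            _ = k⁻¹ * h.1 * y := by rw [this]; group
        first
          | simpa [mul_assoc] using h2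
          | simpa [mul_assoc] using h2.symm
      · intro a b hab
        have := congrArg Subtype.val hab
        exact Subtype.ext (mul_left_cancel this)
  have hkey : (Fintype.card G : ℝ) * s ^ 2 ≤ Nat.card (Subgroup.centralizer {y}) *
      (Fintype.card G * s) := by
    calc (Fintype.card G : ℝ) * s ^ 2 = ∑ h : G, ‖F (h * y * h⁻¹)‖ ^ 2 := by
          simp [hFcl, hFy, abs_of_nonneg hs0]
      _ = ∑ g : G, ∑ h ∈ Finset.univ.filter (fun h : G => h * y * h⁻¹ = g),
            ‖F (h * y * h⁻¹)‖ ^ 2 :=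
          (Finset.sum_fiberwise _ _ _).symm
      _ = ∑ g : G, ((Finset.univ.filter (fun h : G => h * y * h⁻¹ = g)).card : ℝ) *
            ‖F g‖ ^ 2 := by
          refine Finset.sum_congr rfl fun g _ => ?_
          rw [← nsmul_eq_mul]
          refine Finset.sum_eq_card_nsmul fun h hh => ?_
          rw [(Finset.mem_filter.1 hh).2]
      _ ≤ ∑ g : G, (Nat.card (Subgroup.centralizer {y}) : ℝ) * ‖F g‖ ^ 2 := by
          gcongr with g
          exact hfib g
      _ = _ := by rw [← Finset.mul_sum, hnorm]
  have hG : (0 : ℝ) < Fintype.card G := by exact_mod_cast Fintype.card_pos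
  rcases hs0.eq_or_lt with h0 | h0
  · rw [← h0]; positivity
  · have : (Fintype.card G * s) * s ≤ (Fintype.card G * s) *
        Nat.card (Subgroup.centralizer {y}) := by nlinarith
    exact le_of_mul_le_mul_left this (by positivity)

theorem FDRep.character_inv_eq_conj {G : Type} [Group G] [Fintype G] (V : FDRep ℂ G) (g : G) :
    V.character g⁻¹ = conj (V.character g) := by
  classical
  set b := Module.finBasis ℂ V
  set A : G → Matrix _ _ ℂ := fun g => LinearMap.toMatrix b b (V.ρ g) with hA
  have hmul : ∀ g h, A (g * h) = A g * A h := fun g h => by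
    simp only [hA, map_mul, Module.End.mul_eq_comp]
    exact LinearMap.toMatrix_comp b b b _ _
  have h1 : A 1 = 1 := by simp [hA, Module.End.one_eq_id]
  have htr : ∀ g, V.character g = (A g).trace := fun g => LinearMap.trace_eq_matrix_trace ℂ b _
  set H := ∑ g, (A g)ᴴ * A g with hH
  have hpd : H.PosDef := by
    have : H = (A 1)ᴴ * A 1 + ∑ g ∈ Finset.univ.erase 1, (A g)ᴴ * A g := by
      exact (Finset.add_sum_erase _ (fun g => (A g)ᴴ * A g) (Finset.mem_univ 1)).symm
    rw [this]
    refine Matrix.PosDef.add_posSemidef ?_ ?_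
    · simpa [h1] using Matrix.PosDef.one
    · exact Matrix.posSemidef_sum _ fun g _ => Matrix.posSemidef_conjTranspose_mul_self _
  have hunit : IsUnit H.det := (Matrix.isUnit_iff_isUnit_det _).1 hpd.isUnit
  have hinv : (A g)ᴴ * H * A g = H := by
    rw [hH, Finset.mul_sum, Finset.sum_mul]
    rw [← Equiv.sum_comp (Equiv.mulRight g) (fun k => (A k)ᴴ * A k)]
    refine Finset.sum_congr rfl fun k _ => ?_
    simp [hmul, Matrix.conjTranspose_mul, Matrix.mul_assoc]
  have h3 : (A g)ᴴ * H = H * A g⁻¹ := by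
    conv_rhs => rw [← hinv]
    rw [Matrix.mul_assoc _ (A g), ← hmul, mul_inv_cancel, h1, Matrix.mul_one]
  have h4 : A g⁻¹ = H⁻¹ * ((A g)ᴴ * H) := by
    rw [h3, ← Matrix.mul_assoc, Matrix.nonsing_inv_mul _ hunit, Matrix.one_mul]
  rw [htr, htr, h4, Matrix.trace_mul_comm, Matrix.mul_assoc, Matrix.mul_nonsing_inv _ hunit,
    Matrix.mul_one, Matrix.trace_conjTranspose]
  rfl

/-- A sum of `2 ^ a`-th roots of unity that vanishes has an even number of terms. -/
theorem Multiset.even_card_of_sum_roots_of_unity_eq_zero (a : ℕ) (s : Multiset ℂ)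
    (hs : ∀ z ∈ s, z ^ 2 ^ (a + 1) = 1) (h0 : s.sum = 0) : Even (Multiset.card s) := by
  have hpos : 0 < 2 ^ (a + 1) := by positivity
  have hζ := Complex.isPrimitiveRoot_exp (2 ^ (a + 1)) hpos.ne'
  set ζ := Complex.exp (2 * Real.pi * Complex.I / (2 ^ (a + 1) : ℕ))
  have : NeZero (2 ^ (a + 1)) := ⟨hpos.ne'⟩
  have key : ∃ f : Polynomial ℤ, Polynomial.aeval ζ f = s.sum ∧ f.eval 1 = Multiset.card s := by
    clear h0
    induction s using Multiset.induction with
    | empty => exact ⟨0, by simp, by simp⟩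
    | cons z s ih =>
      obtain ⟨f, hf1, hf2⟩ := ih fun w hw => hs w (Multiset.mem_cons_of_mem hw)
      obtain ⟨i, -, hi⟩ := hζ.eq_pow_of_pow_eq_one (hs z (Multiset.mem_cons_self z s))
      exact ⟨Polynomial.X ^ i + f, by simp [hf1, hi], by simp [hf2, add_comm]⟩
  obtain ⟨f, hf1, hf2⟩ := key
  have hd : Polynomial.cyclotomic (2 ^ (a + 1)) ℤ ∣ f := by
    rw [Polynomial.cyclotomic_eq_minpoly hζ hpos]
    exact minpoly.isIntegrallyClosed_dvd (hζ.isIntegral hpos) (hf1.trans h0)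
  obtain ⟨q, rfl⟩ := hd
  have : Fact (Nat.Prime 2) := ⟨Nat.prime_two⟩
  rw [Polynomial.eval_mul, Polynomial.eval_one_cyclotomic_prime_pow] at hf2
  have : (Even ((Multiset.card s : ℕ) : ℤ)) := by
    rw [← hf2]; exact (by decide : Even ((2 : ℕ) : ℤ)).mul_right _
  exact_mod_cast this

theorem FDRep.even_finrank_of_character_eq_zero {G : Type} [Group G] (V : FDRep ℂ G) (y : G)
    (a : ℕ) (hy : y ^ 2 ^ a = 1) (h0 : V.character y = 0) : Even (Module.finrank ℂ V) := by
  classical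
  set b := Module.finBasis ℂ V
  set A := LinearMap.toMatrix b b (V.ρ y) with hA
  have htr : A.trace = 0 := (LinearMap.trace_eq_matrix_trace ℂ b _).symm.trans h0
  have hpow : A ^ 2 ^ (a + 1) = 1 := by
    rw [hA, LinearMap.toMatrix_pow, ← map_pow, pow_succ, pow_mul, hy]
    simp [Module.End.one_eq_id]
  have hcard : Multiset.card A.charpoly.roots = Module.finrank ℂ V := by
    rw [(Polynomial.splits_iff_card_roots).1 (IsAlgClosed.splits _), Matrix.charpoly_natDegree_eq_dim]
    simp
  rw [← hcard]
  refine Multiset.even_card_of_sum_roots_of_unity_eq_zero a _ (fun z hz => ?_) ?_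
  · have hz' : z ∈ spectrum ℂ A := by
      rw [Matrix.mem_spectrum_iff_isRoot_charpoly]
      exact Polynomial.isRoot_of_mem_roots hz
    have := spectrum.pow_mem_pow A (2 ^ (a + 1)) hz'
    rw [hpow] at this
    cases isEmpty_or_nonempty (Fin (Module.finrank ℂ V)) with
    | inl h => simp [spectrum.of_subsingleton] at hz'
    | inr h => simpa [spectrum.one_eq] using this
  · rw [← Matrix.trace_eq_sum_roots_charpoly, htr]

/-- Let `φ` be a family of at least `|C_G(y)|` orthonormal integer valued functions, odd at `1` and
at `y`, having integral inner products with all characters. Then the irreducible characters not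
vanishing at the `2`-element `y` are those among `±φ i`. -/
theorem irrX_eq_irrP'_two_of_orthonormal {G ι : Type} [Group G] [Finite G] [Fintype ι]
    [DecidableEq ι] (y : G) (a : ℕ) (hy : y ^ 2 ^ a = 1) (φ : ι → G → ℤ)
    (hcl : ∀ i g h, φ i (h * g * h⁻¹) = φ i g)
    (horth : ∀ i j, ∑ᶠ g, φ i g * φ j g = if i = j then (Nat.card G : ℤ) else 0)
    (hint : ∀ i (V : FDRep ℂ G), ∃ c : ℤ, ∑ᶠ g, V.character g * φ i g = Nat.card G * c)
    (hoddy : ∀ i, Odd (φ i y)) (hodd1 : ∀ i, Odd (φ i 1))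
    (hcard : Nat.card (Subgroup.centralizer {y}) ≤ Fintype.card ι) :
    IrrX G y = IrrP' 2 G ∧ ∀ χ ∈ IrrP' 2 G, χ y = 1 ∨ χ y = -1 := by
  classical
  have := Fintype.ofFinite G
  simp only [finsum_eq_sum_of_fintype, Nat.card_eq_fintype_card (α := G)] at horth hint
  have hGpos : (0 : ℝ) < Fintype.card G := by exact_mod_cast Fintype.card_pos
  have hG0 : (Fintype.card G : ℂ) ≠ 0 := by exact_mod_cast Fintype.card_pos.ne'
  have horthC : ∀ i j, ∑ g, (φ i g : ℂ) * (φ j g : ℂ) =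
      if i = j then (Fintype.card G : ℂ) else 0 := fun i j => by
    have := congrArg (Int.cast : ℤ → ℂ) (horth i j)
    push_cast at this
    exact this
  have hone : ∀ i, 1 ≤ ‖(φ i y : ℂ)‖ ^ 2 := fun i => by
    have h0 : φ i y ≠ 0 := fun h => by simpa [h] using hoddy i
    rw [Complex.norm_intCast]
    exact_mod_cast one_le_pow₀ (n := 2) (Int.one_le_abs h0)
  have hcardR : (Nat.card (Subgroup.centralizer {y}) : ℝ) ≤ Fintype.card ι := by exact_mod_cast hcard
  have hφy : ∀ i, φ i y = 1 ∨ φ i y = -1 := by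
    intro i
    have hb := sum_norm_sq_le_card_centralizer (fun i g => (φ i g : ℂ)) y
      (fun i g h => by simp [hcl]) (fun i j => by simp [horthC])
    have h1 : ‖(φ i y : ℂ)‖ ^ 2 ≤ 1 := by
      have h2 : ∑ j ∈ Finset.univ.erase i, (1 : ℝ) ≤
          ∑ j ∈ Finset.univ.erase i, ‖(φ j y : ℂ)‖ ^ 2 := Finset.sum_le_sum fun j _ => hone j
      have h3 := Finset.add_sum_erase Finset.univ (fun j => ‖(φ j y : ℂ)‖ ^ 2) (Finset.mem_univ i)
      have h4 := Finset.add_sum_erase Finset.univ (fun _ : ι => (1 : ℝ)) (Finset.mem_univ i)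
      simp only [Finset.sum_const, Finset.card_univ, nsmul_eq_mul, mul_one] at h4 h2
      linarith
    rw [Complex.norm_intCast] at h1
    have h5 : |φ i y| ^ 2 ≤ 1 := by exact_mod_cast h1
    rw [sq_abs] at h5
    have h6 := hoddy i
    have h7 : -1 ≤ φ i y := by nlinarith
    have h8 : φ i y ≤ 1 := by nlinarith
    grind
  have hmain : ∀ V : FDRep ℂ G, Simple V → V.character y ≠ 0 →
      ∃ i, ∃ ε : ℤ, (ε = 1 ∨ ε = -1) ∧ ∀ g, V.character g = ε * φ i g := by
    intro V hV hVy
    have : Invertible (Nat.card G : ℂ) := invertibleOfNonzero (by simp)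
    have hself : ∑ g, V.character g * conj (V.character g) = Fintype.card G := by
      have h := FDRep.char_orthonormal V V
      rw [if_pos ⟨Iso.refl V⟩, Nat.card_eq_fintype_card, inv_mul_eq_one₀ hG0] at h
      simpa only [FDRep.character_inv_eq_conj] using h.symm
    choose c hc using fun i => hint i V
    have hc' : ∀ i, ∑ g, conj (V.character g) * φ i g = Fintype.card G * c i := fun i => by
      have := congrArg conj (hc i)
      simpa [map_sum] using this
    by_contra hcon
    have hc0 : ∀ i, c i = 0 := by
      intro i
      by_contra hci
      apply hcon
      have hexp : ∑ g, ‖V.character g - c i * φ i g‖ ^ 2 =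
          (Fintype.card G : ℝ) * (1 - (c i : ℝ) ^ 2) := by
        have : ∑ g, ((‖V.character g - c i * φ i g‖ : ℂ)) ^ 2 =
            (Fintype.card G : ℂ) * (1 - (c i : ℂ) ^ 2) := by
          have hterm : ∀ g, ((‖V.character g - c i * φ i g‖ : ℂ)) ^ 2 =
              V.character g * conj (V.character g) - c i * (V.character g * φ i g) -
              c i * (conj (V.character g) * φ i g) + c i ^ 2 * ((φ i g : ℂ) * φ i g) := by
            intro g
            rw [← Complex.mul_conj']
            simp only [map_sub, map_mul, map_intCast]
            ring
          simp only [hterm, Finset.sum_add_distrib, Finset.sum_sub_distrib, ← Finset.mul_sum,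
            hc, hc', hself, horthC, if_true]
          ring
        exact_mod_cast this
      have hnn : 0 ≤ ∑ g, ‖V.character g - c i * φ i g‖ ^ 2 :=
        Finset.sum_nonneg fun g _ => by positivity
      have hc1 : (c i : ℝ) ^ 2 ≤ 1 := by
        rw [hexp] at hnn
        nlinarith [nonneg_of_mul_nonneg_right hnn hGpos]
      have hc1' : (c i) ^ 2 ≤ 1 := by exact_mod_cast hc1
      have hc2 : c i = 1 ∨ c i = -1 := by
        have h7 : -1 ≤ c i := by nlinarith
        have h8 : c i ≤ 1 := by nlinarith
        omega
      refine ⟨i, c i, hc2, fun g => ?_⟩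
      have hz : ∑ g, ‖V.character g - c i * φ i g‖ ^ 2 = 0 := by
        rw [hexp]
        rcases hc2 with h | h <;> simp [h]
      have := (Finset.sum_eq_zero_iff_of_nonneg fun g _ => by positivity).1 hz g (Finset.mem_univ g)
      exact sub_eq_zero.1 (norm_eq_zero.1 (pow_eq_zero_iff two_ne_zero |>.1 this))
    have hb := sum_norm_sq_le_card_centralizer
      (fun (o : Option ι) g => o.elim (V.character g) fun i => (φ i g : ℂ)) y
      (fun o g h => by cases o <;> simp [hcl])
      (fun o o' => by
        cases o with
        | none =>
          cases o' with
          | none => simpa using hself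
          | some j => simpa [hc0] using hc j
        | some i =>
          cases o' with
          | none => simpa [hc0, mul_comm] using hc' i
          | some j => simpa using horthC i j)
    rw [Fintype.sum_option] at hb
    have h2 : ∑ j : ι, (1 : ℝ) ≤ ∑ j, ‖(φ j y : ℂ)‖ ^ 2 := Finset.sum_le_sum fun j _ => hone j
    simp only [Finset.sum_const, Finset.card_univ, nsmul_eq_mul, mul_one] at h2
    have h3 : 0 < ‖V.character y‖ ^ 2 := by positivity
    simp only [Option.elim] at hb
    linarith
  have hne : ∀ V : FDRep ℂ G, ¬ (2 ∣ Module.finrank ℂ V) → V.character y ≠ 0 :=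
    fun V h h0 => h (even_iff_two_dvd.1 (V.even_finrank_of_character_eq_zero y a hy h0))
  refine ⟨Set.ext fun χ => ⟨?_, ?_⟩, ?_⟩
  · rintro ⟨⟨V, hV, rfl⟩, hχ⟩
    refine ⟨V, hV, rfl, fun hd => ?_⟩
    obtain ⟨i, ε, hε, h⟩ := hmain V hV hχ
    have h1 := h 1
    rw [FDRep.char_one] at h1
    have h2 : ((Module.finrank ℂ V : ℕ) : ℤ) = ε * φ i 1 := by exact_mod_cast h1
    have h3 : (2 : ℤ) ∣ (Module.finrank ℂ V : ℕ) := by exact_mod_cast hd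
    have h4 := hodd1 i
    rcases hε with rfl | rfl <;> grind
  · rintro ⟨V, hV, rfl, hd⟩
    exact ⟨⟨V, hV, rfl⟩, hne V hd⟩
  · rintro _ ⟨V, hV, rfl, hd⟩
    obtain ⟨i, ε, hε, h⟩ := hmain V hV (hne V hd)
    rw [h y]
    rcases hε with rfl | rfl <;> rcases hφy i with h' | h' <;> simp [h']

end ClassFunctions

section Content

variable {ι τ σ : Type*} [Fintype ι]

theorem exists_perm_comp_eq_of_card_fiber_eq [DecidableEq τ] (F F' : ι → τ)
    (h : ∀ t, Fintype.card {i // F i = t} = Fintype.card {i // F' i = t}) :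
    ∃ g : Equiv.Perm ι, F' ∘ g = F := by
  refine ⟨Equiv.ofFiberEquiv fun t => Fintype.equivOfCardEq (h t), funext fun i => ?_⟩
  exact Equiv.ofFiberEquiv_map _ i

/-- Summed over all permutations, the number of fixed words of a given content is `n!`. -/
theorem sum_card_fixed_of_content [DecidableEq ι] [Fintype τ] [DecidableEq τ] (M : τ → ℕ)
    (hM : ∑ t, M t = Fintype.card ι) :
    ∑ g : Equiv.Perm ι, (Finset.univ.filter fun F : ι → τ =>
      F ∘ g = F ∧ ∀ t, Fintype.card {i // F i = t} = M t).card = (Fintype.card ι).factorial := by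
  obtain ⟨F₀, hF₀⟩ : ∃ F₀ : ι → τ, ∀ t, Fintype.card {i // F₀ i = t} = M t := by
    have e : ι ≃ Σ t, Fin (M t) := Fintype.equivOfCardEq (by simp [hM])
    refine ⟨fun i => (e i).1, fun t => ?_⟩
    rw [Fintype.card_congr (e.subtypeEquiv (q := fun x => x.1 = t) fun _ => Iff.rfl),
      Fintype.card_congr (Equiv.sigmaSubtype t), Fintype.card_fin]
  calc _ = ∑ g : Equiv.Perm ι, ∑ F : ι → τ with ∀ t, Fintype.card {i // F i = t} = M t,
        (if F ∘ g = F then 1 else 0) := by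
        refine Finset.sum_congr rfl fun g _ => ?_
        rw [← Finset.card_filter, Finset.filter_filter]
        simp only [and_comm]
    _ = ∑ F : ι → τ with ∀ t, Fintype.card {i // F i = t} = M t,
        ∑ g : Equiv.Perm ι, (if F ∘ g = F then 1 else 0) := Finset.sum_comm
    _ = ∑ F : ι → τ with ∀ t, Fintype.card {i // F i = t} = M t,
        ∑ g : Equiv.Perm ι, (if F₀ ∘ g = F then 1 else 0) := by
        refine Finset.sum_congr rfl fun F hF => ?_
        obtain ⟨k, rfl⟩ := exists_perm_comp_eq_of_card_fiber_eq F F₀ fun t => by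
          rw [hF₀, (Finset.mem_filter.1 hF).2]
        rw [← Equiv.sum_comp (Equiv.mulLeft k) fun g : Equiv.Perm ι =>
          if F₀ ∘ g = F₀ ∘ k then 1 else 0]
        rfl
    _ = ∑ g : Equiv.Perm ι, 1 := by
        rw [Finset.sum_comm]
        refine Finset.sum_congr rfl fun g _ => ?_
        rw [Finset.sum_ite_eq, if_pos]
        rw [Finset.mem_filter]
        refine ⟨Finset.mem_univ _, fun t => ?_⟩
        rw [← hF₀]
        exact Fintype.card_congr (g.subtypeEquiv fun _ => Iff.rfl)
    _ = _ := by simp [Fintype.card_perm]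

/-- The content of a word, as an exponent vector. -/
def content (f : ι → σ) : σ →₀ ℕ := ∑ i, Finsupp.single (f i) 1

theorem content_comp_perm (f : ι → σ) (g : Equiv.Perm ι) : content (f ∘ g) = content f :=
  Equiv.sum_comp g fun i => Finsupp.single (f i) 1

/-- The content of a pair of words, as a matrix. -/
def pairContent [DecidableEq σ] (f f' : ι → σ) (s : σ) : σ →₀ ℕ :=
  ∑ i, if f i = s then Finsupp.single (f' i) 1 else 0

theorem sum_pairContent [Fintype σ] [DecidableEq σ] (f f' : ι → σ) :
    ∑ s, pairContent f f' s = content f' := by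
  simp only [pairContent, content]
  rw [Finset.sum_comm]
  simp

theorem degree_pairContent [DecidableEq σ] (f f' : ι → σ) (s : σ) :
    (pairContent f f' s).degree = content f s := by
  simp only [pairContent, content, map_sum, Finsupp.finsetSum_apply, Finsupp.single_apply]
  refine Finset.sum_congr rfl fun i _ => ?_
  split_ifs <;> simp

theorem pairContent_apply [DecidableEq σ] (f f' : ι → σ) (s t : σ) :
    pairContent f f' s t = Fintype.card {i // (f i, f' i) = (s, t)} := by
  simp only [pairContent, Finsupp.finsetSum_apply, Fintype.card_subtype, Finset.card_filter]
  refine Finset.sum_congr rfl fun i _ => ?_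
  by_cases h : f i = s <;> simp [h, Finsupp.single_apply]

variable [DecidableEq ι] [Fintype σ] [DecidableEq σ]

theorem sum_card_fixed_of_pairContent (M : σ → σ →₀ ℕ)
    (hM : ∑ s, (M s).degree = Fintype.card ι) :
    ∑ g : Equiv.Perm ι, (Finset.univ.filter fun p : (ι → σ) × (ι → σ) =>
      (p.1 ∘ g = p.1 ∧ p.2 ∘ g = p.2) ∧ pairContent p.1 p.2 = M).card =
      (Fintype.card ι).factorial := by
  rw [← sum_card_fixed_of_content (ι := ι) (fun t : σ × σ => M t.1 t.2)]
  · refine Finset.sum_congr rfl fun g _ => ?_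
    refine Finset.card_equiv (Equiv.arrowProdEquivProdArrow ι (fun _ => σ) (fun _ => σ)).symm
      fun p => ?_
    simp only [Finset.mem_filter, Finset.mem_univ, true_and, funext_iff, Function.comp_apply,
      Finsupp.ext_iff, pairContent_apply, Prod.forall]
    refine and_congr ?_ Iff.rfl
    simp [Equiv.arrowProdEquivProdArrow, Prod.ext_iff, forall_and]
  · rw [Fintype.sum_prod_type, ← hM]
    exact Finset.sum_congr rfl fun s _ => (Finsupp.degree_eq_sum (M s)).symm

open MvPolynomial

/-- The sum of the monomials of all words fixed by `g`; this is the power sum symmetric polynomial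
of the cycle type of `g`. -/
def fixedWordSum (σ : Type*) [Fintype σ] [DecidableEq σ] (g : Equiv.Perm ι) : MvPolynomial σ ℤ :=
  ∑ f : ι → σ with f ∘ g = f, monomial (content f) 1

theorem coeff_fixedWordSum (g : Equiv.Perm ι) (α : σ →₀ ℕ) :
    coeff α (fixedWordSum σ g) =
      (Finset.univ.filter fun f : ι → σ => f ∘ g = f ∧ content f = α).card := by
  simp [fixedWordSum, coeff_sum, coeff_monomial, Finset.filter_filter]

/-- The complete homogeneous symmetric polynomial. -/
def completeHom (σ : Type*) [Fintype σ] (m : ℕ) : MvPolynomial σ ℤ :=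
  PowerSeries.coeff m (∏ l : σ, PowerSeries.mk fun k => (X l : MvPolynomial σ ℤ) ^ k)

theorem completeHom_eq (m : ℕ) : completeHom σ m =
    ∑ M ∈ Finset.finsuppAntidiag (Finset.univ : Finset σ) m, monomial M 1 := by
  rw [completeHom, PowerSeries.coeff_prod]
  refine Finset.sum_congr rfl fun M _ => ?_
  rw [monomial_eq, Finsupp.prod_fintype _ _ (by simp)]
  simp

theorem sum_coeff_smul_fixedWordSum (α : σ →₀ ℕ) (hα : α.degree = Fintype.card ι) :
    ∑ g : Equiv.Perm ι, coeff α (fixedWordSum σ g) • fixedWordSum σ g =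
      ((Fintype.card ι).factorial : ℤ) • ∏ s, completeHom σ (α s) := by
  ext β
  simp only [coeff_sum, coeff_smul, smul_eq_mul, completeHom_eq, Finset.prod_univ_sum]
  have hmon : ∀ M : σ → σ →₀ ℕ, ∏ s, monomial (M s) (1 : ℤ) = monomial (∑ s, M s) 1 := fun M =>
    (monomial_sum_one Finset.univ M).symm
  simp only [hmon, coeff_monomial]
  rw [← Finset.sum_filter, Finset.sum_const, nsmul_one, ← Nat.cast_mul]
  set S := (Fintype.piFinset fun s => Finset.finsuppAntidiag (Finset.univ : Finset σ) (α s)).filter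
    fun M => ∑ s, M s = β with hS
  have hmem : ∀ M, M ∈ S ↔ (∀ s, (M s).degree = α s) ∧ ∑ s, M s = β := fun M => by
    simp [hS, Finset.mem_finsuppAntidiag, Finsupp.degree_eq_sum]
  have h1 : ∀ g : Equiv.Perm ι, coeff α (fixedWordSum σ g) * coeff β (fixedWordSum σ g) =
      ((∑ M ∈ S, (Finset.univ.filter fun p : (ι → σ) × (ι → σ) =>
      (p.1 ∘ g = p.1 ∧ p.2 ∘ g = p.2) ∧ pairContent p.1 p.2 = M).card : ℕ) : ℤ) := fun g => by
    rw [coeff_fixedWordSum, coeff_fixedWordSum, ← Nat.cast_mul, ← Finset.card_product]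
    congr 1
    rw [Finset.card_eq_sum_card_fiberwise (f := fun p => pairContent p.1 p.2) (t := S)]
    · refine Finset.sum_congr rfl fun M hM => ?_
      congr 1
      ext p
      rw [hmem] at hM
      simp only [Finset.mem_filter, Finset.mem_product, Finset.mem_univ, true_and]
      constructor
      · tauto
      · rintro ⟨⟨h1, h2⟩, rfl⟩
        refine ⟨⟨⟨h1, Finsupp.ext fun s => ?_⟩, h2, ?_⟩, rfl⟩
        · rw [← degree_pairContent p.1 p.2, hM.1]
        · rw [← sum_pairContent p.1 p.2, hM.2]
    · intro p hp
      simp only [Finset.coe_product, Set.mem_prod, Finset.mem_coe, Finset.mem_filter,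
        Finset.mem_univ, true_and] at hp
      rw [Finset.mem_coe, hmem]
      exact ⟨fun s => by rw [degree_pairContent, hp.1.2], by rw [sum_pairContent, hp.2.2]⟩
  simp only [h1]
  rw [← Nat.cast_sum, Finset.sum_comm, Finset.sum_congr rfl fun M hM =>
    sum_card_fixed_of_pairContent M ?_, Finset.sum_const, smul_eq_mul, mul_comm]
  rw [← hα, Finsupp.degree_eq_sum]
  exact Finset.sum_congr rfl fun s _ => ((hmem M).1 hM).1 s

end Content

section Alternant

open MvPolynomial

variable {N : ℕ}

/-- The alternant with exponents `γ`. -/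
def alternant (γ : Fin N → ℕ) : MvPolynomial (Fin N) ℤ :=
  Matrix.det (Matrix.of fun i j => X j ^ γ i)

theorem alternant_eq_sum (γ : Fin N → ℕ) : alternant γ =
    ∑ w : Equiv.Perm (Fin N), monomial (Finsupp.equivFunOnFinite.symm (γ ∘ w))
      ((Equiv.Perm.sign w : ℤˣ) : ℤ) := by
  rw [alternant, Matrix.det_apply']
  refine Finset.sum_congr rfl fun w _ => ?_
  rw [monomial_eq, Finsupp.prod_fintype _ _ (by simp)]
  simp

theorem coeff_alternant_of_strictMono (γ β : Fin N →₀ ℕ) (hγ : StrictMono γ) (hβ : StrictMono β) :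
    coeff β (alternant γ) = if β = γ then 1 else 0 := by
  rw [alternant_eq_sum, coeff_sum]
  simp only [coeff_monomial]
  rw [Finset.sum_eq_single 1]
  · have : (Finsupp.equivFunOnFinite.symm (γ ∘ (1 : Equiv.Perm (Fin N)))) = γ := by
      ext; simp
    rw [this]
    simp [eq_comm]
  · intro w _ hw
    rw [if_neg]
    rintro rfl
    apply hw
    have h1 : Monotone (γ ∘ w) := by
      simpa using hβ.monotone
    have h2 : γ ∘ w = γ ∘ (1 : Equiv.Perm (Fin N)) :=
      Tuple.unique_monotone h1 (by simpa using hγ.monotone)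
    exact Equiv.ext fun i => hγ.injective (congrFun h2 i)
  · simp

/-- The polynomial `∏ (1 - X l t)` over `l ≠ j`. -/
def omitProd (j : Fin N) : Polynomial (MvPolynomial (Fin N) ℤ) :=
  ∏ l ∈ Finset.univ.erase j, (1 - Polynomial.C (X l) * Polynomial.X)

theorem coeff_omitProd_eq_zero (j : Fin N) (k : ℕ) (hk : N ≤ k) : (omitProd j).coeff k = 0 := by
  apply Polynomial.coeff_eq_zero_of_natDegree_lt
  have h : (omitProd j).natDegree ≤ ∑ l ∈ Finset.univ.erase j, 1 := by
    refine (Polynomial.natDegree_prod_le _ _).trans (Finset.sum_le_sum fun l _ => ?_)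
    refine (Polynomial.natDegree_sub_le _ _).trans ?_
    simp
  rw [Finset.sum_const, Finset.card_erase_of_mem (Finset.mem_univ j)] at h
  simp only [Finset.card_univ, Fintype.card_fin, smul_eq_mul, mul_one] at h
  have := j.pos
  omega

theorem PowerSeries.mk_pow_mul_one_sub {R : Type*} [CommRing R] (x : R) :
    (PowerSeries.mk fun k => x ^ k) * (1 - PowerSeries.C x * PowerSeries.X) = 1 := by
  ext k
  rw [mul_sub, mul_one, ← mul_assoc, mul_comm _ (PowerSeries.C x), mul_assoc]
  cases k with
  | zero => simp
  | succ k => simp [PowerSeries.coeff_succ_mul_X, pow_succ']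

theorem X_pow_eq_sum_completeHom (j : Fin N) (c : ℕ) : (X j : MvPolynomial (Fin N) ℤ) ^ c =
    ∑ k : Fin N, (if (k : ℕ) ≤ c then completeHom (Fin N) (c - k) else 0) *
      (omitProd j).coeff k := by
  have h : (PowerSeries.mk fun k => (X j : MvPolynomial (Fin N) ℤ) ^ k) =
      (omitProd j : PowerSeries (MvPolynomial (Fin N) ℤ)) *
        ∏ l : Fin N, PowerSeries.mk fun k => (X l : MvPolynomial (Fin N) ℤ) ^ k := by
    rw [← Finset.mul_prod_erase _ _ (Finset.mem_univ j), mul_left_comm, omitProd,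
      ← Polynomial.coeToPowerSeries.ringHom_apply, map_prod, ← Finset.prod_mul_distrib]
    rw [Finset.prod_eq_one, mul_one]
    intro l _
    rw [mul_comm]
    simpa using PowerSeries.mk_pow_mul_one_sub (X l : MvPolynomial (Fin N) ℤ)
  have h2 := congrArg (PowerSeries.coeff c) h
  rw [PowerSeries.coeff_mk, PowerSeries.coeff_mul,
    Finset.Nat.sum_antidiagonal_eq_sum_range_succ_mk] at h2
  rw [h2, Fin.sum_univ_eq_sum_range (fun k => (if k ≤ c then completeHom (Fin N) (c - k) else 0) *
      (omitProd j).coeff k) N]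
  simp only [Polynomial.coeff_coe, ite_mul, zero_mul]
  rw [← Finset.sum_filter]
  symm
  refine Finset.sum_subset_zero_on_sdiff (fun k hk => ?_) (fun k hk => ?_) (fun k hk => ?_)
  · simp only [Finset.mem_filter, Finset.mem_range] at hk ⊢
    omega
  · simp only [Finset.mem_sdiff, Finset.mem_filter, Finset.mem_range, not_and] at hk
    rw [coeff_omitProd_eq_zero j k (by grind), zero_mul]
  · rw [mul_comm, completeHom]

/-- The Jacobi–Trudi matrix attached to the exponents `γ`. -/
def jacobiTrudi (γ : Fin N → ℕ) : Matrix (Fin N) (Fin N) (MvPolynomial (Fin N) ℤ) :=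
  Matrix.of fun i k => if (k : ℕ) ≤ γ i then completeHom (Fin N) (γ i - k) else 0

theorem alternant_eq_mul_det_jacobiTrudi (γ : Fin N → ℕ) :
    alternant γ = alternant (fun i : Fin N => (i : ℕ)) * (jacobiTrudi γ).det := by
  set Q : Matrix (Fin N) (Fin N) (MvPolynomial (Fin N) ℤ) :=
    Matrix.of fun k j => (omitProd j).coeff k with hQ
  have key : ∀ γ : Fin N → ℕ, alternant γ = (jacobiTrudi γ).det * Q.det := fun γ => by
    rw [← Matrix.det_mul, alternant]
    congr 1
    ext1 i j
    rw [Matrix.mul_apply, Matrix.of_apply, X_pow_eq_sum_completeHom]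
    rfl
  have h1 : (jacobiTrudi fun i : Fin N => (i : ℕ)).det = 1 := by
    rw [Matrix.det_of_isLowerTriangular]
    · refine Finset.prod_eq_one fun i _ => ?_
      simp [jacobiTrudi, completeHom]
    · intro i j hij
      have : ¬ (j ≤ i) := not_le.2 hij
      simp [jacobiTrudi, this]
  rw [key γ, key fun i => (i : ℕ), h1, one_mul, mul_comm]

end Alternant

section FrobeniusCharacter

open MvPolynomial

variable {ι : Type*} [Fintype ι] [DecidableEq ι] {N : ℕ}

/-- The generalized character of the symmetric group attached by Frobenius' formula to the
exponent vector `β`. -/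
def frobChar (β : Fin N →₀ ℕ) (g : Equiv.Perm ι) : ℤ :=
  coeff β (alternant (fun i : Fin N => (i : ℕ)) * fixedWordSum (Fin N) g)

theorem frobChar_eq_sum (β : Fin N →₀ ℕ) (g : Equiv.Perm ι) : frobChar β g =
    ∑ w : Equiv.Perm (Fin N), if (∀ i, ((w i : Fin N) : ℕ) ≤ β i) then
      ((Equiv.Perm.sign w : ℤˣ) : ℤ) * coeff
        (Finsupp.equivFunOnFinite.symm fun i => β i - (w i : ℕ)) (fixedWordSum (Fin N) g) else 0 := by
  rw [frobChar, alternant_eq_sum, Finset.sum_mul, coeff_sum]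
  refine Finset.sum_congr rfl fun w _ => ?_
  rw [coeff_monomial_mul']
  refine if_congr Iff.rfl ?_ rfl
  congr 2
  ext i
  simp

theorem sum_frobChar_smul_fixedWordSum (γ : Fin N →₀ ℕ)
    (hγ : ∑ i, γ i = ∑ i : Fin N, (i : ℕ) + Fintype.card ι) :
    ∑ g : Equiv.Perm ι, frobChar γ g • fixedWordSum (Fin N) g =
      ((Fintype.card ι).factorial : ℤ) • (jacobiTrudi γ).det := by
  have hdet : (jacobiTrudi γ).det = ∑ w : Equiv.Perm (Fin N),
      if (∀ i, ((w i : Fin N) : ℕ) ≤ γ i) then ((Equiv.Perm.sign w : ℤˣ) : ℤ) •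
        ∏ i, completeHom (Fin N) (γ i - (w i : ℕ)) else 0 := by
    rw [← Matrix.det_transpose, Matrix.det_apply]
    refine Finset.sum_congr rfl fun w _ => ?_
    simp only [jacobiTrudi, Matrix.transpose_apply, Matrix.of_apply]
    split_ifs with h
    · rw [Units.smul_def, Finset.prod_congr rfl fun i _ => if_pos (h i)]
    · push Not at h
      obtain ⟨i, hi⟩ := h
      rw [Finset.prod_eq_zero (Finset.mem_univ i) (if_neg (by omega)), smul_zero]
  simp only [frobChar_eq_sum, Finset.sum_smul, hdet, Finset.smul_sum]
  rw [Finset.sum_comm]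
  refine Finset.sum_congr rfl fun w _ => ?_
  split_ifs with h
  · simp only [mul_smul]
    rw [← Finset.smul_sum, sum_coeff_smul_fixedWordSum, smul_comm]
    · rfl
    · rw [Finsupp.degree_eq_sum]
      have h1 : ∑ i, (γ i - (w i : ℕ)) + ∑ i, (w i : ℕ) = ∑ i, γ i := by
        rw [← Finset.sum_add_distrib]
        exact Finset.sum_congr rfl fun i _ => Nat.sub_add_cancel (h i)
      rw [Equiv.sum_comp w fun i : Fin N => (i : ℕ)] at h1
      simp only [Finsupp.equivFunOnFinite_symm_apply_apply]
      omega
  · simp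

theorem sum_frobChar_mul_frobChar (β γ : Fin N →₀ ℕ) (hβ : StrictMono β) (hγ : StrictMono γ)
    (hγs : ∑ i, γ i = ∑ i : Fin N, (i : ℕ) + Fintype.card ι) :
    ∑ g : Equiv.Perm ι, frobChar β g * frobChar γ g =
      if β = γ then ((Fintype.card ι).factorial : ℤ) else 0 := by
  have h := congrArg (fun p => coeff β (alternant (fun i : Fin N => (i : ℕ)) * p))
    (sum_frobChar_smul_fixedWordSum γ hγs)
  simp only [Finset.mul_sum, mul_smul_comm, coeff_sum, coeff_smul, smul_eq_mul,
    ← alternant_eq_mul_det_jacobiTrudi, coeff_alternant_of_strictMono γ β hγ hβ] at h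
  calc _ = ∑ g : Equiv.Perm ι, frobChar γ g *
        coeff β (alternant (fun i : Fin N => (i : ℕ)) * fixedWordSum (Fin N) g) :=
        Finset.sum_congr rfl fun g _ => mul_comm _ _
    _ = _ := by rw [h]; simp

theorem frobChar_conj (β : Fin N →₀ ℕ) (g h : Equiv.Perm ι) :
    frobChar β (h * g * h⁻¹) = frobChar β g := by
  have : fixedWordSum (Fin N) (h * g * h⁻¹) = fixedWordSum (Fin N) g := by
    refine Finset.sum_equiv (Equiv.arrowCongr h.symm (Equiv.refl (Fin N))) (fun f => ?_) fun f _ => ?_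
    · simp only [Finset.mem_filter, Finset.mem_univ, true_and, funext_iff, Function.comp_apply]
      refine ⟨fun H i => ?_, fun H i => ?_⟩
      · simpa using H (h i)
      · simpa using H (h.symm i)
    · exact congrArg (fun c => monomial c (1 : ℤ)) (content_comp_perm f h).symm
  rw [frobChar, frobChar, this]

end FrobeniusCharacter

section Integrality

theorem exists_int_sum_character_mul_trace {G W : Type} [Group G] [Finite G] [AddCommGroup W]
    [Module ℂ W] [FiniteDimensional ℂ W] (ρ : Representation ℂ G W) (V : FDRep ℂ G) :
    ∃ c : ℤ, ∑ᶠ g, V.character g * LinearMap.trace ℂ W (ρ g⁻¹) = Nat.card G * c := by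
  have := Fintype.ofFinite G
  have hG0 : (Nat.card G : ℂ) ≠ 0 := by simp
  have : Invertible (Nat.card G : ℂ) := invertibleOfNonzero hG0
  refine ⟨Module.finrank ℂ (Representation.IntertwiningMap ρ V.ρ), ?_⟩
  have h := Representation.card_inv_mul_sum_char_mul_char_eq_finrank ρ V.ρ
  rw [inv_mul_eq_iff_eq_mul₀ hG0] at h
  rw [finsum_eq_sum_of_fintype]
  exact_mod_cast h

theorem exists_int_sum_character_mul_card_fixed {G X : Type} [Group G] [Finite G] [Fintype X]
    [DecidableEq X] [MulAction G X] (V : FDRep ℂ G) :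
    ∃ c : ℤ, ∑ᶠ g, V.character g * (Fintype.card {x : X // g • x = x} : ℂ) = Nat.card G * c := by
  let ρ : Representation ℂ G (X → ℂ) :=
    { toFun := fun g => LinearMap.funLeft ℂ ℂ fun x => g⁻¹ • x
      map_one' := by ext; simp
      map_mul' := fun g h => by ext; simp [mul_smul] }
  obtain ⟨c, hc⟩ := exists_int_sum_character_mul_trace ρ V
  refine ⟨c, hc ▸ finsum_congr fun g => ?_⟩
  congr 1
  rw [LinearMap.trace_eq_matrix_trace ℂ (Pi.basisFun ℂ X), Matrix.trace, Fintype.card_subtype,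
    Finset.card_filter]
  push_cast
  refine Finset.sum_congr rfl fun x _ => ?_
  rw [Matrix.diag_apply, LinearMap.toMatrix_apply]
  simp [ρ, LinearMap.funLeft, Pi.single_apply]

theorem exists_int_sum_character_mul_unitsHom {G : Type} [Group G] [Finite G] (V : FDRep ℂ G)
    (ψ : G →* ℤˣ) :
    ∃ c : ℤ, ∑ᶠ g, V.character g * (((ψ g : ℤˣ) : ℤ) : ℂ) = Nat.card G * c := by
  let ρ : Representation ℂ G ℂ :=
    { toFun := fun g => (((ψ g : ℤˣ) : ℤ) : ℂ) • LinearMap.id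
      map_one' := by ext; simp
      map_mul' := fun g h => by ext; simp [mul_comm] }
  obtain ⟨c, hc⟩ := exists_int_sum_character_mul_trace ρ V
  refine ⟨c, hc ▸ finsum_congr fun g => ?_⟩
  simp [ρ, Int.units_inv_eq_self]

theorem exists_int_sum_character_mul_linear {G κ : Type} [Group G] [Finite G] (V : FDRep ℂ G)
    (s : Finset κ) (a : κ → ℤ) (f : κ → G → ℂ)
    (h : ∀ k ∈ s, ∃ c : ℤ, ∑ᶠ g, V.character g * f k g = Nat.card G * c) :
    ∃ c : ℤ, ∑ᶠ g, V.character g * ∑ k ∈ s, a k * f k g = Nat.card G * c := by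
  have := Fintype.ofFinite G
  choose! c hc using h
  refine ⟨∑ k ∈ s, a k * c k, ?_⟩
  push_cast
  simp only [finsum_eq_sum_of_fintype, Finset.mul_sum] at hc ⊢
  rw [Finset.sum_comm]
  refine Finset.sum_congr rfl fun k hk => ?_
  rw [mul_left_comm, ← hc k hk, Finset.mul_sum]
  exact Finset.sum_congr rfl fun g _ => by ring

variable {ι : Type} [Fintype ι] {N : ℕ}

open MvPolynomial

/-- The words of content `α`. -/
def Words (ι : Type) [Fintype ι] (α : Fin N →₀ ℕ) : Type := {f : ι → Fin N // content f = α}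

instance (α : Fin N →₀ ℕ) : DecidableEq (Words ι α) := by unfold Words; infer_instance

instance (α : Fin N →₀ ℕ) : MulAction (Equiv.Perm ι) (Words ι α) where
  smul g f := ⟨f.1 ∘ (g⁻¹ : Equiv.Perm ι), by rw [content_comp_perm, f.2]⟩
  one_smul f := Subtype.ext rfl
  mul_smul g h f := Subtype.ext rfl

theorem Words.smul_eq_iff (α : Fin N →₀ ℕ) (g : Equiv.Perm ι) (f : Words ι α) :
    g • f = f ↔ f.1 ∘ g = f.1 := by
  have h : g⁻¹ • f = f ↔ f.1 ∘ g = f.1 := Subtype.ext_iff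
  rw [← h, inv_smul_eq_iff, eq_comm]

variable [DecidableEq ι]

instance (α : Fin N →₀ ℕ) : Fintype (Words ι α) := by unfold Words; infer_instance

theorem coeff_fixedWordSum_eq_card_words (α : Fin N →₀ ℕ) (g : Equiv.Perm ι) :
    coeff α (fixedWordSum (Fin N) g) = (Fintype.card {f : Words ι α // g • f = f} : ℤ) := by
  rw [coeff_fixedWordSum, Nat.cast_inj, ← Fintype.card_subtype]
  simp only [Words.smul_eq_iff]
  refine Fintype.card_congr ?_
  exact (Equiv.subtypeEquivRight fun f => and_comm).trans
    (Equiv.subtypeSubtypeEquivSubtypeInter (fun f : ι → Fin N => content f = α)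
      fun f => f ∘ g = f).symm

theorem exists_int_sum_character_mul_frobChar (V : FDRep ℂ (Equiv.Perm ι)) (β : Fin N →₀ ℕ) :
    ∃ c : ℤ, ∑ᶠ g, V.character g * (frobChar β g : ℂ) = Nat.card (Equiv.Perm ι) * c := by
  have h := exists_int_sum_character_mul_linear V (Finset.univ : Finset (Equiv.Perm (Fin N)))
    (fun w => if (∀ i, ((w i : Fin N) : ℕ) ≤ β i) then ((Equiv.Perm.sign w : ℤˣ) : ℤ) else 0)
    (fun w g => (Fintype.card {f : Words ι (Finsupp.equivFunOnFinite.symm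
      fun i => β i - (w i : ℕ)) // g • f = f} : ℂ))
    fun w _ => exists_int_sum_character_mul_card_fixed V
  obtain ⟨c, hc⟩ := h
  refine ⟨c, hc ▸ finsum_congr fun g => ?_⟩
  rw [frobChar_eq_sum]
  push_cast
  congr 1
  refine Finset.sum_congr rfl fun w _ => ?_
  split_ifs
  · rw [coeff_fixedWordSum_eq_card_words]
    simp
  · simp

theorem coeff_fixedWordSum_modEq (α : Fin N →₀ ℕ) (y : Equiv.Perm ι) (a : ℕ)
    (hy : y ^ 2 ^ a = 1) :
    coeff α (fixedWordSum (Fin N) y) ≡ coeff α (fixedWordSum (Fin N) (1 : Equiv.Perm ι))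
      [ZMOD 2] := by
  have hp : IsPGroup 2 (Subgroup.zpowers y) := by
    refine IsPGroup.of_card (n := Nat.log 2 (orderOf y)) ?_
    obtain ⟨b, _, hb⟩ := (Nat.dvd_prime_pow Nat.prime_two).1 (orderOf_dvd_of_pow_eq_one hy)
    rw [Nat.card_zpowers, hb, Nat.log_pow (by norm_num)]
  have h := hp.card_modEq_card_fixedPoints (α := Words ι α)
  rw [coeff_fixedWordSum_eq_card_words, coeff_fixedWordSum_eq_card_words, ← Nat.cast_ofNat (R := ℤ),
    Int.natCast_modEq_iff]
  have h1 : Fintype.card {f : Words ι α // (1 : Equiv.Perm ι) • f = f} = Nat.card (Words ι α) := by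
    simp
  have h2 : Fintype.card {f : Words ι α // y • f = f} =
      Nat.card (MulAction.fixedPoints (Subgroup.zpowers y) (Words ι α)) := by
    rw [← Nat.card_eq_fintype_card]
    refine Nat.card_congr (Equiv.subtypeEquivRight fun f => ?_)
    rw [MulAction.mem_fixedPoints]
    refine ⟨fun hf => ?_, fun hf => hf ⟨y, Subgroup.mem_zpowers y⟩⟩
    have h3 : Subgroup.zpowers y ≤ MulAction.stabilizer (Equiv.Perm ι) f :=
      Subgroup.zpowers_le.2 hf
    exact fun g => h3 g.2
  rw [h1, h2]
  exact h.symm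

theorem frobChar_modEq (β : Fin N →₀ ℕ) (y : Equiv.Perm ι) (a : ℕ) (hy : y ^ 2 ^ a = 1) :
    frobChar β y ≡ frobChar β (1 : Equiv.Perm ι) [ZMOD 2] := by
  rw [frobChar_eq_sum, frobChar_eq_sum]
  refine Int.ModEq.sum fun w _ => ?_
  split_ifs
  · exact (coeff_fixedWordSum_modEq _ y a hy).mul_left _
  · rfl

end Integrality

section InjectiveVectors

variable {N : ℕ}

theorem Fin.le_apply_of_strictMono {f : Fin N → ℕ} (hf : StrictMono f) (i : Fin N) :
    (i : ℕ) ≤ f i := by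
  have h : (Finset.Iio i).image f ⊆ Finset.range (f i) := by
    intro k hk
    obtain ⟨j, hj, rfl⟩ := Finset.mem_image.1 hk
    exact Finset.mem_range.2 (hf (Finset.mem_Iio.1 hj))
  simpa [Finset.card_image_of_injective _ hf.injective] using Finset.card_le_card h

theorem strictMono_comp_sort {f : Fin N → ℕ} (hf : Function.Injective f) :
    StrictMono (f ∘ Tuple.sort f) :=
  (Tuple.monotone_sort f).strictMono_of_injective (hf.comp (Tuple.sort f).injective)

theorem sum_le_sum_of_injective {f : Fin N → ℕ} (hf : Function.Injective f) :
    ∑ i : Fin N, (i : ℕ) ≤ ∑ i, f i := by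
  rw [← Equiv.sum_comp (Tuple.sort f) f]
  exact Finset.sum_le_sum fun i _ => Fin.le_apply_of_strictMono (strictMono_comp_sort hf) i

theorem mem_range_of_sum_le {f : Fin N → ℕ} (hf : Function.Injective f) {m c : ℕ}
    (hm : ∑ i, f i ≤ ∑ i : Fin N, (i : ℕ) + m) (hc : c + m < N) : c ∈ Set.range f := by
  by_contra h
  have hne : ∀ i, f i ≠ c := fun i hi => h ⟨i, hi⟩
  set g : Fin N → ℕ := fun i => if c < f i then f i - 1 else f i with hg
  have hginj : Function.Injective g := by
    intro i j hij
    have h1 := hne i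
    have h2 := hne j
    apply hf
    simp only [hg] at hij
    split_ifs at hij <;> omega
  have hsum : ∑ i, f i = ∑ i, g i + (Finset.univ.filter fun i => c < f i).card := by
    rw [Finset.card_filter, ← Finset.sum_add_distrib]
    refine Finset.sum_congr rfl fun i _ => ?_
    simp only [hg]
    split_ifs <;> omega
  have h1 : (Finset.univ.filter fun i => ¬ c < f i).card ≤ c := by
    conv_rhs => rw [← Finset.card_range c]
    refine Finset.card_le_card_of_injOn f (fun i hi => ?_) hf.injOn
    have := hne i
    simp only [Finset.coe_filter, Finset.mem_univ, true_and, Set.mem_ofPred_eq] at hi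
    simp only [Finset.coe_range, Set.mem_Iio]
    omega
  have h2 := Finset.card_filter_add_card_filter_not (s := (Finset.univ : Finset (Fin N)))
    fun i => c < f i
  rw [Finset.card_univ, Fintype.card_fin] at h2
  have h3 := sum_le_sum_of_injective hginj
  omega

/-- The positions of `f` at which adding `r` does not create a repeated value. -/
def raisable (f : Fin N → ℕ) (r : ℕ) : Finset (Fin N) :=
  Finset.univ.filter fun i => ∀ j, f j ≠ f i + r

theorem le_card_raisable {f : Fin N → ℕ} (hf : Function.Injective f) {m r : ℕ}
    (hm : ∑ i, f i ≤ ∑ i : Fin N, (i : ℕ) + m) (hr : r + m ≤ N) :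
    r ≤ (raisable f r).card := by
  conv_lhs => rw [← Finset.card_range r]
  refine Finset.card_le_card_of_surjOn (fun i => f i % r) fun c hc => ?_
  have hcr : c < r := by simpa using hc
  obtain ⟨i₀, hi₀⟩ := mem_range_of_sum_le hf hm (show c + m < N by omega)
  obtain ⟨i, hi, hmax⟩ := Finset.exists_max_image (Finset.univ.filter fun i => f i % r = c) f
    ⟨i₀, by simp [hi₀, Nat.mod_eq_of_lt hcr]⟩
  simp only [Finset.mem_filter, Finset.mem_univ, true_and] at hi hmax
  refine ⟨i, ?_, hi⟩
  simp only [raisable, Finset.coe_filter, Finset.mem_univ, true_and, Set.mem_ofPred_eq]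
  intro j hj
  have := hmax j (by rw [hj, Nat.add_mod_right, hi])
  omega

end InjectiveVectors

section OddExponents

open MvPolynomial

variable {N : ℕ}

theorem rename_alternant (γ : Fin N → ℕ) (w : Equiv.Perm (Fin N)) :
    rename w (alternant γ) = ((Equiv.Perm.sign w : ℤˣ) : ℤ) • alternant γ := by
  rw [alternant, AlgHom.map_det]
  have h : (rename w).mapMatrix (Matrix.of fun i j : Fin N => (X j : MvPolynomial (Fin N) ℤ) ^ γ i) =
      (Matrix.of fun i j : Fin N => (X j : MvPolynomial (Fin N) ℤ) ^ γ i).submatrix id w := by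
    ext1 i j
    simp
  rw [h, Matrix.det_permute', zsmul_eq_mul]

/-- The product of the Vandermonde alternant with a power of the sum of the variables. -/
def alternantMulPow (N m : ℕ) : MvPolynomial (Fin N) ℤ :=
  alternant (fun i : Fin N => (i : ℕ)) * (∑ i, X i) ^ m

theorem coeff_mapDomain_alternantMulPow (m : ℕ) (β : Fin N →₀ ℕ) (w : Equiv.Perm (Fin N)) :
    coeff (β.mapDomain w) (alternantMulPow N m) =
      ((Equiv.Perm.sign w : ℤˣ) : ℤ) * coeff β (alternantMulPow N m) := by
  have h : rename w (alternantMulPow N m) =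
      ((Equiv.Perm.sign w : ℤˣ) : ℤ) • alternantMulPow N m := by
    rw [alternantMulPow, map_mul, rename_alternant, map_pow, map_sum, smul_mul_assoc]
    congr 3
    simp only [rename_X]
    exact Equiv.sum_comp w fun i => (X i : MvPolynomial (Fin N) ℤ)
  have h2 := coeff_rename_mapDomain w w.injective (alternantMulPow N m) β
  rw [h, coeff_smul, smul_eq_mul] at h2
  rw [← h2, ← mul_assoc, ← Units.val_mul, Int.units_mul_self, Units.val_one, one_mul]

/-- The exponents of the monomials with odd coefficient in `alternantMulPow N m`. -/
def oddExponents (N m : ℕ) : Finset (Fin N →₀ ℕ) :=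
  (map (Int.castRingHom (ZMod 2)) (alternantMulPow N m)).support

theorem mem_oddExponents (m : ℕ) (β : Fin N →₀ ℕ) :
    β ∈ oddExponents N m ↔ Odd (coeff β (alternantMulPow N m)) := by
  rw [oddExponents, mem_support_iff, coeff_map, eq_intCast, Ne,
    ZMod.intCast_zmod_eq_zero_iff_dvd, Nat.cast_ofNat, ← even_iff_two_dvd, Int.not_even_iff_odd]

theorem injective_of_mem_oddExponents {m : ℕ} {β : Fin N →₀ ℕ} (hβ : β ∈ oddExponents N m) :
    Function.Injective β := by
  intro i j hij
  by_contra hne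
  rw [mem_oddExponents] at hβ
  have h := coeff_mapDomain_alternantMulPow m β (Equiv.swap i j)
  have h2 : β.mapDomain (Equiv.swap i j) = β := by
    rw [← Finsupp.equivMapDomain_eq_mapDomain]
    ext k
    rw [Finsupp.equivMapDomain_apply, Equiv.symm_swap, Equiv.swap_apply_def]
    split_ifs with h1 h2
    · rw [h1, hij]
    · rw [h2, hij]
    · rfl
  rw [h2, Equiv.Perm.sign_swap hne] at h
  simp only [Units.val_neg, Units.val_one] at h
  have : coeff β (alternantMulPow N m) = 0 := by linarith
  simp [this] at hβ

theorem mapDomain_mem_oddExponents {m : ℕ} {β : Fin N →₀ ℕ} (hβ : β ∈ oddExponents N m)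
    (w : Equiv.Perm (Fin N)) : β.mapDomain w ∈ oddExponents N m := by
  rw [mem_oddExponents] at hβ ⊢
  rw [coeff_mapDomain_alternantMulPow]
  refine Odd.mul ?_ hβ
  rcases Int.units_eq_one_or (Equiv.Perm.sign w) with h | h <;> simp [h]

theorem sum_eq_of_mem_oddExponents {m : ℕ} {β : Fin N →₀ ℕ} (hβ : β ∈ oddExponents N m) :
    ∑ i, β i = ∑ i : Fin N, (i : ℕ) + m := by
  have h1 : (alternant fun i : Fin N => (i : ℕ)).IsHomogeneous (∑ i : Fin N, (i : ℕ)) := by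
    rw [alternant_eq_sum]
    refine IsHomogeneous.sum _ _ _ fun w _ => isHomogeneous_monomial _ ?_
    rw [Finsupp.degree_eq_sum]
    exact Equiv.sum_comp w fun i : Fin N => (i : ℕ)
  have h2 : ((∑ i, X i : MvPolynomial (Fin N) ℤ) ^ m).IsHomogeneous (1 * m) :=
    (IsHomogeneous.sum _ _ _ fun i _ => isHomogeneous_X _ _).pow m
  have h3 := (h1.mul h2).coeff_eq_zero (d := β)
  rw [mem_oddExponents, alternantMulPow] at hβ
  by_contra hne
  rw [h3] at hβ
  · simp at hβ
  · rw [Finsupp.degree_eq_sum, one_mul]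
    exact hne

theorem coeff_map_alternantMulPow_add (m a : ℕ) (β : Fin N →₀ ℕ) :
    coeff β (map (Int.castRingHom (ZMod 2)) (alternantMulPow N (m + 2 ^ a))) =
      ∑ i, if 2 ^ a ≤ β i then coeff (β - Finsupp.single i (2 ^ a))
        (map (Int.castRingHom (ZMod 2)) (alternantMulPow N m)) else 0 := by
  have h : map (Int.castRingHom (ZMod 2)) (alternantMulPow N (m + 2 ^ a)) =
      map (Int.castRingHom (ZMod 2)) (alternantMulPow N m) * ∑ i, X i ^ 2 ^ a := by
    rw [alternantMulPow, pow_add, ← mul_assoc, ← alternantMulPow, map_mul]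
    congr 1
    simp only [map_pow, map_sum, map_X]
    exact sum_pow_char_pow 2 a _ _
  rw [h, Finset.mul_sum, coeff_sum]
  refine Finset.sum_congr rfl fun i _ => ?_
  rw [X_pow_eq_monomial, coeff_mul_monomial', mul_one]
  refine if_congr ?_ rfl rfl
  exact Finsupp.single_le_iff

theorem eq_of_add_single_eq_add_single {m r : ℕ} (hr : m < r) {β γ : Fin N →₀ ℕ}
    (hβ : β ∈ oddExponents N m) (hγ : Function.Injective γ) {i j : Fin N} (hi : i ∈ raisable β r)
    (h : β + Finsupp.single i r = γ + Finsupp.single j r) : i = j := by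
  by_contra hne
  have hinj := injective_of_mem_oddExponents hβ
  have hval : ∀ k, β k + (if k = i then r else 0) = γ k + (if k = j then r else 0) := fun k => by
    simpa [Finsupp.single_apply, eq_comm] using DFunLike.congr_fun h k
  have hi' : ∀ k, β k ≠ β i + r := by simpa [raisable] using hi
  have hj := hval j
  rw [if_neg (Ne.symm hne), if_pos rfl, add_zero] at hj
  have hκ : Function.Injective (fun k => if k = j then γ j else β k) := by
    have key : ∀ k, k ≠ j → γ j ≠ β k := by
      intro k hk hjk
      by_cases hki : k = i
      · subst hki
        exact hi' j (by omega)
      · have h1 := hval k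
        rw [if_neg hki, if_neg hk] at h1
        exact hk (hγ (by omega))
    intro k l hkl
    simp only at hkl
    split_ifs at hkl with h1 h2 h2
    · rw [h1, h2]
    · exact absurd hkl (key l h2)
    · exact absurd hkl.symm (key k h1)
    · exact hinj hkl
  have h1 := sum_le_sum_of_injective hκ
  have h2 := sum_eq_of_mem_oddExponents hβ
  have h3 : ∑ k, β k = ∑ k, (if k = j then γ j else β k) + r := by
    rw [← Finset.add_sum_erase _ _ (Finset.mem_univ j),
      ← Finset.add_sum_erase (a := j) _ (fun k => if k = j then γ j else β k) (Finset.mem_univ j),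
      Finset.sum_congr rfl fun k hk => if_neg (Finset.ne_of_mem_erase hk), if_pos rfl, hj]
    ring
  omega

theorem mul_card_oddExponents_le {m a : ℕ} (hm : m < 2 ^ a) (hN : m + 2 ^ a ≤ N) :
    2 ^ a * (oddExponents N m).card ≤ (oddExponents N (m + 2 ^ a)).card := by
  have h1 : 2 ^ a * (oddExponents N m).card ≤
      ((oddExponents N m).sigma fun β => raisable β (2 ^ a)).card := by
    rw [Finset.card_sigma, mul_comm, ← smul_eq_mul]
    exact Finset.card_nsmul_le_sum _ _ _ fun β hβ =>
      le_card_raisable (injective_of_mem_oddExponents hβ) (sum_eq_of_mem_oddExponents hβ).le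
        (by omega)
  refine h1.trans (Finset.card_le_card_of_injOn
    (fun p => p.1 + Finsupp.single p.2 (2 ^ a)) ?_ ?_)
  · rintro ⟨β, i⟩ hp
    obtain ⟨hβ, hi⟩ := Finset.mem_sigma.1 hp
    simp only at hβ hi
    rw [Finset.mem_coe, oddExponents, mem_support_iff, coeff_map_alternantMulPow_add,
      Finset.sum_eq_single i]
    · rw [if_pos (by simp), add_tsub_cancel_right]
      exact mem_support_iff.1 hβ
    · intro j _ hj
      simp only
      split_ifs with hle
      · by_contra hne
        have hmem : β + Finsupp.single i (2 ^ a) - Finsupp.single j (2 ^ a) ∈ oddExponents N m :=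
          mem_support_iff.2 hne
        refine hj (eq_of_add_single_eq_add_single hm hβ (injective_of_mem_oddExponents hmem) hi
          ?_).symm
        rw [tsub_add_cancel_of_le (Finsupp.single_le_iff.2 hle)]
      · rfl
    · simp
  · rintro ⟨β, i⟩ hp ⟨γ, j⟩ hq h
    obtain ⟨hβ, hi⟩ := Finset.mem_sigma.1 hp
    obtain ⟨hγ, hj⟩ := Finset.mem_sigma.1 hq
    simp only at hβ hi hγ hj h
    obtain rfl := eq_of_add_single_eq_add_single hm hβ (injective_of_mem_oddExponents hγ) hi h
    rw [add_right_cancel h]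

theorem factorial_le_card_oddExponents_zero : N.factorial ≤ (oddExponents N 0).card := by
  have h1 : Finsupp.equivFunOnFinite.symm (fun i : Fin N => (i : ℕ)) ∈ oddExponents N 0 := by
    rw [mem_oddExponents, alternantMulPow, pow_zero, mul_one]
    have := coeff_alternant_of_strictMono
      (Finsupp.equivFunOnFinite.symm (fun i : Fin N => (i : ℕ)))
      (Finsupp.equivFunOnFinite.symm (fun i : Fin N => (i : ℕ)))
      Fin.val_strictMono Fin.val_strictMono
    rw [if_pos rfl] at this
    simp only [Finsupp.coe_equivFunOnFinite_symm] at this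
    rw [this]
    exact odd_one
  calc N.factorial = (Finset.univ : Finset (Equiv.Perm (Fin N))).card := by
        rw [Finset.card_univ, Fintype.card_perm, Fintype.card_fin]
    _ ≤ _ := by
      refine Finset.card_le_card_of_injOn (fun w =>
        (Finsupp.equivFunOnFinite.symm (fun i : Fin N => (i : ℕ))).mapDomain w)
        (fun w _ => mapDomain_mem_oddExponents h1 w) fun v _ w _ h => ?_
      simp only [← Finsupp.equivMapDomain_eq_mapDomain] at h
      have h2 : v.symm = w.symm := Equiv.ext fun i => by
        simpa [Fin.ext_iff] using DFunLike.congr_fun h i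
      exact Equiv.symm_bijective.1 h2

theorem le_card_oddExponents (S : Finset ℕ) (hS : ∑ i ∈ S, 2 ^ i ≤ N) :
    N.factorial * ∏ i ∈ S, 2 ^ i ≤ (oddExponents N (∑ i ∈ S, 2 ^ i)).card := by
  induction S using Finset.induction_on_max with
  | empty => simpa using factorial_le_card_oddExponents_zero
  | insert a s hs ih =>
    have ha : a ∉ s := fun h => lt_irrefl _ (hs a h)
    rw [Finset.sum_insert ha] at hS ⊢
    rw [Finset.prod_insert ha, add_comm, mul_left_comm]
    exact (Nat.mul_le_mul_left _ (ih ((Nat.le_add_left _ _).trans hS))).trans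
      (mul_card_oddExponents_le (Nat.geomSum_lt le_rfl hs)
        ((add_comm _ _).trans_le hS))

theorem card_oddExponents_le (m : ℕ) : (oddExponents N m).card ≤
    N.factorial * ((oddExponents N m).filter fun β : Fin N →₀ ℕ => StrictMono β).card := by
  have h : N.factorial = (Finset.univ : Finset (Equiv.Perm (Fin N))).card := by
    rw [Finset.card_univ, Fintype.card_perm, Fintype.card_fin]
  rw [h, ← Finset.card_product]
  have hval : ∀ (β : Fin N →₀ ℕ), (β.mapDomain (Tuple.sort β).symm : Fin N → ℕ) =
      β ∘ Tuple.sort β := fun β => by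
    rw [← Finsupp.equivMapDomain_eq_mapDomain]
    ext i
    simp
  refine Finset.card_le_card_of_injOn (fun β : Fin N →₀ ℕ => (Tuple.sort β, β.mapDomain (Tuple.sort β).symm))
    (fun β hβ => ?_) fun β _ γ _ h => ?_
  · simp only [Finset.coe_product, Set.mem_prod, Finset.mem_coe, Finset.mem_univ, true_and,
      Finset.mem_filter]
    refine ⟨mapDomain_mem_oddExponents hβ _, ?_⟩
    rw [hval]
    exact strictMono_comp_sort (injective_of_mem_oddExponents hβ)
  · obtain ⟨h1, h2⟩ := Prod.ext_iff.1 h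
    simp only at h1 h2
    rw [h1] at h2
    exact Finsupp.mapDomain_injective (Tuple.sort γ).symm.injective h2

theorem le_card_strictMono_oddExponents (S : Finset ℕ) (hS : ∑ i ∈ S, 2 ^ i ≤ N) :
    ∏ i ∈ S, 2 ^ i ≤
      ((oddExponents N (∑ i ∈ S, 2 ^ i)).filter fun β : Fin N →₀ ℕ => StrictMono β).card :=
  Nat.le_of_mul_le_mul_left ((le_card_oddExponents S hS).trans (card_oddExponents_le _))
    N.factorial_pos

variable {ι : Type*} [Fintype ι] [DecidableEq ι]

theorem frobChar_one (β : Fin N →₀ ℕ) : frobChar β (1 : Equiv.Perm ι) =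
    coeff β (alternantMulPow N (Fintype.card ι)) := by
  have h : fixedWordSum (Fin N) (1 : Equiv.Perm ι) = (∑ i, X i) ^ Fintype.card ι := by
    rw [← Finset.card_univ, ← Finset.prod_const, Finset.prod_univ_sum, fixedWordSum]
    refine Finset.sum_congr (by simp) fun f _ => ?_
    rw [content, monomial_sum_one]
    rfl
  rw [frobChar, h, alternantMulPow]

end OddExponents

section SignHoms

theorem two_pow_le_card_iteratedWreathProduct_hom (a : ℕ) :
    2 ^ a ≤ Nat.card (IteratedWreathProduct (Multiplicative (ZMod 2)) a →* ℤˣ) := by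
  set C := Multiplicative (ZMod 2)
  induction a with
  | zero => exact Nat.card_pos (α := PUnit →* ℤˣ)
  | succ a ih =>
    set D := IteratedWreathProduct C a
    have hC : 2 ≤ Nat.card (C →* ℤˣ) := by
      have : Nontrivial (C →* ℤˣ) :=
        ⟨1, MonoidHom.mk' (fun c : Multiplicative (ZMod 2) => if c.toAdd = 0 then 1 else -1)
          (by decide), fun h => by
            have := DFunLike.congr_fun h (Multiplicative.ofAdd 1)
            revert this
            decide⟩
      have := Finite.one_lt_card (α := C →* ℤˣ)
      omega
    let F : (D →* ℤˣ) × (C →* ℤˣ) → (RegularWreathProduct D C →* ℤˣ) := fun p =>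
      { toFun := fun w => (∏ x, p.1 (w.left x)) * p.2 w.right
        map_one' := by simp
        map_mul' := fun v w => by
          simp only [RegularWreathProduct.mul_left, RegularWreathProduct.mul_right, map_mul,
            Pi.mul_apply, Finset.prod_mul_distrib]
          have h := Equiv.prod_comp (Equiv.mulLeft v.right⁻¹) fun x => p.1 (w.left x)
          simp only [Equiv.coe_mulLeft] at h
          rw [h]
          exact mul_mul_mul_comm _ _ _ _ }
    have hF : Function.Injective F := by
      rintro ⟨θ, ε⟩ ⟨θ', ε'⟩ h
      have h1 : ε = ε' := MonoidHom.ext fun q => by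
        simpa [F] using DFunLike.congr_fun h ⟨1, q⟩
      have h2 : θ = θ' := MonoidHom.ext fun d => by
        have h3 : ∀ θ : D →* ℤˣ, ∏ x : C, θ ((Pi.mulSingle 1 d : C → D) x) = θ d := fun θ => by
          rw [Finset.prod_eq_single 1 (fun x _ hx => by simp [Pi.mulSingle_eq_of_ne hx]) (by simp)]
          simp
        simpa [F, h3] using DFunLike.congr_fun h ⟨Pi.mulSingle 1 d, 1⟩
      rw [h1, h2]
    calc 2 ^ (a + 1) = 2 ^ a * 2 := pow_succ _ _
      _ ≤ Nat.card (D →* ℤˣ) * Nat.card (C →* ℤˣ) := Nat.mul_le_mul ih hC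
      _ = Nat.card ((D →* ℤˣ) × (C →* ℤˣ)) := (Nat.card_prod _ _).symm
      _ ≤ _ := Nat.card_le_card_of_injective F hF

theorem MulEquiv.card_hom_eq {G H K : Type*} [Group G] [Group H] [Group K] (e : G ≃* H) :
    Nat.card (G →* K) = Nat.card (H →* K) :=
  Nat.card_congr (e.monoidHomCongrLeftEquiv)

theorem factorization_two_factorial_add {m a : ℕ} (hm : m < 2 ^ a) :
    (2 ^ a + m).factorial.factorization 2 =
      (2 ^ a).factorial.factorization 2 + m.factorial.factorization 2 := by
  have h1 : (Nat.choose (2 ^ a + m) m).factorization 2 = 0 := by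
    rw [Nat.factorization_choose' Nat.prime_two (Nat.lt_succ_self _), Finset.card_eq_zero,
      Finset.filter_eq_empty_iff]
    intro i _
    rw [not_le]
    rcases le_or_gt i a with hi | hi
    · rw [Nat.mod_eq_zero_of_dvd (pow_dvd_pow 2 hi), add_zero]
      exact Nat.mod_lt _ (by positivity)
    · have h2 : 2 ^ (a + 1) ≤ 2 ^ i := Nat.pow_le_pow_right (by norm_num) hi
      have := Nat.mod_le m (2 ^ i)
      have := Nat.mod_le (2 ^ a) (2 ^ i)
      rw [pow_succ] at h2
      omega
  have h2 := Nat.add_choose_mul_factorial_mul_factorial (2 ^ a) m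
  have h3 := (Nat.choose_pos (Nat.le_add_left m (2 ^ a))).ne'
  rw [← h2, Nat.factorization_mul (by positivity) (by positivity),
    Nat.factorization_mul h3 (by positivity)]
  simp [h1]

theorem card_sylow_hom_mul_le {β γ : Type} [Finite β] [Finite γ] {a : ℕ} (hβ : Nat.card β = 2 ^ a)
    (hγ : Nat.card γ < 2 ^ a) (P : Sylow 2 (Equiv.Perm β)) (Q : Sylow 2 (Equiv.Perm γ))
    (R : Sylow 2 (Equiv.Perm (β ⊕ γ))) :
    Nat.card (P →* ℤˣ) * Nat.card (Q →* ℤˣ) ≤ Nat.card (R →* ℤˣ) := by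
  let f : P × Q →* Equiv.Perm (β ⊕ γ) :=
    (Equiv.Perm.sumCongrHom β γ).comp (P.1.subtype.prodMap Q.1.subtype)
  have hf : Function.Injective f := Equiv.Perm.sumCongrHom_injective.comp
    (Function.Injective.prodMap P.1.subtype_injective Q.1.subtype_injective)
  let R' : Sylow 2 (Equiv.Perm (β ⊕ γ)) := Sylow.ofCard f.range (by
    rw [← Nat.card_congr (MonoidHom.ofInjective hf).toEquiv, Nat.card_prod, P.card_eq_multiplicity,
      Q.card_eq_multiplicity, Nat.card_perm, Nat.card_perm, Nat.card_perm, Nat.card_sum, hβ,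
      factorization_two_factorial_add hγ, pow_add])
  have e : P × Q ≃* R := (MonoidHom.ofInjective hf).trans (R'.equiv R)
  rw [← e.card_hom_eq, ← Nat.card_prod]
  refine Nat.card_le_card_of_injective (fun p => p.1.coprod p.2) fun p q h => ?_
  refine Prod.ext (MonoidHom.ext fun x => ?_) (MonoidHom.ext fun x => ?_)
  · simpa using DFunLike.congr_fun h (x, 1)
  · simpa using DFunLike.congr_fun h (1, x)

theorem prod_two_pow_le_card_sylow_hom (S : Finset ℕ) {α : Type} [Finite α]
    (hα : Nat.card α = ∑ i ∈ S, 2 ^ i) (P : Sylow 2 (Equiv.Perm α)) :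
    ∏ i ∈ S, 2 ^ i ≤ Nat.card (P →* ℤˣ) := by
  induction S using Finset.induction_on_max generalizing α with
  | empty => exact Nat.card_pos
  | insert a s hs ih =>
    have ha : a ∉ s := fun h => lt_irrefl _ (hs a h)
    rw [Finset.sum_insert ha] at hα
    rw [Finset.prod_insert ha]
    let e : α ≃ Fin (2 ^ a) ⊕ Fin (∑ i ∈ s, 2 ^ i) :=
      (Finite.equivFinOfCardEq hα).trans finSumFinEquiv.symm
    obtain ⟨Q₁⟩ : Nonempty (Sylow 2 (Equiv.Perm (Fin (2 ^ a)))) := inferInstance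
    obtain ⟨Q₂⟩ : Nonempty (Sylow 2 (Equiv.Perm (Fin (∑ i ∈ s, 2 ^ i)))) := inferInstance
    let R : Sylow 2 (Equiv.Perm (Fin (2 ^ a) ⊕ Fin (∑ i ∈ s, 2 ^ i))) :=
      Sylow.ofCard (P.1.map e.permCongrHom.toMonoidHom) (by
        rw [Subgroup.card_map_of_injective e.permCongrHom.injective, P.card_eq_multiplicity,
          Nat.card_congr e.permCongrHom.toEquiv])
    have hR : P ≃* R := P.1.equivMapOfInjective _ e.permCongrHom.injective
    rw [hR.card_hom_eq]
    refine le_trans ?_ (card_sylow_hom_mul_le (Nat.card_fin _)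
      (by rw [Nat.card_fin]; exact Nat.geomSum_lt le_rfl hs) Q₁ Q₂ R)
    refine Nat.mul_le_mul ?_ (ih (Nat.card_fin _) Q₂)
    rw [(Sylow.mulEquivIteratedWreathProduct 2 a _ (Nat.card_fin _) (Multiplicative (ZMod 2))
      (by simp) Q₁).card_hom_eq]
    exact two_pow_le_card_iteratedWreathProduct_hom a

theorem sum_unitsHom_mul_unitsHom {G : Type} [Group G] [Finite G] [DecidableEq (G →* ℤˣ)]
    (ψ θ : G →* ℤˣ) : ∑ᶠ g, ((ψ g : ℤˣ) : ℤ) * ((θ g : ℤˣ) : ℤ) =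
      if ψ = θ then (Nat.card G : ℤ) else 0 := by
  classical
  have := Fintype.ofFinite G
  have h := sum_hom_units ((Units.coeHom ℤ).comp (ψ * θ))
  rw [finsum_eq_sum_of_fintype, Nat.card_eq_fintype_card]
  have h1 : (Units.coeHom ℤ).comp (ψ * θ) = 1 ↔ ψ = θ := by
    rw [DFunLike.ext_iff, DFunLike.ext_iff]
    refine forall_congr' fun g => ?_
    rw [MonoidHom.comp_apply, Units.coeHom_apply, MonoidHom.one_apply, Units.val_eq_one,
      MonoidHom.mul_apply, mul_eq_one_iff_eq_inv, Int.units_inv_eq_self]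
  simp only [h1] at h
  simpa using h

theorem card_centralizer_subtype_le {G : Type*} [Group G] [Finite G] (H : Subgroup G) (y : H) :
    Nat.card (Subgroup.centralizer {y}) ≤ Nat.card (Subgroup.centralizer {(y : G)}) := by
  refine Nat.card_le_card_of_injective (fun g => ⟨(g.1 : G), ?_⟩) fun g h hgh => ?_
  · rw [Subgroup.mem_centralizer_singleton_iff]
    exact congrArg Subtype.val (Subgroup.mem_centralizer_singleton_iff.1 g.2)
  · exact Subtype.ext (Subtype.ext (congrArg (fun x => (x.1 : G)) hgh))

end SignHoms

section TypeII

theorem List.sum_range_getD_mul_pow (b : ℕ) (L : List ℕ) :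
    ∑ i ∈ Finset.range L.length, L.getD i 0 * b ^ i = Nat.ofDigits b L := by
  induction L with
  | nil => simp
  | cons d L ih =>
    rw [List.length_cons, Finset.sum_range_succ', Nat.ofDigits_cons, ← ih, Finset.mul_sum, add_comm]
    simp [pow_succ', mul_left_comm]

theorem exists_finset_padicCycleMultiset_two (m : ℕ) : ∃ T : Finset ℕ,
    (∀ i, i ∈ T ↔ m / 2 ^ i % 2 = 1) ∧ padicCycleMultiset 2 m = T.val.map (2 ^ ·) ∧
      ∑ i ∈ T, 2 ^ i = m := by
  have hd : ∀ i, (Nat.digits 2 m).getD i 0 = m / 2 ^ i % 2 := fun i =>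
    Nat.getD_digits m i le_rfl
  have h1 : padicCycleMultiset 2 m =
      ((Finset.range (Nat.digits 2 m).length).filter fun i => m / 2 ^ i % 2 = 1).val.map
        (2 ^ ·) := by
    rw [padicCycleMultiset, Finset.sum_congr rfl fun i _ => by rw [hd i]]
    induction Finset.range (Nat.digits 2 m).length using Finset.induction_on with
    | empty => rfl
    | insert i s hi ih =>
      rw [Finset.sum_insert hi, ih, Finset.filter_insert]
      split_ifs with h
      · rw [Finset.insert_val_of_notMem fun h => hi (Finset.mem_filter.1 h).1, h,
          Multiset.map_cons, Multiset.replicate_one, Multiset.singleton_add]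
      · rw [(by omega : m / 2 ^ i % 2 = 0), Multiset.replicate_zero, zero_add]
  refine ⟨(Finset.range (Nat.digits 2 m).length).filter fun i => m / 2 ^ i % 2 = 1, fun i => ?_,
    h1, ?_⟩
  · rw [Finset.mem_filter, and_iff_right_iff_imp, ← hd, Finset.mem_range]
    intro h
    by_contra hlt
    rw [List.getD_eq_default _ _ (not_lt.1 hlt)] at h
    exact zero_ne_one h
  · rw [Finset.sum_filter]
    conv_rhs => rw [← Nat.ofDigits_digits 2 m, ← List.sum_range_getD_mul_pow]
    refine Finset.sum_congr rfl fun i _ => ?_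
    rw [hd]
    split_ifs with h
    · rw [h, one_mul]
    · rw [(by omega : m / 2 ^ i % 2 = 0), zero_mul]

theorem exists_finset_card_centralizer_of_isTypeII {n : ℕ} (hn : 6 ≤ n) (heven : Even n)
    (h8 : n % 8 ≠ 0) {y : Equiv.Perm (Fin n)} (hy : IsTypeII y) :
    ∃ S : Finset ℕ, ∑ i ∈ S, 2 ^ i = n ∧
      Nat.card (Subgroup.centralizer {y}) = ∏ i ∈ S, 2 ^ i := by
  obtain ⟨T, hT, hTm, hTs⟩ := exists_finset_padicCycleMultiset_two (n - 2)
  have h2 : n % 2 = 0 := Nat.even_iff.1 heven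
  have h0 : 0 ∉ T := by rw [hT]; omega
  have hct : y.cycleType = T.val.map (2 ^ ·) := by
    have h := congrArg (Multiset.filter (2 ≤ ·)) hy
    have hy2 : y.cycleType.filter (2 ≤ ·) = y.cycleType :=
      Multiset.filter_eq_self.2 fun a ha => Equiv.Perm.two_le_of_mem_cycleType ha
    have hT2 : (T.val.map (2 ^ ·)).filter (2 ≤ ·) = T.val.map (2 ^ ·) :=
      Multiset.filter_eq_self.2 fun a ha => by
        obtain ⟨i, hi, rfl⟩ := Multiset.mem_map.1 ha
        exact Nat.le_self_pow (fun h => h0 (h ▸ hi)) 2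
    have hone : ∀ k, (Multiset.replicate k 1).filter (2 ≤ ·) = 0 := fun k =>
      Multiset.filter_eq_nil.2 fun a ha => by simp [Multiset.eq_of_mem_replicate ha]
    rwa [fullCycleType, hTm, Multiset.filter_add, Multiset.filter_add, hy2, hT2, hone, hone,
      add_zero, add_zero] at h
  have hnodup : y.cycleType.Nodup := by
    rw [hct]
    exact T.nodup.map (Nat.pow_right_injective le_rfl)
  have hcard : Nat.card (Subgroup.centralizer {y}) = 2 * ∏ i ∈ T, 2 ^ i := by
    rw [Equiv.Perm.nat_card_centralizer, Finset.prod_eq_one fun k hk => ?_]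
    · have h3 : y.cycleType.sum = n - 2 := by rw [hct]; exact hTs
      have h4 : y.cycleType.prod = ∏ i ∈ T, 2 ^ i := by rw [hct]; rfl
      rw [h3, h4, Fintype.card_fin, (by omega : n - (n - 2) = 2)]
      simp
    · rw [Multiset.count_eq_one_of_mem hnodup (Multiset.mem_toFinset.1 hk), Nat.factorial_one]
  by_cases h4 : n % 4 = 2
  · have h1 : 1 ∉ T := by rw [hT]; omega
    refine ⟨insert 1 T, ?_, ?_⟩
    · rw [Finset.sum_insert h1]
      omega
    · rw [Finset.prod_insert h1, hcard, pow_one]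
  · have h1 : 1 ∈ T := by rw [hT]; omega
    have h2 : 2 ∉ T.erase 1 := by
      rw [Finset.mem_erase, hT]
      omega
    refine ⟨insert 2 (T.erase 1), ?_, ?_⟩
    · have := Finset.add_sum_erase T (fun i => 2 ^ i) h1
      rw [Finset.sum_insert h2]
      omega
    · have := Finset.mul_prod_erase T (fun i => 2 ^ i) h1
      rw [Finset.prod_insert h2, hcard, ← this]
      ring

end TypeII

theorem irrX_perm_eq {n : ℕ} (S : Finset ℕ) (hS : ∑ i ∈ S, 2 ^ i = n) (y : Equiv.Perm (Fin n))
    (a : ℕ) (hy : y ^ 2 ^ a = 1)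
    (hcard : Nat.card (Subgroup.centralizer {y}) ≤ ∏ i ∈ S, 2 ^ i) :
    IrrX (Equiv.Perm (Fin n)) y = IrrP' 2 (Equiv.Perm (Fin n)) ∧
      ∀ χ ∈ IrrP' 2 (Equiv.Perm (Fin n)), χ y = 1 ∨ χ y = -1 := by
  set I := (oddExponents n n).filter fun β : Fin n →₀ ℕ => StrictMono β with hI
  have hodd : ∀ β : I, Odd (frobChar β.1 (1 : Equiv.Perm (Fin n))) := fun β => by
    rw [frobChar_one, Fintype.card_fin, ← mem_oddExponents]
    exact (Finset.mem_filter.1 β.2).1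
  refine irrX_eq_irrP'_two_of_orthonormal y a hy (fun β : I => frobChar β.1)
    (fun β g h => frobChar_conj _ g h) (fun β γ => ?_)
    (fun β V => exists_int_sum_character_mul_frobChar V β.1) (fun β => ?_) hodd ?_
  · rw [finsum_eq_sum_of_fintype, sum_frobChar_mul_frobChar _ _ (Finset.mem_filter.1 β.2).2
      (Finset.mem_filter.1 γ.2).2, Nat.card_perm, Nat.card_fin, Fintype.card_fin]
    · exact if_congr Subtype.ext_iff.symm rfl rfl
    · rw [Fintype.card_fin]
      exact sum_eq_of_mem_oddExponents (Finset.mem_filter.1 γ.2).1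
  · rw [Int.odd_iff, frobChar_modEq β.1 y a hy]
    exact Int.odd_iff.1 (hodd β)
  · refine hcard.trans ?_
    have := le_card_strictMono_oddExponents (N := n) S hS.le
    rw [hS] at this
    simpa using this

theorem irrX_sylow_perm_eq {n : ℕ} (S : Finset ℕ) (hS : ∑ i ∈ S, 2 ^ i = n)
    (P : Sylow 2 (Equiv.Perm (Fin n))) (y : P)
    (a : ℕ) (hy : y ^ 2 ^ a = 1)
    (hcard : Nat.card (Subgroup.centralizer {(y : Equiv.Perm (Fin n))}) ≤ ∏ i ∈ S, 2 ^ i) :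
    IrrX P y = IrrP' 2 P ∧ ∀ χ ∈ IrrP' 2 P, χ y = 1 ∨ χ y = -1 := by
  classical
  have := Fintype.ofFinite (P →* ℤˣ)
  have hodd : ∀ (ψ : P →* ℤˣ) g, Odd ((ψ g : ℤˣ) : ℤ) := fun ψ g => by
    rcases Int.units_eq_one_or (ψ g) with h | h <;> simp [h]
  refine irrX_eq_irrP'_two_of_orthonormal y a hy (fun (ψ : P →* ℤˣ) g => ((ψ g : ℤˣ) : ℤ))
    (fun ψ g h => by
      rw [map_mul, map_mul, map_inv, mul_comm, inv_mul_cancel_left]) sum_unitsHom_mul_unitsHom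
    (fun ψ V => exists_int_sum_character_mul_unitsHom V ψ) (fun ψ => hodd ψ y) (fun ψ => hodd ψ 1) ?_
  rw [← Nat.card_eq_fintype_card]
  exact (card_centralizer_subtype_le P.1 y).trans
    (hcard.trans (prod_two_pow_le_card_sylow_hom S (by rw [Nat.card_fin, hS]) P))

/-- For `n` even, `n ≢ 0 (mod 8)`, and `y` a picky element of Type II of `S_n` with
unique Sylow `2`-subgroup `P`: `Irr^y(S_n) = Irr_{2'}(S_n)`, `Irr^y(P) = Irr_{2'}(P)`,
and all these characters take value `±1` at `y`. -/
theorem typeII_not_eight_dvd (n : ℕ) (hn : 6 ≤ n) (heven : Even n) (h8 : n % 8 ≠ 0)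
    (y : Equiv.Perm (Fin n)) (hy : IsTypeII y)
    (P : Sylow 2 (Equiv.Perm (Fin n))) (hyP : y ∈ (P : Subgroup (Equiv.Perm (Fin n)))) :
    IrrX (Equiv.Perm (Fin n)) y = IrrP' 2 (Equiv.Perm (Fin n)) ∧
    IrrX ↥(P : Subgroup (Equiv.Perm (Fin n))) ⟨y, hyP⟩ =
      IrrP' 2 ↥(P : Subgroup (Equiv.Perm (Fin n))) ∧
    (∀ χ ∈ IrrP' 2 (Equiv.Perm (Fin n)), χ y = 1 ∨ χ y = -1) ∧
    (∀ ψ ∈ IrrP' 2 ↥(P : Subgroup (Equiv.Perm (Fin n))),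
      ψ ⟨y, hyP⟩ = 1 ∨ ψ ⟨y, hyP⟩ = -1) := by
  obtain ⟨S, hS, hcard⟩ := exists_finset_card_centralizer_of_isTypeII hn heven h8 hy
  obtain ⟨a, ha⟩ := P.isPGroup' ⟨y, hyP⟩
  obtain ⟨h1, h2⟩ := irrX_perm_eq S hS y a (congrArg Subtype.val ha) hcard.le
  obtain ⟨h3, h4⟩ := irrX_sylow_perm_eq S hS P ⟨y, hyP⟩ a ha hcard.le
  exact ⟨h1, h3, h2, h4⟩

end
end
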